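/- Let G be a vertex-minimal triangle-free, fork-free graph with chromatic number at least 4, and let C be a good 5-cycle in G on which no two consecutive vertices both have degree 3 in G. Then for any indices i, j with j not in {i−1, i, i+1} (mod 5), if v_i has degree at least 4 in G, then no vertex in N(v_i) \ V(C) is adjacent to a vertex in N(v_j) \ V(C). -/

import Mathlib

open SimpleGraph

/-- The fork: `K_{1,4}` with two edges subdivided. Vertex 0 is the center,
adjacent to leaves 1, 2 and to 3, 5; paths 0-3-4 and 0-5-6. -/
def fork : SimpleGraph (Fin 7) :=
  SimpleGraph.fromEdgeSet {s(0, 1), s(0, 2), s(0, 3), s(0, 5), s(3, 4), s(5, 6)}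

/-- A graph is fork-free if it has no induced subgraph isomorphic to the fork. -/
def ForkFree {V : Type} (G : SimpleGraph V) : Prop :=
  IsEmpty (fork ↪g G)

/-- `G` is a vertex-minimal triangle-free, fork-free graph with chromatic
number at least 4: every smaller triangle-free fork-free graph is 3-colorable. -/
def MinCex {V : Type} [Fintype V] (G : SimpleGraph V) : Prop :=
  G.CliqueFree 3 ∧ ForkFree G ∧ 4 ≤ G.chromaticNumber ∧
    ∀ (W : Type) [Fintype W] (H : SimpleGraph W),
      Fintype.card W < Fintype.card V → H.CliqueFree 3 → ForkFree H →
        H.chromaticNumber ≤ 3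

/-- `c` describes a 5-cycle in `G`. -/
def IsC5 {V : Type} (G : SimpleGraph V) (c : Fin 5 → V) : Prop :=
  Function.Injective c ∧ ∀ i : Fin 5, G.Adj (c i) (c (i + 1))

/-- Distance from a vertex `u` to the 5-cycle `c`. -/
noncomputable def distC {V : Type} (G : SimpleGraph V) (c : Fin 5 → V) (u : V) : ℕ :=
  Finset.univ.inf' Finset.univ_nonempty fun i => G.dist u (c i)

/-- A good 5-cycle: one minimizing the number of vertices at distance at least 2. -/
def GoodC5 {V : Type} (G : SimpleGraph V) (c : Fin 5 → V) : Prop :=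
  IsC5 G c ∧ ∀ d : Fin 5 → V, IsC5 G d →
    {u : V | 2 ≤ distC G c u}.ncard ≤ {u : V | 2 ≤ distC G d u}.ncard

/-! ### Consequences of minimality -/

section Minimality

variable {V : Type} [Fintype V] {G : SimpleGraph V}

theorem MinCex.not_colorable (hG : MinCex G) : ¬ G.Colorable 3 := by
  intro h
  have h3 : G.chromaticNumber ≤ 3 := h.chromaticNumber_le
  have := hG.2.2.1.trans h3
  exact absurd this (by decide)

/-- Deleting a nonempty set of vertices leaves a 3-colourable graph. -/
theorem MinCex.exists_coloring_off (hG : MinCex G) (S : Set V) (hS : S.Nonempty) :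
    ∃ φ : V → Fin 3, ∀ x y, x ∉ S → y ∉ S → G.Adj x y → φ x ≠ φ y := by
  classical
  obtain ⟨s, hs⟩ := hS
  have hcard : Fintype.card (Sᶜ : Set V) < Fintype.card V :=
    Fintype.card_subtype_lt (x := s) (by simpa using hs)
  let e := SimpleGraph.Embedding.induce (G := G) Sᶜ
  have hχ := hG.2.2.2 _ (G.induce Sᶜ) hcard (hG.1.comap ⟨e.toCopy⟩)
    ⟨fun f => hG.2.1.false (e.comp f)⟩
  obtain ⟨φ⟩ := SimpleGraph.chromaticNumber_le_iff_colorable.mp hχ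
  refine ⟨fun v => if h : v ∈ Sᶜ then φ ⟨v, h⟩ else 0, fun x y hx hy hxy => ?_⟩
  simp only [Set.mem_compl_iff, hx, hy, not_false_eq_true, dite_true]
  exact φ.valid (by simpa using hxy)

theorem MinCex.triangle_free (hG : MinCex G) {x y z : V} (hxy : G.Adj x y) (hyz : G.Adj y z)
    (hxz : G.Adj x z) : False := by
  classical
  exact hG.1 {x, y, z} (SimpleGraph.is3Clique_triple_iff.mpr ⟨hxy, hxz, hyz⟩)

end Minimality

namespace Reduction

/-! ### Labelled configurations -/

/-- A conjunction over all naturals below a bound. -/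
def allBelow : ℕ → (ℕ → Bool) → Bool
  | 0, _ => true
  | n + 1, p => p n && allBelow n p

theorem allBelow_spec {n : ℕ} {p : ℕ → Bool} (h : allBelow n p = true) :
    ∀ i < n, p i = true := by
  induction n with
  | zero => intro i hi; omega
  | succ n ih =>
    simp only [allBelow, Bool.and_eq_true] at h
    intro i hi
    rcases Nat.lt_succ_iff_lt_or_eq.mp hi with hi | rfl
    · exact ih h.2 i hi
    · exact h.1

/-- A graph on `0, …, n - 1` with `n ≤ 16`; bit `16 * i + j` of `code` records whether `i` and `j`
are adjacent. -/
structure Config where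
  n : ℕ
  code : ℕ

namespace Config

/-- The neighbours of `i`, as a bit mask followed by irrelevant higher bits. -/
def row (K : Config) (i : ℕ) : ℕ := K.code >>> (16 * i)

def adj (K : Config) (i j : ℕ) : Bool := K.code.testBit (16 * i + j)

theorem testBit_row (K : Config) (i j : ℕ) : (K.row i).testBit j = K.adj i j := by
  simp [row, adj, Nat.testBit_shiftRight]

/-- The adjacency matrix is symmetric. -/
def symm (K : Config) : Bool :=
  allBelow K.n fun i => allBelow i fun j => K.adj i j == K.adj j i

variable {V : Type} (G : SimpleGraph V)

/-- `f` places `K` in `G` as an induced subgraph. -/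
def Emb (K : Config) (f : ℕ → V) : Prop :=
  ∀ i < K.n, ∀ j < i, f i ≠ f j ∧ (K.adj i j = true ↔ G.Adj (f i) (f j))

/-- `G` has no induced copy of `K`. -/
def Absent (K : Config) : Prop := ∀ f : ℕ → V, ¬ K.Emb G f

variable {G} {K : Config} {f : ℕ → V}

theorem Emb.injOn (h : K.Emb G f) {i j : ℕ} (hi : i < K.n) (hj : j < K.n) (hf : f i = f j) :
    i = j := by
  rcases lt_trichotomy i j with hij | hij | hij
  · exact absurd hf.symm (h j hj i hij).1
  · exact hij
  · exact absurd hf (h i hi j hij).1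

theorem Emb.adj_iff (h : K.Emb G f) (hs : K.symm = true) {i j : ℕ} (hi : i < K.n) (hj : j < K.n)
    (hij : i ≠ j) : K.adj i j = true ↔ G.Adj (f i) (f j) := by
  rcases lt_or_gt_of_ne hij with hlt | hlt
  · have := allBelow_spec (allBelow_spec hs j hj) i hlt
    rw [G.adj_comm, ← (h j hj i hlt).2, eq_of_beq this]
  · exact (h i hi j hlt).2

/-- Adjacency in `K` extended by a vertex labelled `K.n` with neighbourhood `A`. -/
def extAdj (K : Config) (A x y : ℕ) : Bool :=
  bif Nat.beq x K.n then A.testBit y else bif Nat.beq y K.n then A.testBit x else K.adj x y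

end Config

/-- `T` records, below `v`, the neighbours of `u` among the vertices `f i`. -/
def Records {V : Type} (G : SimpleGraph V) (f : ℕ → V) (u : V) (v T : ℕ) : Prop :=
  (∀ i < v, T.testBit i = true ↔ G.Adj u (f i)) ∧ ∀ i, v ≤ i → T.testBit i = false

/-- A copy of the configuration at position `index` of a list inside a configuration extended by
one vertex whose neighbours within `supp` are `nbrs`. The five-bit digits of `images` are the images
of the vertices. -/
structure Witness where
  index : ℕ
  nbrs : ℕ
  supp : ℕ
  images : ℕ

namespace Witness

def image (w : Witness) (a : ℕ) : ℕ := (w.images >>> (5 * a)) % 32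

def verifyCopy (K F : Config) (w : Witness) : Bool :=
  allBelow F.n fun a =>
    (Nat.beq (w.image a) K.n || w.supp.testBit (w.image a)) &&
    allBelow a fun b => !Nat.beq (w.image a) (w.image b) &&
      (K.extAdj w.nbrs (w.image a) (w.image b) == F.adj a b)

def verify (db : List Config) (K : Config) (v : ℕ) (w : Witness) : Bool :=
  Nat.blt w.supp (2 ^ v) &&
  match db[w.index]? with
  | none => false
  | some F => verifyCopy K F w

def kills (w : Witness) (T : ℕ) : Bool := Nat.beq (T &&& w.supp) w.nbrs

variable {V : Type} {G : SimpleGraph V}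

theorem not_kills {db : List Config} {K : Config} {f : ℕ → V} {u : V} {v T : ℕ} {w : Witness}
    (hdb : ∀ F ∈ db, F.Absent G) (hK : K.Emb G f) (hs : K.symm = true) (hu : ∀ i < K.n, f i ≠ u)
    (hv : v ≤ K.n) (hT : Records G f u v T) (hw : w.verify db K v = true) : w.kills T = false := by
  by_contra hk
  rw [Bool.not_eq_false, kills, Nat.beq_eq] at hk
  simp only [verify, Bool.and_eq_true, Nat.blt_eq] at hw
  obtain ⟨hlt, hw⟩ := hw
  cases hF : db[w.index]? with
  | none => simp [hF] at hw
  | some F =>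
    simp only [hF] at hw
    have hsupp : ∀ x, w.supp.testBit x = true → x < v := fun x hx => by
      by_contra hxv
      rw [Nat.testBit_lt_two_pow
        (hlt.trans_le (Nat.pow_le_pow_right (by norm_num) (not_lt.mp hxv)))] at hx
      exact Bool.false_ne_true hx
    have hnbr : ∀ x, w.supp.testBit x = true → (w.nbrs.testBit x = true ↔ G.Adj u (f x)) := by
      intro x hx
      rw [← hk, Nat.testBit_and, hx, Bool.and_true, hT.1 x (hsupp x hx)]
    let f' : ℕ → V := fun x => if x = K.n then u else f x
    have key : ∀ x y, (x = K.n ∨ w.supp.testBit x = true) → (y = K.n ∨ w.supp.testBit y = true) →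
        x ≠ y → f' x ≠ f' y ∧ (K.extAdj w.nbrs x y = true ↔ G.Adj (f' x) (f' y)) := by
      intro x y hA hB hne
      have hbeq : Nat.beq K.n K.n = true := Nat.beq_eq.mpr rfl
      by_cases hx : x = K.n
      · have hy : y ≠ K.n := fun hy => hne (hx.trans hy.symm)
        have hyv := hB.resolve_left hy
        simp only [f', hx, hy, if_true, if_false, Config.extAdj, hbeq, cond_true]
        exact ⟨(hu y ((hsupp y hyv).trans_le hv)).symm, hnbr y hyv⟩
      · have hxv := hA.resolve_left hx
        have hxn := (hsupp x hxv).trans_le hv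
        have hx' : Nat.beq x K.n = false := by rwa [← Bool.not_eq_true, Nat.beq_eq]
        by_cases hy : y = K.n
        · simp only [f', hx, hy, if_true, if_false, Config.extAdj, hbeq, cond_true, hx', cond_false]
          exact ⟨hu x hxn, by rw [hnbr x hxv, G.adj_comm]⟩
        · have hyn := (hsupp y (hB.resolve_left hy)).trans_le hv
          have hy' : Nat.beq y K.n = false := by rwa [← Bool.not_eq_true, Nat.beq_eq]
          simp only [f', hx, hy, if_false, Config.extAdj, hx', hy', cond_false]
          exact ⟨fun h => hne (hK.injOn hxn hyn h), hK.adj_iff hs hxn hyn hne⟩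
    refine hdb F (List.mem_of_getElem? hF) (fun a => f' (w.image a)) fun a ha b hb => ?_
    have hA := allBelow_spec hw a ha
    have hB := allBelow_spec hw b (hb.trans ha)
    simp only [Bool.and_eq_true, Bool.or_eq_true, Nat.beq_eq] at hA hB
    have hab := allBelow_spec hA.2 b hb
    simp only [Bool.and_eq_true, Bool.not_eq_true', beq_iff_eq, ← Bool.not_eq_true,
      Nat.beq_eq] at hab
    rw [← hab.2]
    exact key _ _ hA.1 hB.1 hab.1

end Witness

/-! ### Enumerating the possible neighbourhoods of an outside vertex -/

/-- Every possible neighbourhood is refuted by a witness or satisfies `leaf` already on an initial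
segment of length at least `k`. -/
def scan (K : Config) (k : ℕ) (leaf : ℕ → Bool) : List (List Witness) → ℕ → ℕ → Bool
  | [], _, _ => false
  | ws :: rest, v, T =>
    ((Nat.ble k (v + 1) && leaf T) || ws.any (fun w => w.kills T) ||
      scan K k leaf rest (v + 1) T) &&
    (!Nat.beq (K.row v &&& T) 0 ||
      ((Nat.ble k (v + 1) && leaf (T ||| 2 ^ v)) || ws.any (fun w => w.kills (T ||| 2 ^ v)) ||
        scan K k leaf rest (v + 1) (T ||| 2 ^ v)))

def verifyLevels (db : List Config) (K : Config) : List (List Witness) → ℕ → Bool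
  | [], _ => true
  | ws :: rest, v => ws.all (fun w => w.verify db K (v + 1)) && verifyLevels db K rest (v + 1)

section Scan

variable {V : Type} {G : SimpleGraph V} {db : List Config} {K : Config} {f : ℕ → V} {u : V}

theorem land_ne_zero {a b : ℕ} (h : a &&& b ≠ 0) :
    ∃ i, a.testBit i = true ∧ b.testBit i = true := by
  obtain ⟨i, hi⟩ := Nat.exists_testBit_of_ne_zero h
  exact ⟨i, by simpa [Nat.testBit_and] using hi⟩

theorem Records.succ_of_not_adj {v T : ℕ} (hT : Records G f u v T) (h : ¬ G.Adj u (f v)) :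
    Records G f u (v + 1) T := by
  refine ⟨fun i hi => ?_, fun i hi => hT.2 i (by omega)⟩
  rcases Nat.lt_succ_iff_lt_or_eq.mp hi with hi | rfl
  · exact hT.1 i hi
  · simp [hT.2 i le_rfl, h]

theorem Records.succ_of_adj {v T : ℕ} (hT : Records G f u v T) (h : G.Adj u (f v)) :
    Records G f u (v + 1) (T ||| 2 ^ v) := by
  refine ⟨fun i hi => ?_, fun i hi => ?_⟩
  · rw [Nat.testBit_or, Nat.testBit_two_pow]
    rcases Nat.lt_succ_iff_lt_or_eq.mp hi with hi | rfl
    · rw [decide_eq_false (by omega), Bool.or_false]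
      exact hT.1 i hi
    · simp [h]
  · rw [Nat.testBit_or, Nat.testBit_two_pow, hT.2 i (by omega)]
    simp; omega

theorem scan_sound (hG : ∀ x y z, G.Adj x y → G.Adj y z → G.Adj x z → False)
    (hdb : ∀ F ∈ db, F.Absent G) (hK : K.Emb G f) (hs : K.symm = true)
    (hu : ∀ i < K.n, f i ≠ u) {k : ℕ} {leaf : ℕ → Bool} {P : Prop}
    (hleaf : ∀ v T, k ≤ v → v ≤ K.n → Records G f u v T → leaf T = true → P)
    (levels : List (List Witness)) (v T : ℕ) (hlen : v + levels.length ≤ K.n)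
    (hver : verifyLevels db K levels v = true) (hT : Records G f u v T)
    (h : scan K k leaf levels v T = true) : P := by
  induction levels generalizing v T with
  | nil => exact absurd h Bool.false_ne_true
  | cons ws rest ih =>
    simp only [List.length_cons] at hlen
    simp only [verifyLevels, Bool.and_eq_true, List.all_eq_true] at hver
    have step : ∀ U, Records G f u (v + 1) U →
        ((Nat.ble k (v + 1) && leaf U) || ws.any (fun w => w.kills U) ||
          scan K k leaf rest (v + 1) U) = true → P := by
      intro U hU h
      simp only [Bool.or_eq_true, Bool.and_eq_true, List.any_eq_true, Nat.ble_eq] at h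
      rcases h with (⟨hk, hl⟩ | ⟨w, hw, hkill⟩) | h
      · exact hleaf _ _ hk (by omega) hU hl
      · rw [Witness.not_kills hdb hK hs hu (by omega) hU (hver.1 w hw)] at hkill
        exact absurd hkill Bool.false_ne_true
      · exact ih _ _ (by omega) hver.2 hU h
    simp only [scan, Bool.and_eq_true] at h
    by_cases hadj : G.Adj u (f v)
    · refine step _ (hT.succ_of_adj hadj) ?_
      have h2 := h.2
      rw [Bool.or_eq_true] at h2
      refine h2.resolve_left fun h0 => ?_
      rw [Bool.not_eq_true', ← Bool.not_eq_true, Nat.beq_eq] at h0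
      obtain ⟨i, hi, hTi⟩ := land_ne_zero h0
      have hiv : i < v := by
        by_contra hiv
        rw [hT.2 i (not_lt.mp hiv)] at hTi
        exact absurd hTi Bool.false_ne_true
      rw [Config.testBit_row] at hi
      exact hG _ _ _ hadj ((hK v (by omega) i hiv).2.mp hi) ((hT.1 i hiv).mp hTi)
    · exact step _ (hT.succ_of_not_adj hadj) h.1

end Scan

/-! ### Extending a colouring to the deleted vertices -/

/-- Vertex `s` may be coloured by a class `c`, the other two classes covering `o`, if `p` is the set
of deleted vertices already in that class and every list member of `R` meets `c`. -/
def fits (K : Config) (k s c o p : ℕ) (R : List ℕ) : Bool :=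
  Nat.beq (K.row s &&& p) 0 &&
  Nat.beq (((K.code >>> (16 * s + k)) % 2 ^ (K.n - k)) &&& (o >>> k))
    ((K.code >>> (16 * s + k)) % 2 ^ (K.n - k)) &&
  R.all fun r => !Nat.beq (r &&& c) 0

/-- The deleted vertices `s, s + 1, …` can be coloured one after the other. -/
def extend (K : Config) (k c₀ c₁ c₂ : ℕ) : List (List ℕ) → ℕ → ℕ → ℕ → ℕ → Bool
  | [], _, _, _, _ => true
  | R :: Rs, s, p₀, p₁, p₂ =>
    (fits K k s c₀ (c₁ ||| c₂) p₀ R && extend K k c₀ c₁ c₂ Rs (s + 1) (p₀ ||| 2 ^ s) p₁ p₂) ||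
    (fits K k s c₁ (c₀ ||| c₂) p₁ R && extend K k c₀ c₁ c₂ Rs (s + 1) p₀ (p₁ ||| 2 ^ s) p₂) ||
    (fits K k s c₂ (c₀ ||| c₁) p₂ R && extend K k c₀ c₁ c₂ Rs (s + 1) p₀ p₁ (p₂ ||| 2 ^ s))

/-- Every colouring of the remaining vertices extends. -/
def colour (K : Config) (k : ℕ) (Rs : List (List ℕ)) : ℕ → ℕ → ℕ → ℕ → ℕ → Bool
  | 0, _, c₀, c₁, c₂ => extend K k c₀ c₁ c₂ Rs 0 0 0 0
  | m + 1, v, c₀, c₁, c₂ =>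
    extend K k c₀ c₁ c₂ Rs 0 0 0 0 ||
    ((!Nat.beq (K.row v &&& c₀) 0 || colour K k Rs m (v + 1) (c₀ ||| 2 ^ v) c₁ c₂) &&
     (!Nat.beq (K.row v &&& c₁) 0 || colour K k Rs m (v + 1) c₀ (c₁ ||| 2 ^ v) c₂) &&
     (!Nat.beq (K.row v &&& c₂) 0 || colour K k Rs m (v + 1) c₀ c₁ (c₂ ||| 2 ^ v)))

section Colour

variable {V : Type} {G : SimpleGraph V} {K : Config} {f : ℕ → V} {φ : V → Fin 3} {k : ℕ}

/-- The colour `ψ i` of the deleted vertex `i` is compatible with `ψ` below `i`, with `φ` on the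
other vertices of `K`, and with the outside vertices whose neighbourhood contains a member of
`R`. -/
structure Compatible (G : SimpleGraph V) (K : Config) (f : ℕ → V) (φ : V → Fin 3) (k : ℕ)
    (ψ : ℕ → Fin 3) (i : ℕ) (R : List ℕ) : Prop where
  below : ∀ j < i, G.Adj (f i) (f j) → ψ i ≠ ψ j
  rest : ∀ y, k ≤ y → y < K.n → G.Adj (f i) (f y) → ψ i ≠ φ (f y)
  outside : ∀ r ∈ R, ∃ y, r.testBit y = true ∧ k ≤ y ∧ y < K.n ∧ φ (f y) = ψ i

/-- The bits of `c` lie in `[k, K.n)` and have a colour in `A`. -/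
def InClass (K : Config) (f : ℕ → V) (φ : V → Fin 3) (k c : ℕ) (A : Set (Fin 3)) : Prop :=
  ∀ y, c.testBit y = true → k ≤ y ∧ y < K.n ∧ φ (f y) ∈ A

theorem InClass.union {c d : ℕ} {A B : Set (Fin 3)} (hc : InClass K f φ k c A)
    (hd : InClass K f φ k d B) : InClass K f φ k (c ||| d) (A ∪ B) := by
  intro y hy
  rw [Nat.testBit_or, Bool.or_eq_true] at hy
  rcases hy with hy | hy
  · exact ⟨(hc y hy).1, (hc y hy).2.1, Or.inl (hc y hy).2.2⟩
  · exact ⟨(hd y hy).1, (hd y hy).2.1, Or.inr (hd y hy).2.2⟩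

theorem InClass.mono {c : ℕ} {A B : Set (Fin 3)} (hc : InClass K f φ k c A) (h : A ⊆ B) :
    InClass K f φ k c B :=
  fun y hy => ⟨(hc y hy).1, (hc y hy).2.1, h (hc y hy).2.2⟩

theorem InClass.insert {c v : ℕ} {A : Set (Fin 3)} (hc : InClass K f φ k c A) (hk : k ≤ v)
    (hv : v < K.n) (hφ : φ (f v) ∈ A) : InClass K f φ k (c ||| 2 ^ v) A := by
  intro y hy
  rw [Nat.testBit_or, Bool.or_eq_true, Nat.testBit_two_pow, decide_eq_true_eq] at hy
  rcases hy with hy | rfl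
  · exact hc y hy
  · exact ⟨hk, hv, hφ⟩

theorem fits_sound (hK : K.Emb G f) (hs : K.symm = true) (hkn : k ≤ K.n) {s c o p : ℕ}
    {R : List ℕ} (hsk : s < k) {a : Fin 3} (hc : InClass K f φ k c {a})
    (ho : InClass K f φ k o {a}ᶜ) {ψ : ℕ → Fin 3} (hψ : ψ s = a)
    (hp : ∀ j < s, ψ j = a → p.testBit j = true) (h : fits K k s c o p R = true) :
    Compatible G K f φ k ψ s R := by
  simp only [fits, Bool.and_eq_true, Nat.beq_eq, List.all_eq_true, Bool.not_eq_true',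
    ← Bool.not_eq_true] at h
  obtain ⟨⟨h1, h2⟩, h3⟩ := h
  refine ⟨fun j hj hadj hne => ?_, fun y hky hyn hadj hne => ?_, fun r hr => ?_⟩
  · have hbit : (K.row s &&& p).testBit j = true := by
      rw [Nat.testBit_and, Config.testBit_row, (hK s (by omega) j hj).2.mpr hadj,
        hp j hj (by rw [← hne, hψ])]
      rfl
    rw [h1, Nat.zero_testBit] at hbit
    exact Bool.false_ne_true hbit
  · have hbit : ((K.code >>> (16 * s + k)) % 2 ^ (K.n - k)).testBit (y - k) = true := by
      rw [Nat.testBit_mod_two_pow, Nat.testBit_shiftRight,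
        (by omega : 16 * s + k + (y - k) = 16 * s + y)]
      have := (hK.adj_iff hs (by omega) hyn (by omega : s ≠ y)).mpr hadj
      rw [Config.adj] at this
      simp only [this, Bool.and_true, decide_eq_true_eq]
      omega
    rw [← h2, Nat.testBit_and, Bool.and_eq_true, Nat.testBit_shiftRight,
      (by omega : k + (y - k) = y)] at hbit
    exact (ho y hbit.2).2.2 (by rw [← hne, hψ]; rfl)
  · obtain ⟨y, hy, hyc⟩ := land_ne_zero (h3 r hr)
    obtain ⟨h1, h2, h3⟩ := hc y hyc
    exact ⟨y, hy, h1, h2, by rw [hψ]; exact h3⟩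

theorem extend_sound (hK : K.Emb G f) (hs : K.symm = true) (hkn : k ≤ K.n) {c₀ c₁ c₂ : ℕ}
    (h₀ : InClass K f φ k c₀ {0}) (h₁ : InClass K f φ k c₁ {1}) (h₂ : InClass K f φ k c₂ {2})
    (Rs : List (List ℕ)) (s p₀ p₁ p₂ : ℕ) (hlen : s + Rs.length ≤ k) (ψ₀ : ℕ → Fin 3)
    (hp₀ : ∀ j < s, ψ₀ j = 0 → p₀.testBit j = true)
    (hp₁ : ∀ j < s, ψ₀ j = 1 → p₁.testBit j = true)
    (hp₂ : ∀ j < s, ψ₀ j = 2 → p₂.testBit j = true)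
    (h : extend K k c₀ c₁ c₂ Rs s p₀ p₁ p₂ = true) :
    ∃ ψ : ℕ → Fin 3, (∀ j < s, ψ j = ψ₀ j) ∧
      ∀ i R, Rs[i]? = some R → Compatible G K f φ k ψ (s + i) R := by
  induction Rs generalizing s p₀ p₁ p₂ ψ₀ with
  | nil => exact ⟨ψ₀, fun _ _ => rfl, fun i R hR => by simp at hR⟩
  | cons R Rs ih =>
    simp only [List.length_cons] at hlen
    have hbit : ∀ (a b : Fin 3) (p : ℕ), (∀ j < s, ψ₀ j = b → p.testBit j = true) →
        ∀ j < s + 1, Function.update ψ₀ s a j = b →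
          (p ||| 2 ^ s).testBit j = true := by
      intro a b p hp j hj hb
      rw [Nat.testBit_or, Nat.testBit_two_pow]
      by_cases hjs : j = s
      · simp [hjs]
      · rw [Function.update_of_ne hjs] at hb
        rw [hp j (by omega) hb, Bool.true_or]
    have hbit' : ∀ (a b : Fin 3) (p : ℕ), a ≠ b → (∀ j < s, ψ₀ j = b → p.testBit j = true) →
        ∀ j < s + 1, Function.update ψ₀ s a j = b → p.testBit j = true := by
      intro a b p hab hp j hj hb
      by_cases hjs : j = s
      · rw [hjs, Function.update_self] at hb
        exact absurd hb hab
      · rw [Function.update_of_ne hjs] at hb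
        exact hp j (by omega) hb
    have finish : ∀ (a : Fin 3) (c o p : ℕ), InClass K f φ k c {a} → InClass K f φ k o {a}ᶜ →
        (∀ j < s, ψ₀ j = a → p.testBit j = true) → fits K k s c o p R = true →
        (∃ ψ : ℕ → Fin 3, (∀ j < s + 1, ψ j = Function.update ψ₀ s a j) ∧
          ∀ i R', Rs[i]? = some R' → Compatible G K f φ k ψ (s + 1 + i) R') →
        ∃ ψ : ℕ → Fin 3, (∀ j < s, ψ j = ψ₀ j) ∧
          ∀ i R', (R :: Rs)[i]? = some R' → Compatible G K f φ k ψ (s + i) R' := by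
      rintro a c o p hc ho hp hfit ⟨ψ, hψ, hψ'⟩
      have hlow : ∀ j < s, ψ j = ψ₀ j := fun j hj => by
        rw [hψ j (by omega), Function.update_of_ne (by omega)]
      refine ⟨ψ, hlow, fun i R' hR' => ?_⟩
      cases i with
      | zero =>
        simp only [List.getElem?_cons_zero, Option.some.injEq] at hR'
        subst hR'
        rw [Nat.add_zero]
        exact fits_sound hK hs hkn (by omega) hc ho (by rw [hψ s (by omega), Function.update_self])
          (fun j hj hja => hp j hj (by rw [← hlow j hj, hja])) hfit
      | succ i =>
        rw [List.getElem?_cons_succ] at hR'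
        have := hψ' i R' hR'
        rwa [Nat.add_right_comm] at this
    simp only [extend, Bool.or_eq_true, Bool.and_eq_true] at h
    rcases h with (⟨hf, he⟩ | ⟨hf, he⟩) | ⟨hf, he⟩
    · exact finish 0 _ _ _ h₀
        ((h₁.union h₂).mono (by rintro x (rfl | rfl) <;> decide)) hp₀ hf
        (ih _ _ _ _ (by omega) _ (hbit _ _ _ hp₀) (hbit' _ _ _ (by decide) hp₁)
          (hbit' _ _ _ (by decide) hp₂) he)
    · exact finish 1 _ _ _ h₁
        ((h₀.union h₂).mono (by rintro x (rfl | rfl) <;> decide)) hp₁ hf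
        (ih _ _ _ _ (by omega) _ (hbit' _ _ _ (by decide) hp₀) (hbit _ _ _ hp₁)
          (hbit' _ _ _ (by decide) hp₂) he)
    · exact finish 2 _ _ _ h₂
        ((h₀.union h₁).mono (by rintro x (rfl | rfl) <;> decide)) hp₂ hf
        (ih _ _ _ _ (by omega) _ (hbit' _ _ _ (by decide) hp₀) (hbit' _ _ _ (by decide) hp₁)
          (hbit _ _ _ hp₂) he)

theorem colour_sound (hK : K.Emb G f) (hs : K.symm = true) {Rs : List (List ℕ)}
    (hlen : Rs.length ≤ k)
    (hφ : ∀ x y, k ≤ x → x < K.n → k ≤ y → y < K.n → G.Adj (f x) (f y) → φ (f x) ≠ φ (f y))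
    (m v c₀ c₁ c₂ : ℕ) (hkv : k ≤ v) (hv : v + m = K.n)
    (h₀ : InClass K f φ k c₀ {0}) (h₁ : InClass K f φ k c₁ {1}) (h₂ : InClass K f φ k c₂ {2})
    (hb₀ : c₀ < 2 ^ v) (hb₁ : c₁ < 2 ^ v) (hb₂ : c₂ < 2 ^ v)
    (h : colour K k Rs m v c₀ c₁ c₂ = true) :
    ∃ ψ : ℕ → Fin 3, ∀ i R, Rs[i]? = some R → Compatible G K f φ k ψ i R := by
  have done : ∀ c₀ c₁ c₂, InClass K f φ k c₀ {0} → InClass K f φ k c₁ {1} →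
      InClass K f φ k c₂ {2} → extend K k c₀ c₁ c₂ Rs 0 0 0 0 = true →
      ∃ ψ : ℕ → Fin 3, ∀ i R, Rs[i]? = some R → Compatible G K f φ k ψ i R := by
    intro c₀ c₁ c₂ h₀ h₁ h₂ h
    obtain ⟨ψ, -, hψ⟩ := extend_sound hK hs (by omega) h₀ h₁ h₂ Rs 0 0 0 0 (by omega) (fun _ => 0)
      (by omega) (by omega) (by omega) h
    exact ⟨ψ, fun i R hR => by simpa using hψ i R hR⟩
  induction m generalizing v c₀ c₁ c₂ with
  | zero => exact done _ _ _ h₀ h₁ h₂ h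
  | succ m ih =>
    simp only [colour, Bool.or_eq_true, Bool.and_eq_true] at h
    rcases h with h | ⟨⟨hc₀, hc₁⟩, hc₂⟩
    · exact done _ _ _ h₀ h₁ h₂ h
    have blocked : ∀ (c : ℕ) (a : Fin 3), InClass K f φ k c {a} → c < 2 ^ v → φ (f v) = a →
        (!Nat.beq (K.row v &&& c) 0) = true → False := by
      intro c a hc hb hv' h0
      rw [Bool.not_eq_true', ← Bool.not_eq_true, Nat.beq_eq] at h0
      obtain ⟨y, hy, hyc⟩ := land_ne_zero h0
      have hyv : y < v := by
        by_contra hyv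
        rw [Nat.testBit_lt_two_pow
          (hb.trans_le (Nat.pow_le_pow_right (by norm_num) (not_lt.mp hyv)))] at hyc
        exact Bool.false_ne_true hyc
      obtain ⟨hky, hyn, hya⟩ := hc y hyc
      rw [Config.testBit_row] at hy
      exact hφ v y hkv (by omega) hky hyn ((hK v (by omega) y hyv).2.mp hy) (hv'.trans hya.symm)
    have hlift : ∀ c, c < 2 ^ v → c < 2 ^ (v + 1) := fun c hc =>
      hc.trans (Nat.pow_lt_pow_right (by norm_num) (by omega))
    have hadd : ∀ c, c < 2 ^ v → c ||| 2 ^ v < 2 ^ (v + 1) := fun c hc =>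
      Nat.or_lt_two_pow (hlift c hc) (Nat.pow_lt_pow_right (by norm_num) (by omega))
    have hcol : ∀ a : Fin 3, a = 0 ∨ a = 1 ∨ a = 2 := by decide
    rcases hcol (φ (f v)) with ha | ha | ha
    · exact ih _ _ _ _ (by omega) (by omega) (h₀.insert hkv (by omega) ha) h₁ h₂ (hadd _ hb₀)
        (hlift _ hb₁) (hlift _ hb₂) (hc₀.resolve_left (blocked _ _ h₀ hb₀ ha))
    · exact ih _ _ _ _ (by omega) (by omega) h₀ (h₁.insert hkv (by omega) ha) h₂ (hlift _ hb₀)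
        (hadd _ hb₁) (hlift _ hb₂) (hc₁.resolve_left (blocked _ _ h₁ hb₁ ha))
    · exact ih _ _ _ _ (by omega) (by omega) h₀ h₁ (h₂.insert hkv (by omega) ha) (hlift _ hb₀)
        (hlift _ hb₁) (hadd _ hb₂) (hc₂.resolve_left (blocked _ _ h₂ hb₂ ha))

end Colour

/-! ### Certificates for reducible configurations -/

/-- For every deleted neighbour of a vertex of type `T`, a listed set is contained in `T`. -/
def covers : List (List ℕ) → ℕ → ℕ → Bool
  | [], _, _ => true
  | R :: Rs, s, T =>
    (!T.testBit s || R.any fun r => Nat.beq (r &&& T) r) && covers Rs (s + 1) T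

theorem covers_spec {Rs : List (List ℕ)} {s T : ℕ} (h : covers Rs s T = true) {i : ℕ} {R : List ℕ}
    (hR : Rs[i]? = some R) (hT : T.testBit (s + i) = true) : ∃ r ∈ R, r &&& T = r := by
  induction Rs generalizing s i with
  | nil => simp at hR
  | cons R' Rs ih =>
    simp only [covers, Bool.and_eq_true, Bool.or_eq_true, List.any_eq_true, Nat.beq_eq] at h
    cases i with
    | zero =>
      simp only [List.getElem?_cons_zero, Option.some.injEq] at hR
      subst hR
      refine h.1.resolve_left fun h0 => ?_
      rw [Nat.add_zero] at hT
      simp [hT] at h0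
    | succ i =>
      rw [List.getElem?_cons_succ] at hR
      exact ih h.2 hR (by rwa [Nat.add_right_comm])

/-- Evidence that `K` is absent: every 3-colouring of the graph without the first `k` vertices of
`K` extends. The sets in the `s`-th entry of `lists` are to be met by the colour class of `s`. -/
structure Cert where
  K : Config
  k : ℕ
  lists : List (List ℕ)
  levels : List (List Witness)

def Cert.check (db : List Config) (c : Cert) : Bool :=
  c.K.symm && Nat.ble 1 c.k && Nat.ble (c.k + 2) c.K.n && c.K.adj (c.k + 1) c.k &&
  Nat.beq c.lists.length c.k && Nat.ble c.levels.length c.K.n &&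
  verifyLevels db c.K c.levels 0 && scan c.K c.k (covers c.lists 0) c.levels 0 0 &&
  colour c.K c.k c.lists (c.K.n - (c.k + 2)) (c.k + 2) (2 ^ c.k) (2 ^ (c.k + 1)) 0

theorem records_zero {V : Type} {G : SimpleGraph V} {f : ℕ → V} {u : V} : Records G f u 0 0 :=
  ⟨fun i hi => absurd hi (by omega), fun i _ => Nat.zero_testBit i⟩

section Soundness

variable {V : Type} [Fintype V] {G : SimpleGraph V} {db : List Config}

theorem Cert.check_sound (hG : MinCex G) (hdb : ∀ F ∈ db, F.Absent G) {c : Cert}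
    (h : c.check db = true) : c.K.Absent G := by
  classical
  intro f hf
  obtain ⟨K, k, Rs, levels⟩ := c
  simp only [Cert.check, Bool.and_eq_true, Nat.ble_eq, Nat.beq_eq] at h hf
  obtain ⟨⟨⟨⟨⟨⟨⟨⟨hs, hk1⟩, hkn⟩, hedge⟩, hRs⟩, hlen⟩, hver⟩, hscan⟩, hcol⟩ := h
  obtain ⟨φ₀, hφ₀⟩ := hG.exists_coloring_off {x | ∃ i < k, f i = x} ⟨f 0, 0, hk1, rfl⟩
  have hout : ∀ y, k ≤ y → y < K.n → ¬ ∃ i < k, f i = f y := by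
    rintro y hky hyn ⟨i, hik, hi⟩
    have := hf.injOn (by omega) hyn hi
    omega
  have hperm : ∀ a b : Fin 3, a ≠ b → ∃ σ : Equiv.Perm (Fin 3), σ a = 0 ∧ σ b = 1 := by decide
  obtain ⟨σ, hσ₀, hσ₁⟩ := hperm (φ₀ (f k)) (φ₀ (f (k + 1)))
    (hφ₀ _ _ (hout _ le_rfl (by omega)) (hout _ (by omega) (by omega))
      ((hf (k + 1) (by omega) k (by omega)).2.mp hedge).symm)
  set φ : V → Fin 3 := fun x => σ (φ₀ x) with hφdef
  have hφ : ∀ x y, (¬ ∃ i < k, f i = x) → (¬ ∃ i < k, f i = y) → G.Adj x y → φ x ≠ φ y :=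
    fun x y hx hy hxy h => hφ₀ x y hx hy hxy (σ.injective h)
  have hpow : ∀ y a, φ (f y) = a → k ≤ y → y < K.n → InClass K f φ k (2 ^ y) {a} := by
    intro y a ha hky hyn z hz
    rw [Nat.testBit_two_pow, decide_eq_true_eq] at hz
    subst hz
    exact ⟨hky, hyn, ha⟩
  obtain ⟨ψ, hψ⟩ := colour_sound hf hs hRs.le
    (fun x y hx hxn hy hyn => hφ _ _ (hout x hx hxn) (hout y hy hyn)) _ (k + 2) _ _ _ (by omega)
    (by omega) (hpow k 0 hσ₀ le_rfl (by omega)) (hpow (k + 1) 1 hσ₁ (by omega) (by omega))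
    (fun y hy => by simp at hy) (Nat.pow_lt_pow_right (by norm_num) (by omega))
    (Nat.pow_lt_pow_right (by norm_num) (by omega)) (by positivity) hcol
  have hψ' : ∀ i < k, ∃ R, Rs[i]? = some R ∧ Compatible G K f φ k ψ i R := fun i hi =>
    ⟨_, List.getElem?_eq_getElem (by omega), hψ _ _ (List.getElem?_eq_getElem (by omega))⟩
  have cross : ∀ i < k, ∀ u, (¬ ∃ j < k, f j = u) → G.Adj (f i) u → ψ i ≠ φ u := by
    intro i hi u hu hadj
    obtain ⟨R, hR, hcomp⟩ := hψ' i hi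
    by_cases hin : ∃ y < K.n, f y = u
    · obtain ⟨y, hyn, rfl⟩ := hin
      exact hcomp.rest y (not_lt.mp fun h => hu ⟨y, h, rfl⟩) hyn hadj
    · refine scan_sound (u := u) (fun _ _ _ => hG.triangle_free) hdb hf hs
        (fun y hy h => hin ⟨y, hy, h⟩) ?_ levels 0 0 (by omega) hver records_zero hscan
      intro v T hkv hvn hT hcov
      obtain ⟨r, hr, hrT⟩ := covers_spec hcov hR
        (by rw [Nat.zero_add]; exact (hT.1 i (by omega)).mpr hadj.symm)
      obtain ⟨y, hy, hky, hyn, hyψ⟩ := hcomp.outside r hr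
      rw [← hrT, Nat.testBit_and, Bool.and_eq_true] at hy
      have hyv : y < v := by
        by_contra hyv
        rw [hT.2 y (not_lt.mp hyv)] at hy
        exact Bool.false_ne_true hy.2
      rw [← hyψ]
      exact (hφ _ _ hu (hout y hky hyn) ((hT.1 y hyv).mp hy.2)).symm
  have inner : ∀ i < k, ∀ j < k, G.Adj (f i) (f j) → ψ i ≠ ψ j := by
    intro i hi j hj hadj
    rcases lt_trichotomy i j with hij | rfl | hij
    · exact ((hψ' j hj).choose_spec.2.below i hij hadj.symm).symm
    · exact absurd hadj (G.irrefl)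
    · exact (hψ' i hi).choose_spec.2.below j hij hadj
  refine hG.not_colorable ⟨SimpleGraph.Coloring.mk
    (fun x => if h : ∃ i < k, f i = x then ψ h.choose else φ x) ?_⟩
  intro x y hxy
  by_cases hx : ∃ i < k, f i = x <;> by_cases hy : ∃ i < k, f i = y
  · simp only [hx, hy, dite_true]
    refine inner _ hx.choose_spec.1 _ hy.choose_spec.1 ?_
    rw [hx.choose_spec.2, hy.choose_spec.2]
    exact hxy
  · simp only [hx, hy, dite_true, dite_false]
    exact cross _ hx.choose_spec.1 y hy (by rw [hx.choose_spec.2]; exact hxy)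
  · simp only [hx, hy, dite_true, dite_false]
    exact (cross _ hy.choose_spec.1 x hx (by rw [hy.choose_spec.2]; exact hxy.symm)).symm
  · simp only [hx, hy, dite_false]
    exact hφ x y hx hy hxy

/-- Check certificates in order, each one relying on its predecessors. -/
def checkAll (db : List Config) : List Cert → Bool
  | [] => true
  | c :: cs => c.check db && checkAll (c.K :: db) cs

/-- The configurations known to be absent once all certificates have been checked. -/
def known (db : List Config) (cs : List Cert) : List Config :=
  cs.foldl (fun db c => c.K :: db) db

theorem checkAll_sound (hG : MinCex G) (hdb : ∀ F ∈ db, F.Absent G) {cs : List Cert}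
    (h : checkAll db cs = true) : ∀ F ∈ known db cs, F.Absent G := by
  induction cs generalizing db with
  | nil => exact hdb
  | cons c cs ih =>
    simp only [checkAll, Bool.and_eq_true] at h
    refine ih (fun F hF => ?_) h.2
    rcases List.mem_cons.mp hF with rfl | hF
    · exact c.check_sound hG hdb h.1
    · exact hdb F hF

end Soundness

/-! ### Classifying outside vertices -/

/-- The levels of `r` show that all possible neighbourhoods in `r.1` satisfy `leaf`. -/
def classifies (db : List Config) (leaf : ℕ → Bool) (r : Config × List (List Witness)) : Bool :=
  r.1.symm && Nat.ble r.2.length r.1.n && verifyLevels db r.1 r.2 0 &&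
    scan r.1 r.1.n leaf r.2 0 0

/-- The second configuration is the first one with a new vertex of neighbourhood `T`. -/
def Config.extendsBy (K K' : Config) (T : ℕ) : Bool :=
  Nat.beq K'.n (K.n + 1) &&
  (allBelow K.n fun i => allBelow i fun j => K'.adj i j == K.adj i j) &&
  allBelow K.n fun j => K'.adj K.n j == T.testBit j

section Classify

variable {V : Type} {G : SimpleGraph V}

theorem classifies_sound (hG : ∀ x y z, G.Adj x y → G.Adj y z → G.Adj x z → False)
    {db : List Config} (hdb : ∀ F ∈ db, F.Absent G) {leaf : ℕ → Bool}
    {r : Config × List (List Witness)} (h : classifies db leaf r = true) {f : ℕ → V}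
    (hf : r.1.Emb G f) {u : V} (hu : ∀ i < r.1.n, f i ≠ u) :
    ∃ T, Records G f u r.1.n T ∧ leaf T = true := by
  simp only [classifies, Bool.and_eq_true, Nat.ble_eq] at h
  refine scan_sound hG hdb hf h.1.1.1 hu (fun v T hv hvn hT hl => ⟨T, ?_, hl⟩) r.2 0 0
    (by omega) h.1.2 records_zero h.2
  rwa [le_antisymm hvn hv] at hT

theorem Config.Emb.snoc {K K' : Config} {f : ℕ → V} (hf : K.Emb G f) {u : V} {T : ℕ}
    (hu : ∀ i < K.n, f i ≠ u) (hT : Records G f u K.n T) (h : K.extendsBy K' T = true) :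
    K'.Emb G (Function.update f K.n u) := by
  simp only [Config.extendsBy, Bool.and_eq_true, Nat.beq_eq] at h
  obtain ⟨⟨hn, hold⟩, hnew⟩ := h
  intro i hi j hj
  rw [Function.update_of_ne (by omega : j ≠ K.n)]
  by_cases hin : i = K.n
  · subst hin
    rw [Function.update_self, eq_of_beq (allBelow_spec hnew j hj)]
    exact ⟨(hu j hj).symm, hT.1 j hj⟩
  · rw [Function.update_of_ne hin,
      eq_of_beq (allBelow_spec (allBelow_spec hold i (by omega)) j hj)]
    exact hf i (by omega) j hj

theorem Records.eq {f : ℕ → V} {u : V} {v T U : ℕ} (hT : Records G f u v T)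
    (hU : Records G f u v U) : T = U := by
  refine Nat.eq_of_testBit_eq fun i => ?_
  rcases lt_or_ge i v with hi | hi
  · rw [Bool.eq_iff_iff, hT.1 i hi, hU.1 i hi]
  · rw [hT.2 i hi, hU.2 i hi]

theorem Records.restrict {f f' : ℕ → V} {u : V} {v w T : ℕ} (hT : Records G f u w T) (hvw : v ≤ w)
    (hff : ∀ i < v, f i = f' i) : Records G f' u v (T % 2 ^ v) := by
  refine ⟨fun i hi => ?_, fun i hi => ?_⟩
  · rw [Nat.testBit_mod_two_pow, decide_eq_true hi, Bool.true_and, hT.1 i (by omega), hff i hi]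
  · rw [Nat.testBit_mod_two_pow, decide_eq_false (by omega), Bool.false_and]

end Classify

/-! ### The two basic configurations -/

def forkConfig : Config := ⟨7, 2535379780782312491558337839150⟩

/-- The Wagner graph: `t` is adjacent to `t + 3`, `t + 4` and `t + 5` modulo 8. -/
def wagner : Config := ⟨8, 145385421241715270614681899592843320⟩

theorem forkConfig_absent {V : Type} {G : SimpleGraph V} (hG : ForkFree G) :
    forkConfig.Absent G := by
  intro f hf
  have hadj : ∀ a b : Fin 7, fork.Adj a b ↔ a ≠ b ∧ forkConfig.adj a b = true := by
    simp only [fork, SimpleGraph.fromEdgeSet_adj, Set.mem_insert_iff, Set.mem_singleton_iff,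
      Sym2.eq_iff]
    decide
  refine hG.false ⟨⟨fun a => f a, fun a b hab => Fin.ext (hf.injOn a.2 b.2 hab)⟩, ?_⟩
  intro a b
  rw [hadj]
  by_cases hab : a = b
  · simp [hab]
  · simp only [ne_eq, hab, not_false_eq_true, true_and]
    exact (hf.adj_iff (by decide) a.2 b.2 (fun h => hab (Fin.ext h))).symm

/-! ### The Wagner graph

The nonempty neighbourhoods of outside vertices in an induced Wagner graph are short arcs, and arcs
of adjacent vertices are nearly opposite. Cutting the circle of arcs into three pieces is therefore
almost a proper colouring. -/

/-- The possible neighbourhoods of a second outside vertex, for every nonempty type of a first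
one. -/
def wagnerPairs : List (Config × List (List Witness)) := [
  (⟨9, 1020992486184057105660738504194914255160⟩, [[], [], [], [], [], [], [], [],
    [⟨0, 256, 498, 9939589281⟩, ⟨0, 256, 317, 9934377056⟩]]),
  (⟨9, 680710119263118642197363896763146043448⟩, [[], [], [], [], [], [], [], [],
    [⟨0, 256, 498, 9939589281⟩, ⟨0, 260, 485, 8892095682⟩]]),
  (⟨9, 1701557220025934032587487720157945528632⟩, [[], [], [], [], [], [], [], [],
    [⟨0, 256, 500, 9936541858⟩]]),
  (⟨9, 2382121953867810959514236935021498728760⟩, [[], [], [], [], [], [], [], [],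
    [⟨0, 256, 498, 9939589281⟩]]),
  (⟨9, 2041839586946872496050862327589730517048⟩, [[], [], [], [], [], [], [], [],
    [⟨0, 256, 485, 9932283074⟩]]),
  (⟨9, 1361274853104995569124113112726177316920⟩, [[], [], [], [], [], [], [], [],
    [⟨0, 256, 500, 9936541858⟩]]),
  (⟨9, 3402969054630626349904432813811329663032⟩, [[], [], [], [], [], [], [], [],
    [⟨0, 256, 489, 9937362115⟩, ⟨0, 256, 498, 9939589281⟩]]),
  (⟨9, 4764098522314380203757931244637914136632⟩, [[], [], [], [], [], [], [], [],
    [⟨0, 256, 485, 9932283074⟩]]),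
  (⟨9, 4083533788472503276831182029774360936504⟩, [[], [], [], [], [], [], [], [],
    [⟨0, 256, 500, 9936541858⟩]]),
  (⟨9, 2722404320788749422977683598947776462904⟩, [[], [], [], [], [], [], [], [],
    [⟨0, 256, 489, 9937362115⟩, ⟨0, 258, 498, 8899401889⟩,
    ⟨0, 260, 500, 8896354466⟩]]),
  (⟨9, 6805792723840010989260473314504113913912⟩, [[], [], [], [], [], [], [], [],
    [⟨0, 256, 467, 9938443268⟩, ⟨0, 256, 485, 9932283074⟩]]),
  (⟨9, 9528051659207518696967542231552297533496⟩, [[], [], [], [], [], [], [], [],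
    [⟨0, 256, 459, 9933364227⟩, ⟨0, 256, 485, 9932283074⟩]]),
  (⟨9, 8166922191523764843114043800725713059896⟩, [[], [], [], [], [], [], [], [],
    [⟨0, 256, 407, 9934439428⟩]]),
  (⟨9, 5444663256156257135406974883677529440312⟩, [[], [], [], [], [], [], [], [],
    [⟨0, 256, 407, 9934439428⟩]]),
  (⟨9, 13611440062259089738815492381833084010552⟩, [[], [], [], [], [], [], [], [],
    [⟨0, 256, 423, 9939518469⟩, ⟨0, 256, 459, 9933364227⟩]]),
  (⟨9, 19055957932994105158951852583611020607544⟩, [[], [], [], [], [], [], [], [],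
    [⟨0, 256, 407, 9934439428⟩]]),
  (⟨9, 16333698997626597451244783666562836987960⟩, [[], [], [], [], [], [], [], [],
    [⟨0, 256, 303, 9935259685⟩]]),
  (⟨9, 10889181126891582031108423464784900390968⟩, [[], [], [], [], [], [], [], [],
    [⟨0, 256, 423, 9939518469⟩, ⟨0, 272, 467, 8898255876⟩]]),
  (⟨9, 27222734759378728400714620183257946259512⟩, [[], [], [], [], [], [], [], [],
    [⟨0, 256, 407, 9934439428⟩]]),
  (⟨9, 38111770500849068716552428966143253807160⟩, [[], [], [], [], [], [], [], [],
    [⟨0, 256, 303, 9935259685⟩]]),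
  (⟨9, 32667252630114053296416068764365317210168⟩, [[], [], [], [], [], [], [], [],
    [⟨0, 256, 423, 9939518469⟩]]),
  (⟨9, 21778216888643712980578259981480009662520⟩, [[], [], [], [], [], [], [], [],
    [⟨0, 256, 350, 9936342086⟩, ⟨0, 384, 444, 8897237095⟩]]),
  (⟨9, 54446653320767490270293277023111511801912⟩, [[], [], [], [], [], [], [], [],
    [⟨0, 256, 414, 9933294663⟩]]),
  (⟨9, 76224724823989961535600922322691928621112⟩, [[], [], [], [], [], [], [], [],
    [⟨0, 256, 350, 9936342086⟩]]),
  (⟨9, 65335689082519621219763113539806621073464⟩, [[], [], [], [], [], [], [], [],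
    [⟨0, 256, 444, 9937424487⟩]]),
  (⟨9, 43557617579297149954455468240226204254264⟩, [[], [], [], [], [], [], [], [],
    [⟨0, 256, 444, 9937424487⟩]]),
  (⟨9, 22118499255564651444041634588911777874232⟩, [[], [], [], [], [], [], [], [],
    [⟨0, 256, 317, 9934377056⟩, ⟨0, 256, 350, 9936342086⟩]]),
  (⟨9, 65675971449440559683226488147238389285176⟩, [[], [], [], [], [], [], [], [],
    [⟨0, 256, 317, 9934377056⟩]]),
  (⟨9, 43897899946218088417918842847657972465976⟩, [[], [], [], [], [], [], [], [],
    [⟨0, 256, 317, 9934377056⟩]]),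
  (⟨9, 340427752342180178733989289331361055032⟩, [[], [], [], [], [], [], [], [],
    [⟨0, 256, 317, 9934377056⟩, ⟨0, 384, 414, 8893107271⟩]]),
  (⟨9, 44238182313139026881382217455089757454392⟩, [[], [], [], [], [], [], [], [],
    [⟨0, 256, 444, 9937424487⟩]]),
  (⟨9, 44578464680059965344845592062521525666104⟩, [[], [], [], [], [], [], [], [],
    [⟨0, 256, 317, 9934377056⟩]])]

def wagnerTwoFourPath : Config × List (List Witness) :=
  (⟨10, 6155180920358801691614266596521424974202798392⟩, [[], [], [], [], [], [], [], [], [],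
    [⟨0, 256, 783, 2452629544⟩]])

def wagnerThreePath : Config × List (List Witness) :=
  (⟨10, 6333586881947046676746552342846727054326497592⟩, [[], [], [], [], [], [], [], [], [],
    [⟨0, 256, 317, 11008118880⟩, ⟨0, 128, 715, 10973553667⟩]])

def wagnerClaw : Config × List (List Witness) :=
  (⟨11, 701527119854169808504600468860791876476337621303608⟩, [[], [], [], [], [], [], [], [], [],
    [], [⟨0, 512, 1683, 12123866116⟩]])

/-- The types coloured `0`, `1` and `2`. -/
def arcs : Fin 3 → List ℕ
  | 0 => [3, 2, 5, 7, 6, 4, 10, 14, 12, 8, 20, 28]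
  | 1 => [24, 16, 40, 56, 48, 32, 80, 112, 96]
  | 2 => [64, 160, 224, 192, 128, 65, 193, 129, 1, 130, 131]

def arcColour (T : ℕ) : Fin 3 :=
  bif (arcs 0).elem T then 0 else bif (arcs 1).elem T then 1 else 2

def nonemptyArcs : List ℕ := arcs 0 ++ arcs 1 ++ arcs 2

/-- Types of colour `0` that may be joined to the type `3`. -/
def lastArcs : List ℕ := [20, 28]

/-- Types of colour `2` that may be joined to the type `3`. -/
def farArcs : List ℕ := [64, 160, 224]

/-- A necessary condition on the types of adjacent vertices. -/
def mayMeet (S T : ℕ) : Bool :=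
  !Nat.beq S 0 &&
  (!(arcColour S == arcColour T) || (Nat.beq S 3 && lastArcs.elem T) ||
    (Nat.beq T 3 && lastArcs.elem S)) &&
  (!Nat.beq S 3 || !(arcColour T == 2) || farArcs.elem T) &&
  (!lastArcs.elem S || !(arcColour T == 1) || Nat.beq T 96)

def mayMeetBoth (S T : ℕ) : Bool := mayMeet S T && mayMeet T S

theorem wagner_types_check :
    classifies [] (0 :: nonemptyArcs).elem (wagner, List.replicate 8 []) = true := by
  decide +kernel

theorem wagnerPairs_check : (nonemptyArcs.all fun S => wagnerPairs.any fun r =>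
    wagner.extendsBy r.1 S && classifies [forkConfig] (fun U => !U.testBit 8 ||
      !(0 :: nonemptyArcs).elem (U % 2 ^ 8) || mayMeetBoth S (U % 2 ^ 8)) r) = true := by
  decide +kernel

theorem wagner_rows_check : (nonemptyArcs.all fun S => allBelow 8 fun j =>
    !S.testBit j || mayMeetBoth S (wagner.row j % 2 ^ 8)) = true := by
  decide +kernel

theorem wagnerTwoFourPath_check : classifies [forkConfig] (fun U => !U.testBit 8 ||
    !farArcs.elem (U % 2 ^ 8)) wagnerTwoFourPath = true := by
  decide +kernel

theorem wagnerThreePath_check : classifies [forkConfig] (fun U => !U.testBit 8 ||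
    !farArcs.elem (U % 2 ^ 8) || Nat.beq U 480) wagnerThreePath = true := by
  decide +kernel

theorem wagnerClaw_check : classifies [forkConfig] (fun U => !U.testBit 9 ||
    !Nat.beq (U % 2 ^ 8) 96) wagnerClaw = true := by
  decide +kernel

section Wagner

variable {V : Type} {G : SimpleGraph V} {f : ℕ → V} {t : V → ℕ}

/-- `t` assigns to every vertex its neighbourhood in the Wagner graph placed by `f`. -/
structure Typing (G : SimpleGraph V) (f : ℕ → V) (t : V → ℕ) : Prop where
  emb : wagner.Emb G f
  records : ∀ x, Records G f x 8 (t x)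
  mem : ∀ x, t x ∈ 0 :: nonemptyArcs

theorem records_wagner (hf : wagner.Emb G f) {j : ℕ} (hj : j < 8) :
    Records G f (f j) 8 (wagner.row j % 2 ^ 8) := by
  have hdiag : ∀ i < 8, wagner.adj i i = false := by decide
  refine ⟨fun i hi => ?_, fun i hi => ?_⟩
  · rw [Nat.testBit_mod_two_pow, decide_eq_true hi, Bool.true_and, Config.testBit_row]
    by_cases hij : j = i
    · simp [hij, hdiag i hi]
    · exact hf.adj_iff (by decide) hj hi hij
  · rw [Nat.testBit_mod_two_pow, decide_eq_false (by omega), Bool.false_and]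

theorem exists_typing (hG : ∀ x y z, G.Adj x y → G.Adj y z → G.Adj x z → False)
    (hf : wagner.Emb G f) : ∃ t : V → ℕ, Typing G f t := by
  have hrows : ∀ j < 8, wagner.row j % 2 ^ 8 ∈ 0 :: nonemptyArcs := by decide +kernel
  have key : ∀ x, ∃ T, Records G f x 8 T ∧ T ∈ 0 :: nonemptyArcs := by
    intro x
    by_cases hx : ∃ j < 8, f j = x
    · obtain ⟨j, hj, rfl⟩ := hx
      exact ⟨_, records_wagner hf hj, hrows j hj⟩
    · obtain ⟨T, hT, hmem⟩ := classifies_sound hG (by simp) wagner_types_check hf (u := x)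
        fun j hj h => hx ⟨j, hj, h⟩
      exact ⟨T, hT, List.elem_iff.mp hmem⟩
  choose t ht using key
  exact ⟨t, hf, fun x => (ht x).1, fun x => (ht x).2⟩

namespace Typing

theorem row_eq (h : Typing G f t) {j : ℕ} (hj : j < 8) : t (f j) = wagner.row j % 2 ^ 8 :=
  (h.records _).eq (records_wagner h.emb hj)

theorem mem_nonemptyArcs (h : Typing G f t) {x : V} (hx : t x ≠ 0) : t x ∈ nonemptyArcs :=
  (List.mem_cons.mp (h.mem x)).resolve_left hx

theorem mayMeet_row (h : Typing G f t) {x : V} {j : ℕ} (hj : j < 8) (hadj : G.Adj x (f j)) :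
    mayMeetBoth (t x) (t (f j)) = true := by
  have hbit : (t x).testBit j = true := ((h.records x).1 j hj).mpr hadj
  have hx : t x ≠ 0 := fun h0 => by simp [h0] at hbit
  have := allBelow_spec (List.all_eq_true.mp wagner_rows_check _ (h.mem_nonemptyArcs hx)) j hj
  rw [hbit, Bool.not_true, Bool.false_or] at this
  rwa [h.row_eq hj]

theorem mayMeet_of_adj (hG : ∀ x y z, G.Adj x y → G.Adj y z → G.Adj x z → False)
    (hfork : forkConfig.Absent G) (h : Typing G f t) {x y : V} (hx : t x ≠ 0)
    (hadj : G.Adj x y) : mayMeetBoth (t x) (t y) = true := by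
  by_cases hyW : ∃ j < 8, f j = y
  · obtain ⟨j, hj, rfl⟩ := hyW
    exact h.mayMeet_row hj hadj
  by_cases hxW : ∃ j < 8, f j = x
  · obtain ⟨j, hj, rfl⟩ := hxW
    have := h.mayMeet_row hj hadj.symm
    rwa [mayMeetBoth, Bool.and_comm] at this
  obtain ⟨r, -, hr⟩ := List.any_eq_true.mp
    (List.all_eq_true.mp wagnerPairs_check _ (h.mem_nonemptyArcs hx))
  rw [Bool.and_eq_true] at hr
  have hemb := h.emb.snoc (fun j hj hjx => hxW ⟨j, hj, hjx⟩) (h.records x) hr.1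
  have hn : r.1.n = 9 := by
    have := hr.1
    simp only [Config.extendsBy, Bool.and_eq_true, Nat.beq_eq] at this
    exact this.1.1
  have hupd : ∀ i < 8, Function.update f 8 x i = f i := fun i hi =>
    Function.update_of_ne (by omega) _ _
  obtain ⟨U, hU, hleaf⟩ := classifies_sound hG (by simpa using hfork) hr.2 hemb (u := y) (by
    intro i hi
    by_cases hi8 : i = 8
    · subst hi8
      exact (Function.update_self (8 : ℕ) x f).trans_ne hadj.ne
    · rw [show wagner.n = 8 from rfl, hupd i (by omega)]
      exact fun hiy => hyW ⟨i, by omega, hiy⟩)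
  rw [hn] at hU
  have hbit : U.testBit 8 = true := by
    rw [hU.1 8 (by omega)]
    exact (congrArg (G.Adj y) (Function.update_self (8 : ℕ) x f)).mpr hadj.symm
  have hmod : U % 2 ^ 8 = t y := (hU.restrict (by omega) hupd).eq (h.records y)
  rw [hbit, hmod, List.elem_iff.mpr (h.mem y)] at hleaf
  simpa using hleaf

/-- The only way in which the colouring by arcs could fail to be repaired. -/
theorem no_conflict (hG : ∀ x y z, G.Adj x y → G.Adj y z → G.Adj x z → False)
    (hfork : forkConfig.Absent G) (h : Typing G f t) {x y z w : V} (hx : t x = 3)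
    (hy : t y ∈ lastArcs) (hz : t z ∈ farArcs) (hw : t w = 96) (hxy : G.Adj x y)
    (hxz : G.Adj x z) (hyw : G.Adj y w) : False := by
  have hdb : ∀ F ∈ [forkConfig], F.Absent G := by simpa using hfork
  have outside : ∀ {v : V} (L : List ℕ), (∀ j < 8, wagner.row j % 2 ^ 8 ∉ L) → t v ∈ L →
      ∀ j < 8, f j ≠ v := by
    rintro v L hL hv j hj rfl
    exact hL j hj (h.row_eq hj ▸ hv)
  have nbr : ∀ {v : V} (L : List ℕ), (∀ j < 8, Nat.testBit 3 j = true → wagner.row j % 2 ^ 8 ∉ L) →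
      t v ∈ L → G.Adj x v → ∀ j < 8, f j ≠ v := by
    rintro v L hL hv hadj j hj rfl
    exact hL j hj (hx ▸ ((h.records x).1 j hj).mpr hadj) (h.row_eq hj ▸ hv)
  have hxW := outside (v := x) [3] (by decide) (by simp [hx])
  have hwW := outside (v := w) [96] (by decide) (by simp [hw])
  have hyW := nbr lastArcs (by decide) hy hxy
  have hzW := nbr farArcs (by decide) hz hxz
  have hyz : ¬ G.Adj z y := fun hzy => hG x z y hxz hzy hxy
  have hzy : y ≠ z := fun e => by
    have : ∀ T ∈ lastArcs, T ∉ farArcs := by decide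
    exact this _ hy (e ▸ hz)
  have hwz : z ≠ w := fun e => by
    rw [e, hw] at hz
    exact absurd hz (by decide)
  have hwx : x ≠ w := fun e => by
    rw [e, hw] at hx
    exact absurd hx (by decide)
  let f₁ := Function.update f 8 x
  let f₂ := Function.update f₁ 9 y
  let f₃ := Function.update f₂ 10 z
  have h₁ : ∀ i < 8, f i = f₁ i := fun i hi => (Function.update_of_ne (by omega) _ _).symm
  have h₂ : ∀ i < 9, f₁ i = f₂ i := fun i hi => (Function.update_of_ne (by omega) _ _).symm
  have h₃ : ∀ i < 10, f₂ i = f₃ i := fun i hi => (Function.update_of_ne (by omega) _ _).symm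
  have e₁ : f₁ 8 = x := Function.update_self ..
  have e₂ : f₂ 9 = y := Function.update_self ..
  have e₃ : f₃ 10 = z := Function.update_self ..
  have transfer : ∀ {g g' : ℕ → V} {v : V} {n T : ℕ}, (∀ i < n, g i = g' i) → Records G g v n T →
      Records G g' v n T := fun hg hT => ⟨fun i hi => hg i hi ▸ hT.1 i hi, hT.2⟩
  have avoid : ∀ {g g' : ℕ → V} {v : V} {n : ℕ}, (∀ i < n, g i = g' i) → (∀ i < n, g i ≠ v) →
      g' n ≠ v → ∀ i < n + 1, g' i ≠ v := by
    intro g g' v n hg hold hnew i hi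
    rcases Nat.lt_succ_iff_lt_or_eq.mp hi with hi | rfl
    · exact hg i hi ▸ hold i hi
    · exact hnew
  let K₁ : Config := ⟨9, 1020992486184057105660738504194914255160⟩
  have emb₁ : K₁.Emb G f₁ := h.emb.snoc hxW (h.records x) (by rw [hx]; decide +kernel)
  have ry := (transfer h₁ (h.records y)).succ_of_adj (by rw [e₁]; exact hxy.symm)
  have av_y := avoid h₁ hyW (by rw [e₁]; exact hxy.ne)
  have av_z := avoid h₂ (avoid h₁ hzW (by rw [e₁]; exact hxz.ne)) (by rw [e₂]; exact hzy)
  have rz : Records G f₂ z 10 (t z ||| 2 ^ 8) :=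
    (transfer h₂ ((transfer h₁ (h.records z)).succ_of_adj
      (by rw [e₁]; exact hxz.symm))).succ_of_not_adj (by rw [e₂]; exact hyz)
  have hz8 : (t z ||| 2 ^ 8).testBit 8 = true := by
    rw [Nat.testBit_or, Nat.testBit_two_pow_self, Bool.or_true]
  have hzmod : (t z ||| 2 ^ 8) % 2 ^ 8 = t z :=
    (rz.restrict (by omega) fun i hi => by rw [h₁ i hi, h₂ i (by omega)]).eq (h.records z)
  have hz' : farArcs.elem (t z) = true := List.elem_iff.mpr hz
  have hcases : t y = 20 ∨ t y = 28 := by simpa [lastArcs] using hy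
  rcases hcases with hy' | hy'
  · have emb₂ : wagnerTwoFourPath.1.Emb G f₂ :=
      emb₁.snoc av_y ry (by rw [hy']; decide +kernel)
    obtain ⟨U, hU, hleaf⟩ := classifies_sound hG hdb wagnerTwoFourPath_check emb₂ (u := z) av_z
    rw [hU.eq rz, hz8, hzmod, hz'] at hleaf
    exact absurd hleaf (by decide)
  · have emb₂ : wagnerThreePath.1.Emb G f₂ :=
      emb₁.snoc av_y ry (by rw [hy']; decide +kernel)
    obtain ⟨U, hU, hleaf⟩ := classifies_sound hG hdb wagnerThreePath_check emb₂ (u := z) av_z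
    rw [hU.eq rz, hz8, hzmod, hz'] at hleaf
    simp only [Bool.not_true, Bool.false_or, Nat.beq_eq] at hleaf
    have emb₃ : wagnerClaw.1.Emb G f₃ := emb₂.snoc av_z rz (by rw [hleaf]; decide +kernel)
    obtain ⟨U, hU, hleaf⟩ := classifies_sound hG hdb wagnerClaw_check emb₃ (u := w)
      (avoid h₃ (avoid h₂ (avoid h₁ hwW (by rw [e₁]; exact hwx)) (by rw [e₂]; exact hyw.ne))
        (by rw [e₃]; exact hwz))
    have hU9 : U.testBit 9 = true := by
      rw [hU.1 9 (by decide), ← h₃ 9 (by omega), e₂]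
      exact hyw.symm
    have hUmod : U % 2 ^ 8 = 96 := by
      rw [← hw]
      refine (hU.restrict (by decide) fun i hi => ?_).eq (h.records w)
      rw [h₁ i hi, h₂ i (by omega), h₃ i (by omega)]
    rw [hU9, hUmod] at hleaf
    exact absurd hleaf (by decide)

end Typing

theorem wagner_absent [Fintype V] (hG : MinCex G) : wagner.Absent G := by
  classical
  intro f hf
  have htri : ∀ x y z, G.Adj x y → G.Adj y z → G.Adj x z → False := fun _ _ _ => hG.triangle_free
  have hfork := forkConfig_absent hG.2.1
  obtain ⟨t, ht⟩ := exists_typing htri hf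
  obtain ⟨φ, hφ⟩ := hG.exists_coloring_off {x | t x ≠ 0}
    ⟨f 0, by rw [Set.mem_ofPred_eq, ht.row_eq (by omega)]; decide⟩
  let far : V → Prop := fun x => ∃ z, G.Adj x z ∧ t z ∈ farArcs
  let near : V → Prop := fun x => ∃ z, G.Adj x z ∧ t z = 96
  let χ : V → Fin 3 := fun x =>
    if t x = 0 then φ x
    else if t x = 3 ∧ ¬ far x then 2
    else if t x ∈ lastArcs ∧ ¬ near x then 1
    else arcColour (t x)
  refine hG.not_colorable ⟨SimpleGraph.Coloring.mk χ ?_⟩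
  have h3 : arcColour 3 = 0 := by decide
  have h3' : 3 ∉ lastArcs := by decide
  have hlast : ∀ T ∈ lastArcs, arcColour T = 0 := by decide
  have meet : ∀ {x y : V}, t x ≠ 0 → G.Adj x y →
      t y ≠ 0 ∧
      (arcColour (t x) = arcColour (t y) → (t x = 3 ∧ t y ∈ lastArcs) ∨
        (t y = 3 ∧ t x ∈ lastArcs)) ∧
      (t x = 3 → arcColour (t y) = 2 → far x) ∧
      (t x ∈ lastArcs → arcColour (t y) = 1 → near x) := by
    intro x y hx hxy
    have := ht.mayMeet_of_adj htri hfork hx hxy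
    simp only [mayMeetBoth, mayMeet, Bool.and_eq_true, Bool.or_eq_true, Bool.not_eq_true',
      List.elem_iff, Nat.beq_eq, ← Bool.not_eq_true, beq_iff_eq] at this
    obtain ⟨⟨⟨⟨-, hc⟩, hfar⟩, hnear⟩, ⟨⟨hy, -⟩, -⟩, -⟩ := this
    refine ⟨hy, fun h => ?_, fun h1 h2 => ⟨y, hxy, ?_⟩, fun h1 h2 => ⟨y, hxy, ?_⟩⟩
    · rcases hc with (hc | hc) | hc
      · exact absurd h hc
      · exact Or.inl hc
      · exact Or.inr hc
    · rcases hfar with (hc | hc) | hc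
      · exact absurd h1 hc
      · exact absurd h2 hc
      · exact hc
    · rcases hnear with (hc | hc) | hc
      · exact absurd h1 hc
      · exact absurd h2 hc
      · exact hc
  intro x y hxy
  by_cases hx : t x = 0
  · by_cases hy : t y = 0
    · simp only [χ, hx, hy, if_true]
      exact hφ x y (by simpa using hx) (by simpa using hy) hxy
    · exact absurd hx (meet hy hxy.symm).1
  obtain ⟨hy, hcol, hx3, hxl⟩ := meet hx hxy
  obtain ⟨-, -, hy3, hyl⟩ := meet hy hxy.symm
  have clash : ∀ {x y : V}, G.Adj x y → t x = 3 → t y ∈ lastArcs → far x → near y → False := by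
    rintro x y hxy hx hy ⟨z, hxz, hz⟩ ⟨w, hyw, hw⟩
    exact ht.no_conflict htri hfork hx hy hz hw hxy hxz hyw
  have c₁ := clash hxy
  have c₂ := clash hxy.symm
  have l₁ := hlast (t x)
  have l₂ := hlast (t y)
  have ne : (0 : Fin 3) ≠ 1 ∧ (0 : Fin 3) ≠ 2 ∧ (1 : Fin 3) ≠ 2 := by decide
  simp only [χ, hx, hy, if_false]
  clear hφ meet clash hlast ht
  split_ifs <;> grind

end Wagner

/-! ### The reducible configurations -/

set_option maxRecDepth 1000000 in
/-- Configurations absent from every minimal counterexample, in an order in which each certificate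
only refers to the two basic configurations and to its predecessors. -/
def reducible : List Cert := [
  ⟨⟨11, 49696140309938689457927749232762448985532914729204⟩, 1, [[264, 770]], [[], [], [], [], [],
    [], [], [⟨1, 1, 235, 1278385504⟩], [⟨1, 1, 423, 8825935200⟩], [], [⟨1, 1, 1333, 10913712480⟩,
    ⟨1, 2, 1626, 9868290401⟩]]⟩,
  ⟨⟨11, 409226569424429869251866093100622768096228575346826⟩, 4, [[], [16], [544], [80, 272]], [[],
    [], [], [], [], [], [], [⟨2, 32, 252, 7719719269⟩, ⟨2, 17, 219, 6681889824⟩, ⟨2, 8, 189,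
    4470081891⟩], [⟨2, 1, 427, 8830158176⟩, ⟨2, 128, 485, 2421358951⟩, ⟨2, 4, 430, 7789970786⟩, ⟨2,
    128, 483, 5571092839⟩, ⟨2, 8, 365, 6618677603⟩], [⟨2, 1, 715, 6686805344⟩, ⟨2, 1, 683,
    5478849888⟩, ⟨2, 2, 663, 4604299617⟩, ⟨2, 32, 633, 9797998949⟩], [⟨2, 1, 1227, 6687917408⟩, ⟨0,
    1573, 1983, 7991433056258315⟩]]⟩,
  ⟨⟨11, 385845709910496343286985022653375361152813149978660⟩, 1, [[1040, 530, 592, 1090, 1538]],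
    [[], [], [], [], [], [], [], [⟨3, 1, 215, 7729057826⟩], [⟨3, 64, 498, 1346542950⟩, ⟨3, 272, 444,
    7625610308⟩, ⟨2, 400, 478, 105502606539⟩], [⟨3, 129, 715, 1174774983⟩, ⟨3, 1, 633, 3366986949⟩],
    [⟨3, 16, 1596, 9842035044⟩, ⟨3, 16, 1242, 6689007651⟩, ⟨3, 512, 1968, 11010219369⟩, ⟨3, 64,
    1492, 11010121062⟩]]⟩,
  ⟨⟨11, 377074648441771222049616523675173841664878833893402⟩, 1, [[96, 292]], [[], [], [], [], [],
    [], [], [], [⟨4, 1, 347, 8696926560⟩], [⟨4, 4, 822, 8897299810⟩], [⟨4, 256, 1834, 1414636904⟩,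
    ⟨4, 64, 1762, 5614118246⟩, ⟨0, 1089, 2015, 8275269185177892⟩, ⟨4, 256, 1484, 6679538024⟩]]⟩,
  ⟨⟨11, 771701588066875882844000037508404317337063705084194⟩, 3, [[], [48], [1280]], [[], [], [],
    [], [], [], [], [], [⟨5, 1, 303, 3391136096⟩, ⟨5, 2, 407, 4370472289⟩, ⟨4, 266, 491,
    7625282763⟩, ⟨5, 4, 461, 280042598⟩, ⟨4, 292, 487, 207408405515⟩], [⟨5, 1, 807, 9934247264⟩, ⟨5,
    256, 869, 2354062696⟩, ⟨5, 16, 633, 179446979⟩, ⟨5, 64, 996, 9937586534⟩, ⟨5, 516, 599,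
    43358338⟩, ⟨5, 8, 952, 8899432803⟩, ⟨4, 641, 1001, 178543365387⟩], [⟨5, 256, 1861, 11041702248⟩,
    ⟨5, 1314, 1394, 4637070379⟩, ⟨5, 514, 1834, 5470791945⟩, ⟨5, 4, 1111, 10871675234⟩, ⟨5, 1152,
    1506, 8802112551⟩, ⟨5, 4, 1366, 8801879394⟩, ⟨5, 1025, 1379, 6721737760⟩]]⟩,
  ⟨⟨11, 379997562516174170770076182616352996342043608088644⟩, 1, [[34, 1538, 1568]], [[], [], [],
    [], [], [], [], [], [⟨6, 128, 486, 6612361575⟩, ⟨6, 16, 374, 5571158372⟩, ⟨6, 9, 315,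
    8724517923⟩], [⟨6, 1, 753, 7695508614⟩, ⟨0, 513, 1023, 12710461959243815⟩, ⟨6, 257, 915,
    1308992648⟩, ⟨6, 16, 828, 9937455460⟩], [⟨6, 1, 1175, 7561291906⟩, ⟨6, 1056, 1768, 9875856485⟩,
    ⟨6, 16, 1628, 9875557732⟩, ⟨6, 16, 1370, 11007007076⟩, ⟨6, 514, 1678, 10814332001⟩]]⟩,
  ⟨⟨12, 64365981987701931436695409620180669845998735023544795178⟩, 1, [[2116, 340]], [[], [], [],
    [], [], [], [], [⟨7, 16, 252, 6679532932⟩], [⟨7, 1, 363, 8696927616⟩, ⟨7, 16, 438, 8826951044⟩],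
    [⟨7, 1, 797, 9743376515⟩], [⟨7, 1, 1131, 10911518080⟩, ⟨7, 256, 1452, 5706456456⟩], [⟨7, 1,
    2347, 11987420544⟩, ⟨0, 320, 4090, 3809058628145313⟩]]⟩,
  ⟨⟨11, 847696818576247682809015270276774361025747827818580⟩, 1, [[266, 1034, 1282, 1288]], [[], [],
    [], [], [], [], [], [], [⟨8, 2, 462, 8828033377⟩], [⟨8, 513, 853, 8733956160⟩, ⟨8, 128, 970,
    3529548135⟩, ⟨8, 32, 874, 9770672485⟩, ⟨8, 8, 798, 8725276003⟩], [⟨8, 1, 1167, 7561291874⟩, ⟨2,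
    1025, 1983, 12746813354348807⟩, ⟨0, 1281, 2047, 188316762434251782⟩, ⟨8, 8, 1594, 11040624995⟩,
    ⟨8, 2, 1258, 10942061921⟩, ⟨5, 11, 2043, 12529255174935815⟩]]⟩,
  ⟨⟨10, 6601217942911754550729350809924261982287691788⟩, 1, [[144]], [[], [], [], [], [], [], [],
    [], [⟨9, 65, 483, 5402599654⟩, ⟨9, 2, 378, 8795622721⟩, ⟨9, 2, 430, 7625315649⟩], [⟨9, 1, 791,
    9942601762⟩, ⟨9, 512, 888, 6715247945⟩, ⟨9, 256, 996, 5678238024⟩, ⟨9, 256, 860, 3527481672⟩,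
    ⟨9, 1, 907, 8902417443⟩, ⟨9, 512, 940, 2423362889⟩]]⟩,
  ⟨⟨11, 379999168153496417115040680338613939751890707546224⟩, 1, [[136, 386]], [[], [], [], [], [],
    [], [], [], [⟨10, 8, 444, 8765116771⟩], [⟨10, 8, 698, 7819367779⟩], [⟨10, 1, 1475, 11017395238⟩,
    ⟨10, 1025, 1265, 7728370816⟩, ⟨10, 256, 1386, 1278388584⟩, ⟨10, 128, 1422, 8937245730⟩, ⟨10,
    1024, 1890, 1286939816⟩, ⟨10, 2, 1422, 8937053282⟩, ⟨10, 256, 1512, 7720839528⟩, ⟨5, 131, 2031,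
    11584629541903425⟩, ⟨10, 1155, 1699, 9903810603⟩, ⟨10, 258, 1954, 7819602088⟩]]⟩,
  ⟨⟨11, 385838038302720868947671048251113580866868228718858⟩, 1, [[1040, 208, 1664]], [[], [], [],
    [], [], [], [], [⟨11, 1, 215, 6521101441⟩], [⟨11, 4, 476, 7788927330⟩], [⟨11, 1, 573,
    5514470467⟩, ⟨11, 65, 741, 7684334662⟩, ⟨11, 4, 854, 9869238626⟩], [⟨11, 128, 1506,
    11012310375⟩, ⟨11, 16, 1146, 6620808548⟩]]⟩,
  ⟨⟨12, 18582326903910533242620143464886921217941701617587126914⟩, 5, [[], [192], [544], [192],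
    [544]], [[], [], [], [], [], [], [], [⟨12, 2, 215, 6516904321⟩, ⟨12, 32, 249, 239180165⟩], [⟨12,
    2, 343, 8730509697⟩, ⟨12, 260, 335, 42342498⟩, ⟨12, 128, 497, 4569858439⟩, ⟨12, 9, 317,
    8724550723⟩, ⟨12, 16, 315, 5469413764⟩, ⟨12, 80, 474, 7791316004⟩], [⟨12, 1, 723, 6748675456⟩,
    ⟨12, 1, 679, 5605729664⟩, ⟨12, 512, 881, 4568842633⟩, ⟨12, 256, 978, 6745628040⟩, ⟨12, 64, 870,
    8893044102⟩, ⟨12, 64, 742, 7685088646⟩, ⟨12, 16, 826, 9937454468⟩], [⟨12, 2, 1175, 10878978433⟩,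
    ⟨12, 1024, 1714, 7685154186⟩, ⟨12, 8, 1434, 7797319716⟩, ⟨10, 1354, 2046, 8024273715505324⟩,
    ⟨12, 16, 1430, 7786768772⟩, ⟨11, 49, 1969, 250321314124⟩], [⟨12, 2, 2575, 3297783169⟩, ⟨12, 4,
    2327, 8736812033⟩, ⟨12, 2048, 2770, 9869237643⟩, ⟨0, 1096, 4092, 2642271674766668⟩, ⟨12, 16,
    2842, 9943682436⟩, ⟨0, 2084, 3823, 3731786495596908⟩]]⟩,
  ⟨⟨11, 192924638962806402516454799837439673698417344512140⟩, 1, [[592, 1042, 1090, 1104, 1538]],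
    [[], [], [], [], [], [], [], [], [], [⟨13, 1, 843, 9943652387⟩, ⟨13, 256, 922, 4531004776⟩, ⟨13,
    64, 882, 8903659557⟩, ⟨13, 1, 977, 9943652487⟩], [⟨13, 1, 1457, 5514471687⟩, ⟨10, 1536, 2046,
    4544602944280680⟩, ⟨3, 1600, 2042, 325493402541252⟩, ⟨13, 1, 1505, 5581580551⟩, ⟨4, 1552, 2046,
    12705142676820194⟩, ⟨13, 256, 1960, 5681417576⟩, ⟨8, 1296, 2046, 10349740610952459⟩, ⟨13, 64,
    1768, 10981903718⟩, ⟨2, 1282, 2046, 10349807250153826⟩]]⟩,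
  ⟨⟨11, 1145843152925228924751414630152759099766263653138594⟩, 2, [[320, 88], [164, 1060]], [[], [],
    [], [], [], [], [], [], [⟨14, 1, 427, 8827999584⟩, ⟨14, 4, 444, 7790005602⟩], [⟨14, 256, 860,
    9776142466⟩, ⟨3, 265, 1023, 10422648882400293⟩, ⟨14, 128, 937, 3528466791⟩, ⟨14, 66, 603,
    9770995713⟩], [⟨14, 512, 1752, 4637035881⟩, ⟨14, 16, 1622, 10005579108⟩, ⟨14, 16, 1146,
    6613412196⟩, ⟨14, 8, 1614, 11045766499⟩, ⟨1, 1033, 2047, 45397843048076299⟩, ⟨7, 72, 2046,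
    1516542452044101⟩, ⟨14, 1088, 1874, 1214620938⟩, ⟨14, 2, 1179, 10878979425⟩, ⟨14, 1024, 1848,
    3528597866⟩, ⟨6, 1058, 2047, 298613139954499755⟩, ⟨14, 128, 1733, 11041702247⟩, ⟨0, 1184, 2045,
    115697902752907⟩]]⟩,
  ⟨⟨11, 1125382665213673796880977126611095277289728248119304⟩, 1, [[80, 96]], [[], [], [], [], [],
    [], [], [⟨15, 1, 189, 2393904259⟩, ⟨15, 5, 215, 4328889538⟩], [⟨15, 257, 373, 2349175944⟩, ⟨15,
    16, 474, 6718326116⟩], [⟨15, 128, 732, 4401997159⟩, ⟨15, 195, 963, 9907143691⟩, ⟨15, 34, 874,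
    6712304741⟩], [⟨15, 128, 1692, 11043703143⟩, ⟨15, 1025, 1799, 2181408010⟩, ⟨15, 32, 1396,
    2360518792⟩, ⟨15, 128, 1740, 11045768551⟩]]⟩,
  ⟨⟨10, 2319334669767183839625594790783252573039951890⟩, 1, [[12, 36, 40, 72, 96]], [[], [], [], [],
    [], [], [], [⟨16, 64, 250, 5506112838⟩, ⟨16, 4, 190, 5506112834⟩], [⟨16, 1, 335, 8701089857⟩,
    ⟨16, 256, 442, 4463893832⟩, ⟨16, 1, 373, 8768198724⟩], []]⟩,
  ⟨⟨11, 982158091462022267449978468812173861034439906492578⟩, 2, [[1028], [640]], [[], [], [], [],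
    [], [], [⟨17, 66, 119, 5375365185⟩], [⟨17, 1, 231, 6679467360⟩], [⟨17, 1, 423, 8759844192⟩, ⟨17,
    258, 287, 3297087489⟩, ⟨17, 32, 429, 2255495525⟩], [⟨17, 512, 948, 5644618089⟩, ⟨17, 128, 729,
    3432120679⟩, ⟨17, 8, 748, 7727027555⟩, ⟨17, 8, 621, 177281379⟩], [⟨17, 4, 1614, 11045799266⟩,
    ⟨4, 69, 2047, 372887453249343784⟩, ⟨0, 81, 2035, 360853794892801⟩, ⟨1, 2, 1791,
    11583430294801579⟩, ⟨17, 1024, 1764, 2455999850⟩]]⟩,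
  ⟨⟨10, 6422835121895209288406138385817644858418200586⟩, 1, [[20, 68, 80]], [[], [], [], [], [], [],
    [], [], [], [⟨18, 1, 845, 9942603843⟩, ⟨15, 513, 1023, 2398354836396264⟩, ⟨18, 256, 924,
    4532053320⟩, ⟨0, 641, 1023, 6869930350018596⟩, ⟨18, 64, 884, 8902611013⟩, ⟨8, 577, 1021,
    325600732679362⟩, ⟨3, 529, 1023, 8169476659123520⟩, ⟨7, 273, 1023, 10349947832607041⟩, ⟨18, 4,
    884, 8902482053⟩, ⟨9, 517, 1023, 11583630082213985⟩, ⟨13, 261, 1023, 10349847941025034⟩, ⟨17,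
    644, 1004, 175264307466⟩]]⟩,
  ⟨⟨12, 50669080947870162799768547170863928752271064919660103942⟩, 4, [[640], [], [3392], [640]],
    [[], [], [], [], [], [], [⟨18, 97, 127, 36713794700⟩], [⟨18, 134, 254, 107610183852⟩], [⟨19, 1,
    407, 7788889472⟩, ⟨19, 2, 315, 4471131521⟩, ⟨19, 2, 363, 6551508353⟩, ⟨19, 4, 317, 5511318914⟩,
    ⟨19, 32, 442, 8827998597⟩, ⟨19, 264, 366, 5411051587⟩, ⟨19, 32, 438, 8827045253⟩], [⟨19, 1, 791,
    9936373120⟩, ⟨19, 16, 698, 3267503333⟩, ⟨19, 2, 619, 9837838721⟩, ⟨19, 2, 694, 2294326501⟩, ⟨19,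
    256, 963, 6678390152⟩, ⟨19, 520, 718, 7727351843⟩, ⟨19, 128, 694, 2294522917⟩, ⟨19, 16, 629,
    9831520644⟩], [⟨19, 4, 1085, 5513511298⟩, ⟨19, 32, 1203, 10972336517⟩, ⟨19, 8, 1182,
    7855998339⟩], [⟨19, 1, 2443, 7787818368⟩, ⟨19, 129, 2695, 10040510496⟩, ⟨19, 64, 2266,
    11946532230⟩, ⟨19, 2, 2219, 7695502721⟩, ⟨19, 2118, 2758, 10040313900⟩, ⟨19, 16, 2772,
    10040314244⟩]]⟩,
  ⟨⟨11, 409229067073865399716028531295870361563014028329004⟩, 1, [[144, 258]], [[], [], [], [], [],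
    [], [], [], [⟨20, 1, 317, 8761970016⟩], [], [⟨20, 256, 1842, 4631860584⟩, ⟨20, 16, 1492,
    8933017956⟩, ⟨0, 273, 2047, 82232720629181764⟩]]⟩,
  ⟨⟨11, 798004335667468634808150190318984908951937408630802⟩, 1, [[]], [[], [], [], [], [], [], [],
    [⟨21, 33, 237, 3288702149⟩, ⟨21, 4, 222, 7656738146⟩], [⟨21, 256, 474, 4531096936⟩, ⟨2, 129,
    511, 114560804818955⟩, ⟨2, 65, 511, 114595167667211⟩], [⟨21, 65, 869, 2315625734⟩, ⟨21, 8, 910,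
    7785751907⟩, ⟨21, 9, 813, 5436187907⟩, ⟨20, 644, 1004, 180692949099⟩, ⟨21, 4, 670, 7659947362⟩],
    [⟨21, 1, 1351, 8802805825⟩, ⟨21, 1024, 1706, 3530720618⟩, ⟨21, 4, 1310, 8701120866⟩, ⟨21, 1157,
    1925, 10007840779⟩]]⟩,
  ⟨⟨10, 2899109129048043213157525105912368599527063564⟩, 1, [[274, 322, 336, 592, 784]], [[], [],
    [], [], [], [], [], [], [⟨22, 1, 407, 7660904482⟩, ⟨22, 33, 483, 7717855269⟩], [⟨22, 1, 603,
    9707722883⟩, ⟨1, 769, 1023, 10281636522401861⟩, ⟨3, 320, 1022, 324496626226442⟩, ⟨12, 833, 1019,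
    45225108154560⟩, ⟨22, 16, 924, 9907014980⟩, ⟨0, 529, 1023, 359750861882440⟩, ⟨3, 272, 1022,
    324565348780298⟩, ⟨22, 2, 910, 7826640193⟩, ⟨22, 2, 630, 6614492481⟩]]⟩,
  ⟨⟨11, 654760048696793233012733068552063912280451547660436⟩, 1, [[74, 266]], [[], [], [], [], [],
    [], [], [], [⟨23, 1, 469, 8730516832⟩], [⟨23, 8, 730, 6745723235⟩], [⟨23, 1, 1227, 6789532711⟩,
    ⟨23, 64, 1388, 8928790886⟩, ⟨23, 64, 1614, 3524340070⟩, ⟨23, 65, 1635, 1241884966⟩, ⟨3, 259,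
    2047, 146379122484127048⟩, ⟨0, 259, 1471, 357620564100322⟩]]⟩,
  ⟨⟨10, 3032955796519645106498191867910626853759221808⟩, 1, [[12, 68, 328, 772]], [[], [], [], [],
    [], [], [], [], [⟨5, 3, 511, 351984416889064⟩], [⟨24, 1, 873, 9774833861⟩, ⟨24, 512, 826,
    8768491555⟩, ⟨24, 256, 972, 3533969479⟩, ⟨0, 769, 1023, 10425680051472420⟩, ⟨24, 64, 972,
    3533905991⟩, ⟨19, 321, 1023, 10171721665648872⟩, ⟨24, 833, 851, 1279272202⟩, ⟨24, 8, 814,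
    8759846211⟩, ⟨24, 8, 636, 6612460867⟩, ⟨13, 261, 1023, 10351938751335562⟩, ⟨24, 771, 851,
    6480209162⟩]]⟩,
  ⟨⟨10, 5798414256263660317616680974522051982464909348⟩, 1, [[10, 66]], [[], [], [], [], [], [], [],
    [], [⟨25, 128, 486, 5572174151⟩, ⟨6, 65, 511, 289210315772938⟩, ⟨25, 17, 347, 8690931748⟩, ⟨25,
    8, 366, 6611345731⟩, ⟨6, 3, 511, 289382117443594⟩], [⟨25, 1, 655, 7560242274⟩, ⟨19, 513, 1023,
    11584595204052167⟩, ⟨25, 8, 826, 9933296963⟩, ⟨8, 585, 991, 148712204739904⟩, ⟨25, 257, 969,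
    6677668968⟩]]⟩,
  ⟨⟨11, 958774422047386646173505035195134851518922850631718⟩, 3, [[144, 272], [], []], [[], [], [],
    [], [], [], [⟨26, 1, 119, 4469066080⟩], [⟨26, 1, 183, 4470146400⟩, ⟨26, 64, 219, 4395670886⟩],
    [⟨26, 1, 423, 7591728480⟩, ⟨26, 2, 483, 7722770785⟩, ⟨26, 18, 343, 2152046785⟩, ⟨26, 8, 504,
    7722901859⟩], [⟨26, 2, 963, 9939648865⟩, ⟨26, 160, 945, 8899629061⟩, ⟨26, 650, 667, 4395672811⟩,
    ⟨26, 4, 965, 8898445666⟩, ⟨26, 256, 795, 4395672936⟩, ⟨26, 20, 725, 6681895938⟩, ⟨26, 20, 917,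
    8896486402⟩, ⟨26, 20, 663, 1078306018⟩], [⟨26, 128, 1237, 4630583655⟩]]⟩,
  ⟨⟨11, 935389771480270314508717564980141484974307134930988⟩, 1, [[18, 322, 336]], [[], [], [], [],
    [], [], [], [], [], [⟨27, 1, 795, 8903462947⟩, ⟨1, 513, 1007, 397206131671202⟩, ⟨27, 256, 946,
    1312990568⟩, ⟨26, 641, 1001, 108692248843⟩, ⟨27, 1, 843, 8903464995⟩, ⟨2, 257, 1007,
    329034224475330⟩, ⟨4, 65, 1007, 319140805148779⟩, ⟨27, 1, 857, 8903465091⟩, ⟨10, 515, 1007,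
    220215020530690⟩, ⟨27, 1, 729, 7729063043⟩, ⟨4, 66, 1022, 319138760426603⟩, ⟨8, 579, 1015,
    325702772752452⟩], [⟨27, 512, 1834, 5638302057⟩]]⟩,
  ⟨⟨11, 964620339412785297060077335335098613101410941730838⟩, 2, [[], [576]], [[], [], [], [], [],
    [], [⟨28, 65, 95, 3294990368⟩], [⟨28, 8, 238, 6678546787⟩, ⟨28, 8, 252, 6681692515⟩, ⟨28, 8,
    237, 6677402979⟩], [⟨28, 1, 287, 3296760160⟩, ⟨28, 2, 363, 6714196321⟩], [⟨2, 585, 1007,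
    70411904978087⟩, ⟨28, 2, 574, 2259723397⟩, ⟨28, 8, 685, 9831521635⟩, ⟨28, 2, 698, 7628432517⟩],
    [⟨9, 257, 1855, 108100209083659⟩, ⟨28, 1024, 1268, 6682708330⟩, ⟨0, 289, 1983,
    7989399380992299⟩, ⟨28, 1313, 1385, 6714206219⟩, ⟨28, 129, 1737, 9999587431⟩, ⟨1, 73, 2043,
    10312601022203232⟩, ⟨28, 1097, 1385, 8796612619⟩, ⟨28, 80, 1145, 3395659780⟩]]⟩,
  ⟨⟨10, 2140921222153788012949027434996544021857632266⟩, 1, [[324]], [[], [], [], [], [], [], [⟨29,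
    4, 126, 5509254466⟩], [⟨29, 128, 250, 1279429959⟩], [⟨29, 256, 492, 2258901159⟩, ⟨29, 64, 492,
    2258837671⟩, ⟨29, 32, 492, 2258804935⟩, ⟨28, 145, 415, 104294517002⟩], [⟨29, 1, 839,
    9875497025⟩, ⟨0, 513, 1023, 1346912724813988⟩, ⟨7, 321, 1023, 11261336878161097⟩, ⟨29, 33, 693,
    2282038501⟩, ⟨11, 529, 1023, 9150379544553766⟩, ⟨4, 68, 1022, 116618232566025⟩, ⟨4, 36, 1022,
    116621421282569⟩, ⟨6, 289, 1019, 115450006738148⟩, ⟨6, 97, 1019, 109952515642601⟩]]⟩,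
  ⟨⟨10, 6601239041893097417500274026302966555470004250⟩, 1, [[96, 260]], [[], [], [], [], [], [],
    [], [], [⟨30, 1, 315, 5511351616⟩], [⟨30, 1, 621, 5681190979⟩, ⟨20, 320, 1022, 319994563139818⟩,
    ⟨30, 1, 845, 8902416451⟩, ⟨5, 33, 767, 327830560939201⟩, ⟨20, 36, 1022, 320102034737386⟩]]⟩,
  ⟨⟨11, 1125380881170390429616759076437799368773184486965290⟩, 1, [[20, 1104]], [[], [], [], [], [],
    [], [], [], [⟨31, 4, 414, 8829109602⟩], [⟨31, 1, 821, 9809436741⟩, ⟨31, 513, 811, 8767507488⟩,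
    ⟨21, 769, 1019, 329003222368417⟩, ⟨31, 1, 869, 9876545605⟩], [⟨31, 256, 1458, 1413651816⟩, ⟨14,
    273, 1915, 222381901655043⟩, ⟨8, 80, 1918, 285118259466411⟩, ⟨29, 337, 1535,
    11649463406008357⟩]]⟩,
  ⟨⟨10, 5976779382441328342571337533214444196851875928⟩, 1, [[34, 416, 642, 672]], [[], [], [], [],
    [], [], [], [], [⟨32, 1, 311, 2191532196⟩, ⟨32, 5, 349, 8726583392⟩, ⟨32, 1, 437, 2392858788⟩],
    [⟨6, 257, 991, 360951240065126⟩, ⟨0, 385, 1023, 10212615247822949⟩, ⟨32, 1, 915, 9942604836⟩,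
    ⟨7, 513, 991, 292782553041126⟩, ⟨9, 129, 991, 288383468535946⟩, ⟨31, 261, 925, 140735683882⟩,
    ⟨15, 259, 991, 256465450412038⟩, ⟨9, 130, 1022, 288384675447946⟩, ⟨13, 387, 1007,
    291447153721541⟩]]⟩,
  ⟨⟨10, 9366489932965581429225507862661639320803999788⟩, 1, [[82, 322]], [[], [], [], [], [], [],
    [], [], [⟨33, 1, 317, 4471228736⟩, ⟨33, 1, 459, 7560241347⟩], [⟨3, 257, 959, 143251354160138⟩,
    ⟨32, 385, 911, 105469969706⟩, ⟨10, 273, 1015, 282922615736614⟩, ⟨14, 17, 959, 284810328151178⟩,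
    ⟨0, 529, 959, 114422400943338⟩, ⟨2, 273, 959, 284779220338727⟩, ⟨10, 259, 1015,
    286217929299238⟩, ⟨14, 18, 1022, 284982124780682⟩, ⟨0, 530, 1022, 114422468090026⟩, ⟨2, 274,
    1022, 284815727560901⟩]]⟩,
  ⟨⟨11, 938314023591218585219990982992559836888440668684324⟩, 1, [[18, 194]], [[], [], [], [], [],
    [], [], [], [⟨34, 16, 374, 6611345764⟩, ⟨34, 8, 462, 8826952035⟩, ⟨17, 259, 511,
    82742581664934⟩], [⟨34, 1, 753, 9876544645⟩, ⟨34, 128, 938, 9933264231⟩, ⟨34, 64, 874,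
    8893076838⟩, ⟨4, 321, 895, 40822657789129⟩, ⟨15, 643, 991, 221284336501824⟩], [⟨34, 512, 1874,
    1413749097⟩, ⟨34, 513, 1873, 4563773641⟩, ⟨34, 129, 1481, 6543485191⟩, ⟨28, 67, 2015,
    393869239816457⟩, ⟨34, 323, 1363, 4573927435⟩]]⟩,
  ⟨⟨10, 2230130327833208911133412435143931406611906600⟩, 1, [[258]], [[], [], [], [], [], [], [],
    [⟨35, 4, 252, 7728075876⟩], [⟨16, 257, 511, 218839458780170⟩, ⟨35, 128, 490, 5640329543⟩, ⟨4,
    321, 511, 219083396220963⟩, ⟨35, 16, 378, 8758860100⟩, ⟨2, 273, 511, 252956566094954⟩, ⟨16, 3,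
    511, 219079978814474⟩, ⟨4, 67, 511, 218840730568965⟩, ⟨2, 19, 511, 252956498763946⟩], [⟨35, 1,
    945, 7795123333⟩, ⟨0, 513, 1023, 1381062073778282⟩]]⟩,
  ⟨⟨9, 54446554667444108892014611756342963142790⟩, 2, [[72, 264], [16]], [[], [], [], [], [], [],
    [], [], [⟨36, 1, 455, 8831142176⟩, ⟨6, 257, 511, 213478265854985⟩, ⟨17, 65, 511,
    289276956771529⟩, ⟨5, 321, 511, 289172940294244⟩, ⟨3, 97, 511, 255161898372233⟩, ⟨35, 273, 445,
    242808261801⟩, ⟨36, 2, 438, 7794102341⟩, ⟨10, 258, 511, 325699317695494⟩, ⟨11, 130, 511,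
    291611137444934⟩, ⟨35, 266, 431, 171907778793⟩, ⟨13, 6, 511, 288315920155817⟩, ⟨0, 262, 511,
    316908495833190⟩, ⟨2, 134, 511, 184855432497257⟩]]⟩,
  ⟨⟨11, 1028921148299128206282023901911096372392051354697810⟩, 1, [[268, 1036]], [[], [], [], [],
    [], [], [⟨37, 1, 119, 5572170080⟩], [], [⟨37, 1, 343, 8726288736⟩], [⟨37, 1, 921, 7628399876⟩],
    [⟨37, 4, 1596, 3367053481⟩, ⟨36, 1281, 1905, 143143478475⟩, ⟨37, 1, 1363, 10947265888⟩]]⟩,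
  ⟨⟨10, 6066031365422832947427910147514845210571243530⟩, 1, [[4]], [[], [], [], [], [], [], [⟨37,
    81, 127, 37786486954⟩], [⟨38, 1, 183, 5513419841⟩, ⟨1, 129, 255, 4580623714307⟩], [⟨38, 32, 444,
    7786828101⟩, ⟨38, 33, 373, 2349146245⟩], [⟨38, 16, 698, 3396379972⟩, ⟨0, 145, 1023,
    6941293414485002⟩]]⟩,
  ⟨⟨11, 204614511036109346348703318906808593194849860321420⟩, 1, [[800, 1792, 786, 1554, 1584]],
    [[], [], [], [], [], [], [⟨38, 97, 127, 105433272363⟩], [], [⟨39, 1, 311, 5413806210⟩, ⟨39, 32,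
    442, 8829109605⟩], [⟨39, 1, 655, 9899674976⟩, ⟨13, 513, 1007, 111091787202635⟩, ⟨39, 2, 622,
    9868314977⟩, ⟨29, 515, 959, 40822969015304⟩, ⟨8, 515, 767, 183620694224166⟩], [⟨39, 1, 1079,
    5413808258⟩, ⟨22, 272, 1534, 357378029623435⟩, ⟨14, 560, 2042, 44196525412714⟩, ⟨39, 1, 1505,
    6722431143⟩]]⟩,
  ⟨⟨11, 941236491647995756098124357552295311682777406308498⟩, 4, [[288, 1280], [], [], [288, 1280]],
    [[], [], [], [], [], [], [⟨39, 73, 127, 138717172811⟩], [⟨40, 1, 219, 6680610144⟩, ⟨40, 2, 175,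
    3295679841⟩, ⟨40, 4, 222, 7721813346⟩, ⟨39, 148, 247, 207373800459⟩], [⟨40, 64, 492,
    8828032358⟩, ⟨40, 16, 442, 7785844068⟩, ⟨40, 8, 377, 6621863940⟩, ⟨40, 136, 459, 1077256391⟩,
    ⟨39, 322, 499, 172073455851⟩], [⟨40, 128, 965, 9934405991⟩, ⟨3, 642, 763, 6840981128491⟩, ⟨40,
    4, 591, 9764378978⟩, ⟨40, 8, 605, 140584291⟩, ⟨40, 64, 741, 244484454⟩], [⟨40, 1, 1179,
    10975577440⟩, ⟨39, 642, 1766, 174190532939⟩, ⟨0, 644, 2045, 11268040179131563⟩, ⟨40, 1, 1505,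
    5581580551⟩, ⟨15, 1025, 2035, 212381848544523⟩, ⟨23, 264, 2044, 358622496362603⟩, ⟨1, 33, 2037,
    81681929212075⟩, ⟨40, 1056, 1394, 8735004709⟩]]⟩,
  ⟨⟨10, 8563672633984377449316604979828480438348546088⟩, 1, [[18, 322, 578]], [[], [], [], [], [],
    [], [], [⟨41, 1, 219, 7728009251⟩], [⟨41, 64, 490, 8758861126⟩, ⟨41, 16, 470, 6687957026⟩, ⟨41,
    1, 497, 7728013445⟩, ⟨4, 258, 510, 7913552908323⟩], [⟨41, 128, 742, 5571159367⟩, ⟨41, 64, 746,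
    9899709766⟩, ⟨41, 256, 870, 6611346760⟩, ⟨41, 129, 725, 4362413255⟩, ⟨2, 66, 1022,
    325631609965770⟩]]⟩,
  ⟨⟨11, 853545858206584819409002141756402364918112300302412⟩, 1, [[290]], [[], [], [], [], [], [],
    [], [], [⟨42, 1, 349, 8795556192⟩, ⟨42, 16, 442, 8825967972⟩, ⟨41, 273, 501, 208448525547⟩],
    [⟨42, 32, 698, 1186112740⟩, ⟨42, 16, 828, 8894188900⟩], [⟨42, 1, 1083, 5514471459⟩, ⟨0, 1280,
    2044, 78243844919403⟩, ⟨17, 257, 2041, 183765813103947⟩]]⟩,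
  ⟨⟨10, 7493279058159984480613253315501731879719338026⟩, 1, [[68, 80, 276]], [[], [], [], [], [],
    [], [], [⟨43, 1, 215, 7728009281⟩], [⟨43, 1, 363, 8764034368⟩, ⟨43, 1, 413, 8835305539⟩], [⟨43,
    1, 669, 9808387139⟩, ⟨43, 16, 636, 6746641732⟩, ⟨4, 261, 1021, 221144920948834⟩]]⟩,
  ⟨⟨10, 7158767880150872778448343382967549200542728740⟩, 4, [[272, 320], [272], [656], []], [[], [],
    [], [], [], [], [⟨43, 67, 127, 175221280842⟩], [⟨44, 2, 235, 6677499201⟩, ⟨44, 4, 237,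
    7722765634⟩, ⟨43, 164, 254, 209554837546⟩, ⟨44, 8, 159, 74486083⟩], [⟨44, 1, 371, 6587162661⟩,
    ⟨44, 129, 459, 3255115975⟩, ⟨44, 64, 469, 8824885574⟩, ⟨44, 32, 441, 7787905349⟩, ⟨43, 328, 506,
    138787525866⟩], [⟨2, 257, 1021, 107894956890346⟩, ⟨5, 65, 1019, 106901907973322⟩, ⟨44, 16, 726,
    1319248966⟩, ⟨44, 64, 729, 305274182⟩, ⟨19, 3, 1015, 143152334937354⟩, ⟨0, 19, 1019,
    291584261360682⟩, ⟨19, 132, 1015, 142017625784618⟩, ⟨2, 640, 1019, 106796752868362⟩, ⟨0, 148,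
    1021, 325627481820234⟩, ⟨44, 128, 756, 5513651270⟩, ⟨3, 648, 1023, 1381162909240384⟩, ⟨1, 168,
    1023, 9323932832468010⟩, ⟨43, 552, 637, 139893774346⟩, ⟨3, 265, 1023, 2261906048224295⟩, ⟨1, 73,
    1023, 10422311661341770⟩]]⟩,
  ⟨⟨10, 7850080772865468249142740723809419356545482788⟩, 1, [[18, 130]], [[], [], [], [], [], [],
    [], [], [⟨45, 1, 335, 8633981026⟩, ⟨45, 64, 500, 8830191942⟩, ⟨45, 8, 444, 8830191939⟩, ⟨45, 2,
    438, 7788988737⟩], [⟨45, 257, 907, 3456443432⟩, ⟨4, 265, 1023, 10352177997550602⟩, ⟨44, 321,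
    871, 74362914090⟩]]⟩,
  ⟨⟨10, 7181068625380557182741088067046846395704410148⟩, 1, [[2]], [[], [], [], [], [], [], [], [],
    [⟨46, 1, 435, 7795118117⟩, ⟨46, 1, 315, 3365937189⟩], [⟨21, 257, 1015, 148650160457770⟩, ⟨46,
    65, 723, 1376066694⟩, ⟨8, 17, 1023, 1313128273092835⟩, ⟨45, 529, 631, 174252360906⟩, ⟨0, 272,
    1022, 317834298233002⟩, ⟨2, 144, 1022, 317939322595555⟩]]⟩,
  ⟨⟨9, 54446881793713580847606388004918898524170⟩, 1, [[4]], [[], [], [], [], [], [], [⟨46, 81, 127,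
    104358480041⟩], [⟨47, 1, 189, 5512371267⟩, ⟨10, 129, 255, 4579617081345⟩], [⟨47, 32, 438,
    7786762533⟩, ⟨47, 33, 373, 2349113477⟩, ⟨8, 17, 511, 316695961114792⟩, ⟨2, 273, 511,
    213345089396743⟩, ⟨0, 145, 511, 71471649299656⟩]]⟩,
  ⟨⟨10, 5932195587049299576237767329344301758662574084⟩, 1, [[10]], [[], [], [], [], [], [], [],
    [⟨48, 128, 238, 5572169031⟩], [⟨48, 1, 343, 6721376290⟩, ⟨48, 64, 492, 2419299654⟩, ⟨48, 16,
    444, 3464566084⟩, ⟨48, 65, 483, 1308958886⟩, ⟨48, 2, 474, 8801783911⟩, ⟨47, 290, 502,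
    76411867338⟩], [⟨48, 256, 876, 3528657224⟩, ⟨48, 256, 860, 3527481672⟩, ⟨23, 265, 991,
    215745948814624⟩, ⟨29, 25, 991, 220212875039040⟩, ⟨11, 265, 975, 6837858510147⟩]]⟩,
  ⟨⟨10, 5909904369705117869545282797677881345937572386⟩, 3, [[392], [576], [128]], [[], [], [], [],
    [], [], [⟨49, 2, 111, 6548359489⟩], [⟨49, 16, 246, 6678451524⟩, ⟨49, 4, 189, 178330724⟩, ⟨12,
    133, 255, 5504137988330⟩], [⟨49, 128, 444, 8768425028⟩, ⟨49, 64, 490, 5638298950⟩, ⟨49, 8, 444,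
    8768298052⟩, ⟨49, 32, 373, 6713114949⟩, ⟨49, 32, 371, 6711939397⟩, ⟨49, 32, 435, 7651467589⟩,
    ⟨49, 8, 347, 8791298371⟩, ⟨49, 4, 444, 8768265316⟩], [⟨0, 1, 895, 287079977386282⟩, ⟨7, 257,
    1019, 253030759926826⟩, ⟨49, 129, 679, 2188715168⟩, ⟨49, 8, 718, 7719658819⟩, ⟨42, 66, 1023,
    2502666977838090⟩, ⟨49, 32, 700, 9774996548⟩, ⟨5, 82, 895, 325627445119018⟩, ⟨49, 260, 996,
    7719953576⟩, ⟨49, 8, 922, 8899396931⟩, ⟨5, 141, 1021, 325627445119303⟩]]⟩,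
  ⟨⟨10, 2319325141840141024048019842413824723496796202⟩, 1, [[532, 656, 784]], [[], [], [], [], [],
    [], [], [⟨50, 64, 252, 3360759110⟩], [⟨50, 256, 444, 4400946504⟩, ⟨8, 17, 511, 253165908789418⟩,
    ⟨50, 4, 438, 7788860738⟩], [⟨50, 1, 797, 2426414211⟩, ⟨20, 513, 991, 356354511603911⟩, ⟨40, 640,
    1022, 284812411741381⟩, ⟨50, 256, 910, 9765461320⟩, ⟨40, 144, 1022, 284955219398849⟩, ⟨50, 4,
    822, 9835684162⟩, ⟨27, 641, 1019, 282821593956453⟩, ⟨50, 4, 934, 7794230594⟩, ⟨27, 145, 1019,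
    287219808075873⟩]]⟩,
  ⟨⟨9, 65335647545887870440019094100971221680140⟩, 1, [[2]], [[], [], [], [], [], [], [⟨50, 81, 127,
    72081212585⟩], [⟨51, 1, 231, 5579480098⟩, ⟨14, 129, 255, 6778606715907⟩, ⟨3, 33, 255,
    7835167656969⟩], [⟨1, 65, 511, 39864986838019⟩, ⟨7, 193, 511, 38659002933481⟩, ⟨0, 161, 511,
    147616995379203⟩]]⟩,
  ⟨⟨9, 22459072403310894346131380539121206624298⟩, 1, [[20, 68, 80]], [[], [], [], [], [], [], [],
    [], [⟨52, 1, 343, 6720327745⟩, ⟨1, 257, 511, 185027328672839⟩, ⟨51, 385, 463, 37824235721⟩, ⟨52,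
    64, 380, 4464943398⟩, ⟨15, 17, 479, 9011953108995⟩, ⟨15, 273, 509, 9107686954080⟩, ⟨15, 5, 503,
    9011951013893⟩, ⟨15, 261, 509, 9109834370208⟩]]⟩,
  ⟨⟨10, 9321892526237316692715011477343516220627091540⟩, 1, [[162, 266, 290, 296]], [[], [], [], [],
    [], [], [], [⟨53, 1, 235, 3466597414⟩, ⟨53, 8, 190, 5504048451⟩], [⟨53, 1, 399, 7627350050⟩,
    ⟨53, 1, 441, 7627350180⟩, ⟨16, 42, 510, 7911434790977⟩], [⟨6, 129, 1021, 186096876060874⟩, ⟨16,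
    385, 987, 3437292169408⟩, ⟨36, 257, 991, 42986490761226⟩, ⟨9, 160, 1022, 283781417380006⟩, ⟨9,
    9, 991, 45327207999492⟩, ⟨36, 257, 1021, 183726126598154⟩, ⟨16, 385, 1005, 3372867659968⟩, ⟨36,
    34, 1022, 285023832971306⟩, ⟨9, 9, 1021, 186064698451970⟩]]⟩,
  ⟨⟨9, 66016212277590493891311450071748198006896⟩, 1, [[10, 136]], [[], [], [], [], [], [], [],
    [⟨54, 1, 243, 1248991520⟩], [⟨2, 129, 479, 1177025518729⟩, ⟨2, 3, 495, 7774095279273⟩, ⟨0, 131,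
    511, 107958439773353⟩]]⟩,
  ⟨⟨8, 373858367332292583725663706979565578⟩, 1, [[4]], [[], [], [], [], [], [], [⟨54, 81, 127,
    104358480040⟩], [⟨55, 1, 189, 5511322691⟩, ⟨18, 129, 255, 4578543339521⟩, ⟨7, 33, 255,
    7904992330760⟩, ⟨2, 161, 255, 4470228386984⟩, ⟨3, 17, 255, 8800557009991⟩, ⟨0, 145, 255,
    5536447826120⟩]]⟩,
  ⟨⟨11, 771701588067216154825693428766358122621970553307178⟩, 1, [[388]], [[], [], [], [], [], [],
    [], [], [⟨56, 1, 427, 7692389728⟩, ⟨56, 4, 380, 8795559266⟩], [⟨56, 1, 683, 7693501792⟩, ⟨56, 1,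
    791, 9943650369⟩, ⟨56, 1, 605, 6521103491⟩, ⟨37, 400, 1022, 320096676419813⟩, ⟨0, 645, 967,
    247238854688⟩], [⟨56, 640, 1930, 1349888105⟩, ⟨56, 144, 1434, 8631199844⟩]]⟩,
  ⟨⟨10, 1873322487743960137908365873389781306838876248⟩, 1, [[130, 546]], [[], [], [], [], [], [],
    [], [⟨57, 1, 249, 5577478464⟩], [⟨1, 33, 375, 69935994890⟩, ⟨57, 5, 349, 8726583392⟩], [⟨57, 1,
    819, 5647639588⟩, ⟨20, 641, 927, 9038894039338⟩, ⟨1, 33, 885, 78525929482⟩]]⟩,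
  ⟨⟨10, 7158758352078435034422430759103487283441500678⟩, 4, [[64], [], [528], [96, 320]], [[], [],
    [], [], [], [], [], [⟨58, 16, 252, 7686166852⟩, ⟨58, 66, 235, 5610212353⟩, ⟨58, 8, 222,
    6584043843⟩], [⟨58, 128, 438, 2420278599⟩, ⟨58, 2, 411, 8829108545⟩, ⟨58, 4, 413, 7788921154⟩,
    ⟨58, 128, 435, 4462780743⟩, ⟨2, 148, 446, 176195610696⟩, ⟨58, 8, 318, 5511382339⟩], [⟨58, 1,
    711, 6751816000⟩, ⟨58, 16, 634, 9866155332⟩, ⟨58, 2, 683, 5613030721⟩, ⟨58, 2, 667, 4405075265⟩,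
    ⟨0, 534, 959, 7870797194563⟩]]⟩,
  ⟨⟨10, 7314862888142270479573964479205951956188463178⟩, 1, [[20]], [[], [], [], [], [], [], [],
    [⟨59, 33, 235, 7723093024⟩, ⟨58, 161, 253, 209554770058⟩, ⟨3, 17, 253, 174154976266⟩], [⟨59, 1,
    347, 4404058432⟩], [⟨59, 256, 918, 4531987784⟩, ⟨59, 4, 630, 9869362498⟩]]⟩,
  ⟨⟨10, 6066021837516558843911872720401646127976546324⟩, 1, [[66, 72]], [[], [], [], [], [], [], [],
    [], [⟨8, 289, 503, 6843300578372⟩, ⟨4, 161, 431, 282729710755⟩, ⟨60, 8, 380, 6618681667⟩, ⟨60,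
    2, 374, 6618681665⟩], [⟨60, 1, 783, 9942600738⟩, ⟨3, 513, 1023, 11584668352775235⟩, ⟨60, 256,
    980, 4603480392⟩, ⟨59, 641, 919, 139830756618⟩, ⟨1, 577, 1021, 108032627638564⟩, ⟨60, 1, 667,
    7560242276⟩, ⟨0, 545, 959, 11308892226723⟩]]⟩,
  ⟨⟨11, 192919821835785678154014126999777551069295437742114⟩, 1, [[272, 532]], [[], [], [], [], [],
    [], [⟨60, 73, 127, 172979392587⟩, ⟨5, 5, 127, 107548312587⟩], [⟨6, 145, 255, 6843001867328⟩],
    [⟨61, 1, 373, 2360352901⟩, ⟨16, 265, 511, 289383190134859⟩], [⟨61, 512, 700, 5514763331⟩, ⟨61,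
    64, 870, 8758830438⟩, ⟨61, 16, 826, 8767243620⟩, ⟨61, 512, 742, 1152687270⟩], [⟨61, 256, 1496,
    4407437511⟩, ⟨61, 1024, 1134, 5581900834⟩, ⟨61, 64, 1652, 4473300326⟩, ⟨61, 1345, 1859,
    9866062091⟩]]⟩,
  ⟨⟨11, 935389771480270054883733433439295406478951862501420⟩, 1, [[66, 1360]], [[], [], [], [], [],
    [], [], [⟨62, 1, 219, 7661951011⟩, ⟨62, 16, 246, 6611344740⟩], [⟨62, 16, 476, 8831207780⟩],
    [⟨62, 129, 685, 9772045376⟩, ⟨61, 641, 953, 108692246795⟩, ⟨62, 1, 795, 8903462947⟩, ⟨62, 1,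
    667, 7661954083⟩, ⟨62, 528, 694, 1150655652⟩, ⟨62, 1, 857, 8903465091⟩, ⟨62, 258, 994,
    6611641576⟩], [⟨62, 512, 1834, 5638302057⟩, ⟨62, 16, 1206, 10973418852⟩, ⟨62, 1025, 1325,
    8768556096⟩, ⟨0, 513, 2045, 2475004205895914⟩]]⟩,
  ⟨⟨10, 6422833760599577964107349490606950587425357852⟩, 1, [[66]], [[], [], [], [], [], [], [],
    [⟨63, 1, 221, 7656802624⟩], [⟨63, 1, 349, 6551572800⟩, ⟨26, 193, 503, 8871495110976⟩], [⟨63, 64,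
    742, 2191729893⟩, ⟨63, 513, 669, 7660178496⟩]]⟩,
  ⟨⟨11, 941235778040482702318300303719630375078668748455980⟩, 1, [[18, 66]], [[], [], [], [], [],
    [], [], [⟨64, 1, 219, 7661951011⟩, ⟨64, 16, 246, 6611344740⟩], [⟨64, 1, 347, 8802799651⟩, ⟨64,
    64, 490, 7785780582⟩, ⟨6, 131, 511, 78340576969829⟩], [⟨64, 129, 685, 9772045376⟩, ⟨64, 1, 729,
    7661954243⟩], [⟨63, 641, 1693, 105471021387⟩, ⟨0, 513, 2041, 359827299635301⟩]]⟩,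
  ⟨⟨10, 1516477896432201799026473116519485859873226762⟩, 1, [[20, 132]], [[], [], [], [], [], [],
    [], [⟨65, 1, 221, 7728009283⟩, ⟨9, 65, 239, 173987269642⟩, ⟨64, 161, 239, 37756078282⟩, ⟨10,
    145, 255, 7737519997253⟩], [⟨65, 260, 430, 7558468706⟩], [⟨2, 129, 1023, 11506398918807813⟩,
    ⟨64, 641, 719, 37890296010⟩, ⟨0, 385, 1023, 1383194355239205⟩, ⟨4, 17, 767, 247400994343017⟩,
    ⟨65, 512, 686, 7560533090⟩, ⟨65, 4, 670, 4403012930⟩]]⟩,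
  ⟨⟨9, 44919027442578659832149480642043187626002⟩, 1, [[4]], [[], [], [], [], [], [], [], [⟨66, 1,
    221, 6686772292⟩, ⟨10, 136, 254, 36681519209⟩, ⟨11, 73, 255, 6776386882849⟩], [⟨0, 129, 511,
    291584289671331⟩, ⟨66, 64, 474, 3365085223⟩, ⟨6, 321, 511, 291584361959425⟩, ⟨66, 33, 365,
    8657344613⟩, ⟨5, 9, 511, 216716540938376⟩, ⟨66, 256, 374, 6619926562⟩]]⟩,
  ⟨⟨10, 4460200766800546702509782662930551356505456656⟩, 1, [[2]], [[], [], [], [], [], [], [],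
    [⟨67, 33, 235, 1174740165⟩, ⟨67, 5, 207, 3255114946⟩], [⟨67, 1, 371, 6620717092⟩, ⟨67, 1, 311,
    2191532196⟩, ⟨7, 321, 511, 248701165768739⟩], [⟨67, 256, 814, 2191795363⟩, ⟨67, 513, 715,
    1174740169⟩]]⟩,
  ⟨⟨10, 5798425145387670200741297611739478368209600672⟩, 1, [[18, 66, 80]], [[], [], [], [], [], [],
    [⟨68, 1, 119, 1151342725⟩], [⟨12, 5, 191, 107610182666⟩, ⟨12, 5, 239, 109757666314⟩, ⟨67, 11,
    191, 245988593738⟩], [⟨68, 1, 311, 1151344773⟩, ⟨68, 1, 359, 1151344837⟩], [⟨2, 321, 991,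
    140779576364105⟩, ⟨2, 273, 991, 211148253432905⟩, ⟨68, 1, 629, 9741277317⟩, ⟨67, 515, 935,
    246189924426⟩]]⟩,
  ⟨⟨13, 7237608649980166829328341209563459094671519270953291611443490⟩, 3, [[1088], [40], [2576,
    6912]], [[], [], [], [], [], [], [], [], [⟨1, 1, 511, 111190294600973⟩, ⟨17, 17, 509,
    2309893394605⟩, ⟨69, 9, 427, 7788205088⟩, ⟨68, 137, 463, 276059658317⟩, ⟨69, 2, 442,
    8838485092⟩, ⟨2, 258, 495, 14576118760453⟩, ⟨2, 130, 447, 14542763623491⟩, ⟨13, 160, 508,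
    72150651053⟩, ⟨13, 264, 505, 5510535277⟩, ⟨1, 4, 511, 179426589548781⟩, ⟨17, 68, 509,
    180627773549⟩, ⟨69, 36, 430, 8830487586⟩, ⟨68, 292, 439, 241768140813⟩, ⟨13, 5, 463,
    109797508109⟩, ⟨14, 69, 509, 7774072409216⟩], [⟨69, 513, 807, 2190909600⟩, ⟨69, 514, 791,
    8599801921⟩, ⟨68, 770, 974, 208616328429⟩, ⟨2, 10, 1018, 5712544829485⟩, ⟨0, 138, 1022,
    180562686941449⟩, ⟨69, 256, 874, 9778238502⟩, ⟨2, 20, 1020, 10144918441037⟩, ⟨0, 84, 1022,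
    320165263777029⟩], [⟨69, 128, 1926, 11006977447⟩, ⟨69, 64, 1642, 10914727334⟩, ⟨2, 34, 1530,
    3443764041773⟩, ⟨0, 290, 1531, 112425245380842⟩, ⟨69, 1028, 1167, 44473442⟩, ⟨0, 81, 1531,
    357480006688995⟩, ⟨2, 1601, 1995, 11277818770433⟩], [⟨69, 4, 2191, 12046077346⟩], [⟨0, 1153,
    7665, 220156077806731⟩, ⟨69, 4, 4183, 12898605185⟩]]⟩,
  ⟨⟨12, 26052985420627198380923317331492152178544192679284834348⟩, 1, [[18]], [[], [], [], [], [],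
    [], [], [], [⟨70, 1, 343, 6723473442⟩, ⟨70, 256, 504, 4408482982⟩, ⟨69, 385, 463, 72183973068⟩,
    ⟨70, 1, 407, 7562338434⟩, ⟨70, 129, 429, 8664781920⟩, ⟨22, 81, 503, 7736519623044⟩, ⟨3, 3, 479,
    4475558530060⟩, ⟨1, 67, 511, 144247596517639⟩], [⟨2, 1, 1007, 249805129424972⟩, ⟨22, 529, 951,
    7736620286340⟩], [], [⟨0, 273, 4095, 10744856714296832005⟩]]⟩,
  ⟨⟨11, 116927267445440248103717876440527637533736941912204⟩, 1, [[258]], [[], [], [], [], [], [],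
    [⟨15, 33, 127, 138619815947⟩, ⟨70, 81, 127, 105367209131⟩], [⟨71, 17, 221, 6547676224⟩], [⟨71,
    1, 363, 5581578275⟩, ⟨71, 64, 500, 8836550725⟩, ⟨4, 3, 507, 8905783647243⟩, ⟨2, 35, 511,
    289345549372612⟩], [⟨4, 257, 1003, 1345608518667⟩], [⟨0, 321, 2047, 370814972617331938⟩]]⟩,
  ⟨⟨10, 8563687606408542252710329658346382718281711628⟩, 1, [[2]], [[], [], [], [], [], [], [],
    [⟨72, 1, 215, 6687821858⟩, ⟨16, 65, 239, 172947082250⟩, ⟨71, 161, 239, 72115815626⟩], [⟨71, 385,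
    477, 72216481994⟩, ⟨5, 17, 479, 1175953083402⟩, ⟨5, 145, 507, 9010106339489⟩], [⟨0, 129, 1023,
    10485053687665793⟩]]⟩,
  ⟨⟨9, 65335637161135697045390648877761742307346⟩, 1, [[132]], [[], [], [], [], [], [], [⟨17, 33,
    127, 105266712585⟩, ⟨72, 73, 127, 38761662633⟩], [⟨73, 1, 231, 5579480129⟩, ⟨6, 5, 255,
    7737553555465⟩], [⟨6, 129, 503, 2342039847945⟩, ⟨73, 1, 437, 8834257988⟩, ⟨0, 193, 511,
    107928234465576⟩, ⟨17, 65, 499, 282533757961⟩, ⟨0, 37, 511, 289378794542371⟩, ⟨72, 289, 499,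
    138786381001⟩]]⟩,
  ⟨⟨9, 27222942463454297488848042792714100277260⟩, 1, [[2]], [[], [], [], [], [], [], [], [⟨74, 1,
    215, 6686773282⟩, ⟨18, 65, 239, 172947082249⟩, ⟨73, 161, 239, 72115815625⟩], [⟨1, 129, 511,
    316902051289256⟩, ⟨73, 385, 477, 72216481993⟩, ⟨7, 17, 479, 1175953083401⟩, ⟨7, 145, 507,
    9010072785057⟩]]⟩,
  ⟨⟨9, 49002363922978255951978725837195067523084⟩, 1, [[2]], [[], [], [], [], [], [], [], [⟨75, 1,
    215, 7726960674⟩, ⟨19, 65, 239, 172980635657⟩, ⟨74, 161, 239, 105401812169⟩], [⟨75, 1, 343,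
    8733595682⟩, ⟨8, 17, 479, 1174912896009⟩, ⟨8, 145, 507, 9043224596768⟩]]⟩,
  ⟨⟨8, 456934800148947910911508831189860364⟩, 1, [[2]], [[], [], [], [], [], [], [⟨76, 1, 119,
    6618615842⟩], [⟨76, 1, 183, 7658804258⟩, ⟨9, 33, 255, 1172766395400⟩, ⟨1, 161, 255,
    1239101381894⟩, ⟨2, 17, 255, 6776521228385⟩, ⟨75, 81, 253, 72146228456⟩, ⟨0, 49, 255,
    6842156681217⟩]]⟩,
  ⟨⟨11, 961693054263697542817623053383613597808448952860716⟩, 1, [[18, 144, 528]], [[], [], [], [],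
    [], [], [], [⟨77, 2, 246, 7688231265⟩], [⟨77, 128, 504, 6715184487⟩, ⟨77, 128, 442,
    1245815143⟩], [⟨77, 1, 931, 8836359205⟩, ⟨77, 257, 813, 9840200768⟩, ⟨71, 769, 1023,
    4617164302582984⟩], [⟨77, 512, 1904, 4639102313⟩]]⟩,
  ⟨⟨9, 36070180144151565468277733865182171758612⟩, 1, [[66, 72, 138]], [[], [], [], [], [], [], [],
    [⟨78, 1, 175, 7693405218⟩, ⟨1, 129, 191, 250187221089⟩, ⟨1, 33, 191, 181469778017⟩], [⟨78, 8,
    476, 6718359843⟩, ⟨10, 137, 511, 1246723382438⟩, ⟨78, 2, 470, 6718359841⟩, ⟨10, 131, 511,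
    3445679529126⟩]]⟩,
  ⟨⟨9, 680980130900992568309126142124372000796⟩, 1, [[2]], [[], [], [], [], [], [], [], [⟨23, 129,
    253, 74292662505⟩, ⟨3, 33, 255, 7905998962761⟩], [⟨79, 1, 435, 8632933540⟩, ⟨79, 257, 413,
    7659097152⟩, ⟨11, 161, 511, 319037822212200⟩, ⟨79, 257, 349, 6551801920⟩]]⟩,
  ⟨⟨10, 5753811404435966919403791861212055215683207194⟩, 1, [[132]], [[], [], [], [], [], [], [],
    [⟨80, 1, 219, 7623184704⟩, ⟨0, 65, 255, 8046654949476⟩, ⟨24, 193, 239, 69999886663⟩], [⟨1, 33,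
    383, 2413810548842⟩, ⟨80, 4, 438, 7790003522⟩], [⟨80, 1, 615, 5580530753⟩, ⟨2, 641, 1023,
    2399174108945514⟩]]⟩,
  ⟨⟨9, 32667169552492832337188420313045345763412⟩, 1, [[130, 258]], [[], [], [], [], [], [], [],
    [⟨6, 9, 255, 8009210167430⟩], [⟨81, 1, 469, 8798671136⟩, ⟨1, 257, 503, 8014610465860⟩, ⟨2, 1,
    383, 284748284995⟩, ⟨26, 385, 495, 9007856156963⟩, ⟨44, 161, 507, 9009938600224⟩]]⟩,
  ⟨⟨9, 2722279707724169898002659073729289256988⟩, 1, [[130, 322]], [[], [], [], [], [], [], [],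
    [⟨82, 1, 221, 6550524192⟩, ⟨2, 65, 255, 8012362318916⟩, ⟨26, 193, 239, 37787599143⟩, ⟨0, 161,
    255, 6840981424129⟩], [⟨82, 1, 363, 5579481123⟩, ⟨1, 385, 511, 291617714012257⟩, ⟨82, 1, 413,
    8698007840⟩]]⟩,
  ⟨⟨8, 342704903096151563526533973007466506⟩, 1, [[20, 132, 144]], [[], [], [], [], [], [], [],
    [⟨83, 1, 215, 6685724737⟩, ⟨6, 129, 223, 249114430594⟩, ⟨27, 65, 239, 173987269640⟩, ⟨1, 17,
    255, 7977937408101⟩, ⟨1, 5, 255, 7977939503205⟩, ⟨27, 65, 251, 176134753288⟩]]⟩,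
  ⟨⟨9, 10889378446056528652918415142843410284572⟩, 1, [[2]], [[], [], [], [], [], [], [⟨0, 33, 127,
    208343665833⟩], [⟨7, 129, 223, 247037198467⟩, ⟨28, 65, 239, 241698015241⟩], [⟨1, 1, 383,
    9111841439875⟩, ⟨84, 257, 349, 6518247520⟩]]⟩,
  ⟨⟨9, 54446850639932436892103268701170021695516⟩, 1, [[2]], [[], [], [], [], [], [], [⟨1, 33, 127,
    208343665833⟩], [⟨8, 129, 223, 247037198467⟩, ⟨29, 65, 239, 241698015241⟩], [⟨2, 1, 383,
    9111841439875⟩, ⟨85, 257, 349, 6518247520⟩]]⟩,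
  ⟨⟨8, 166156351948093620311783643637612572⟩, 1, [[2]], [[], [], [], [], [], [], [⟨2, 33, 127,
    208343665832⟩], [⟨3, 1, 255, 7977970073731⟩, ⟨86, 129, 221, 6517166176⟩, ⟨1, 65, 255,
    7978073819137⟩, ⟨0, 193, 255, 7978073819137⟩]]⟩,
  ⟨⟨8, 415394048363259069051952312494129170⟩, 1, [[12, 36, 40]], [[], [], [], [], [], [], [], [⟨87,
    1, 207, 7725911105⟩, ⟨10, 129, 223, 249114526818⟩, ⟨10, 65, 223, 214755741794⟩, ⟨87, 1, 245,
    6685725764⟩, ⟨3, 137, 223, 213946335266⟩, ⟨3, 73, 223, 247232233602⟩, ⟨87, 1, 249, 6685725796⟩,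
    ⟨3, 133, 223, 213945286691⟩, ⟨3, 69, 223, 247231185027⟩]]⟩,
  ⟨⟨9, 36750703340886223506557730294285628866620⟩, 1, [[386]], [[], [], [], [], [], [], [], [⟨88, 1,
    221, 6584109344⟩], [⟨0, 1, 381, 144183561474⟩, ⟨6, 385, 479, 6842153733121⟩, ⟨8, 65, 479,
    8012395971682⟩, ⟨32, 193, 475, 38864519463⟩, ⟨1, 67, 475, 249209821321⟩, ⟨4, 195, 463,
    214816620839⟩]]⟩,
  ⟨⟨8, 135002412185819519214574097343512602⟩, 1, [[132]], [[], [], [], [], [], [], [⟨5, 33, 127,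
    207303478440⟩], [⟨89, 1, 231, 5578431553⟩, ⟨0, 129, 255, 1381072111747⟩, ⟨12, 65, 239,
    214753643746⟩, ⟨5, 193, 239, 178516951138⟩, ⟨0, 5, 255, 1380904344707⟩, ⟨5, 69, 239,
    178511708263⟩, ⟨5, 33, 251, 207471250600⟩]]⟩,
  ⟨⟨10, 6422837844112605805671759154735097948421292034⟩, 1, [[4]], [[], [], [], [], [], [], [⟨90, 1,
    111, 5580524609⟩, ⟨90, 1, 95, 4406122561⟩], [⟨90, 64, 246, 4464876870⟩, ⟨90, 8, 190,
    5505064259⟩], [⟨90, 64, 486, 8826950982⟩, ⟨34, 297, 491, 282600999968⟩], [⟨90, 33, 753,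
    7717856389⟩]]⟩,
  ⟨⟨11, 1169224503032416096104642950526157574143332470489256⟩, 4, [[], [], [], []], [[], [], [], [],
    [], [], [⟨91, 24, 95, 1145411587⟩], [⟨91, 1, 235, 1247911264⟩, ⟨35, 83, 223, 209448173796⟩, ⟨91,
    4, 222, 4536239458⟩, ⟨91, 4, 238, 6548397410⟩, ⟨54, 84, 255, 1277823032676⟩, ⟨14, 5, 191,
    176329590891⟩, ⟨9, 85, 255, 1311113325572⟩, ⟨35, 40, 191, 145023467627⟩, ⟨12, 168, 255,
    3339409431908⟩, ⟨90, 26, 191, 68854848683⟩], [⟨54, 321, 495, 5538363546984⟩, ⟨91, 2, 318,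
    4465959265⟩, ⟨91, 66, 359, 174432321⟩, ⟨91, 1, 489, 8831210848⟩, ⟨91, 32, 315, 8626639205⟩, ⟨35,
    356, 493, 282399705190⟩, ⟨91, 264, 365, 5377464387⟩, ⟨35, 10, 431, 282399377515⟩, ⟨12, 138, 495,
    3476777147752⟩], [⟨91, 1, 917, 9809436743⟩, ⟨91, 513, 937, 8834618464⟩, ⟨91, 80, 756,
    2389025956⟩, ⟨91, 4, 917, 9809502215⟩, ⟨91, 516, 686, 5412068450⟩, ⟨91, 520, 591, 1150654467⟩,
    ⟨91, 128, 663, 9799008615⟩], [⟨91, 16, 1429, 11017521159⟩, ⟨15, 1042, 1971, 249147042153⟩, ⟨91,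
    256, 1923, 9999451496⟩, ⟨0, 8, 1519, 360880500971627⟩, ⟨91, 1032, 1103, 1151703043⟩]]⟩,
  ⟨⟨12, 128733413676378947188719567015290165755734629069583810952⟩, 4, [[], [], [], []], [[], [],
    [], [], [], [⟨92, 8, 63, 4463853955⟩], [], [], [⟨92, 1, 427, 1347526016⟩, ⟨55, 97, 495,
    8835824688518⟩, ⟨15, 130, 463, 3296953548⟩, ⟨92, 34, 359, 274077761⟩, ⟨92, 18, 343, 273029185⟩,
    ⟨92, 1, 489, 6682681728⟩, ⟨92, 4, 430, 5477801346⟩, ⟨92, 356, 373, 272799820⟩, ⟨92, 340, 373,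
    273815628⟩, ⟨15, 5, 463, 41045524588⟩, ⟨92, 101, 373, 4471134284⟩, ⟨92, 144, 469, 8594528327⟩,
    ⟨12, 408, 479, 4605353397632⟩, ⟨92, 72, 365, 8596624451⟩, ⟨91, 328, 463, 2357304364⟩, ⟨92, 8,
    317, 4471130499⟩], [⟨92, 2, 846, 9935329665⟩, ⟨92, 547, 567, 4464878604⟩, ⟨92, 4, 686,
    9903900034⟩, ⟨55, 548, 943, 1379828505993⟩, ⟨92, 256, 843, 6479160712⟩, ⟨92, 520, 559,
    1150686211⟩, ⟨92, 272, 791, 2185634824⟩], [⟨92, 32, 1596, 10001420677⟩, ⟨92, 512, 1956,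
    5706588553⟩, ⟨92, 32, 1593, 9999323525⟩, ⟨92, 8, 1071, 10906304899⟩], [⟨92, 32, 3132,
    12148904325⟩, ⟨92, 2593, 2673, 6815917068⟩, ⟨1, 8, 2543, 393865950467180⟩]]⟩,
  ⟨⟨10, 5798414256336351839821750458241805691885191192⟩, 1, [[4]], [[], [], [], [], [], [], [⟨37,
    33, 127, 36614344714⟩, ⟨92, 67, 127, 107414030506⟩], [], [⟨93, 1, 365, 5580529731⟩, ⟨93, 1, 437,
    8835306564⟩], [⟨93, 1, 693, 9741278372⟩]]⟩,
  ⟨⟨11, 748317383506836715804382960497391407192187878047754⟩, 1, [[20]], [[], [], [], [], [], [],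
    [], [⟨94, 1, 221, 7594842243⟩, ⟨93, 193, 239, 104394131627⟩, ⟨93, 145, 191, 104392034475⟩, ⟨8,
    81, 255, 7766548807787⟩, ⟨10, 37, 191, 140661304487⟩], [⟨94, 129, 437, 4463108167⟩, ⟨0, 65, 511,
    289241354639716⟩, ⟨94, 4, 414, 8829109602⟩, ⟨48, 261, 511, 255466971073732⟩], [⟨2, 17, 1023,
    388309172100166⟩, ⟨94, 257, 965, 2382734536⟩], [⟨1, 529, 2047, 261425487717695524⟩]]⟩,
  ⟨⟨10, 5887598179952372651535026801462087139897442466⟩, 2, [[64], [132, 516]], [[], [], [], [], [],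
    [], [], [⟨39, 9, 253, 75333999626⟩, ⟨95, 5, 183, 4465171488⟩, ⟨94, 21, 253, 179386194026⟩, ⟨95,
    66, 246, 4464122950⟩, ⟨18, 160, 253, 105432454154⟩, ⟨95, 10, 190, 5504310339⟩, ⟨58, 38, 255,
    4502367476034⟩], [⟨95, 257, 427, 3464827936⟩, ⟨39, 17, 505, 281558520842⟩, ⟨58, 386, 507,
    3437282629960⟩, ⟨95, 16, 317, 169976132⟩, ⟨95, 8, 413, 243403075⟩, ⟨39, 298, 491, 281558717441⟩,
    ⟨95, 18, 442, 7618240676⟩], [⟨4, 1, 1019, 325669221467146⟩, ⟨95, 513, 691, 4472511520⟩, ⟨0, 2,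
    1023, 11294362958926089⟩, ⟨95, 512, 669, 245665859⟩, ⟨95, 258, 854, 2350195848⟩, ⟨95, 128, 700,
    5513651267⟩, ⟨1, 640, 1021, 5643892366658⟩, ⟨95, 32, 996, 9942768710⟩, ⟨95, 4, 669,
    245441667⟩]]⟩,
  ⟨⟨10, 8608294881668146182183026639825614171875377426⟩, 3, [[], [], []], [[], [], [], [], [], [],
    [⟨96, 4, 111, 6543152450⟩], [⟨59, 162, 255, 40939623658⟩, ⟨96, 16, 245, 6679593284⟩, ⟨40, 138,
    191, 173979864391⟩, ⟨9, 42, 191, 240657728586⟩, ⟨14, 170, 255, 207371865410⟩, ⟨8, 20, 191,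
    1312984138⟩, ⟨40, 69, 253, 247296298053⟩], [⟨96, 1, 343, 6713020736⟩, ⟨96, 1, 407, 7652548928⟩,
    ⟨96, 256, 485, 7719780680⟩, ⟨96, 64, 461, 270638406⟩, ⟨40, 68, 508, 244989496394⟩, ⟨96, 132,
    430, 8765377570⟩], [⟨96, 2, 655, 7821394241⟩, ⟨44, 130, 987, 3508996709674⟩, ⟨19, 258, 823,
    176096019754⟩, ⟨96, 2, 679, 7823491393⟩, ⟨96, 4, 622, 6552589634⟩, ⟨19, 513, 979,
    247233544234⟩]]⟩,
  ⟨⟨9, 44238452324301528205796942016793688145960⟩, 1, [[16]], [[], [], [], [], [], [], [⟨96, 69,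
    127, 175093321769⟩, ⟨41, 3, 127, 73188543497⟩], [⟨41, 65, 251, 244915049481⟩], [⟨1, 1, 511,
    289279106386208⟩, ⟨97, 256, 366, 5579738177⟩, ⟨97, 129, 469, 2282004679⟩, ⟨97, 4, 366,
    5579546721⟩, ⟨0, 261, 511, 282821553979682⟩]]⟩,
  ⟨⟨9, 59891088116812775100819844939777486094356⟩, 1, [[2]], [[], [], [], [], [], [], [], [⟨98, 1,
    175, 3465548834⟩, ⟨98, 8, 250, 5571222819⟩, ⟨50, 41, 255, 1237025137830⟩], [⟨98, 128, 462,
    6544236839⟩, ⟨98, 1, 315, 5646584868⟩, ⟨98, 32, 366, 3423674661⟩]]⟩,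
  ⟨⟨8, 186925856287629525213362650408615946⟩, 1, [[4]], [[], [], [], [], [], [], [], [⟨99, 1, 221,
    7591696515⟩, ⟨0, 129, 255, 2242210960580⟩, ⟨1, 65, 255, 7766377959592⟩, ⟨98, 193, 239,
    104394131624⟩, ⟨1, 17, 255, 7766377896104⟩, ⟨98, 145, 191, 104392034472⟩, ⟨13, 81, 255,
    7766548807784⟩]]⟩,
  ⟨⟨11, 771702301733938958335939090661756933376350807195682⟩, 4, [[16], [], [1280], [1280]], [[],
    [], [], [], [], [], [⟨13, 82, 127, 103115232452⟩, ⟨23, 44, 127, 37950133444⟩], [⟨100, 2, 159,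
    7621116257⟩, ⟨100, 2, 207, 7623213409⟩, ⟨100, 132, 215, 41261186⟩], [⟨100, 64, 486, 7785747814⟩,
    ⟨100, 4, 343, 8791298402⟩, ⟨100, 4, 350, 8794444130⟩, ⟨100, 32, 371, 8792314213⟩], [⟨100, 1,
    633, 3534755973⟩, ⟨100, 512, 826, 4463894889⟩, ⟨100, 2, 543, 9768599905⟩, ⟨52, 578, 639,
    4473376255267⟩, ⟨100, 2, 591, 9770697057⟩, ⟨95, 658, 1023, 146443628489763⟩, ⟨12, 36, 631,
    1381175371⟩, ⟨100, 8, 686, 5672836451⟩, ⟨96, 269, 1023, 4540994944147655⟩], [⟨84, 193, 2031,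
    12637892150330378⟩, ⟨100, 1217, 1241, 4633892875⟩, ⟨100, 512, 1880, 4637068649⟩, ⟨100, 4, 1111,
    10871675234⟩, ⟨100, 8, 1675, 11039448419⟩, ⟨100, 4, 1366, 8801879394⟩, ⟨100, 1037, 1229,
    7623223307⟩]]⟩,
  ⟨⟨10, 6422839204873410271264838439183929823008718994⟩, 4, [[], [], [576], [32]], [[], [], [], [],
    [], [], [⟨101, 2, 111, 5573247297⟩, ⟨45, 84, 127, 178274838595⟩, ⟨45, 42, 127, 211661400162⟩],
    [⟨101, 1, 183, 5505064256⟩, ⟨101, 1, 219, 3361774912⟩, ⟨101, 2, 207, 3295680833⟩, ⟨101, 16, 249,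
    6617566532⟩, ⟨101, 2, 231, 5577378113⟩], [⟨101, 4, 462, 7790955842⟩, ⟨45, 132, 415,
    107375304938⟩, ⟨17, 148, 415, 34603149379⟩, ⟨1, 5, 415, 104230555911⟩, ⟨101, 8, 377,
    6620815364⟩, ⟨101, 256, 438, 5504048456⟩, ⟨101, 8, 315, 1084334244⟩, ⟨45, 9, 415, 249176264810⟩,
    ⟨17, 265, 415, 36612352007⟩], [⟨101, 160, 760, 3363120325⟩, ⟨101, 4, 783, 9932148034⟩]]⟩,
  ⟨⟨11, 935389949842674305935828765398765921181684143030322⟩, 2, [[68], [24, 1032]], [[], [], [],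
    [], [], [], [], [⟨54, 9, 255, 2241011389636⟩, ⟨54, 66, 255, 4403628121186⟩], [⟨102, 1, 311,
    8759841120⟩, ⟨102, 258, 407, 4303723585⟩, ⟨102, 32, 441, 3460309349⟩, ⟨83, 274, 511,
    293707217673314⟩], [⟨102, 1, 567, 9800029536⟩, ⟨102, 1, 993, 9943653573⟩, ⟨83, 645, 1021,
    291508194745442⟩, ⟨102, 16, 857, 8895267172⟩, ⟨65, 554, 639, 10035563533344⟩], [⟨102, 512, 2000,
    7858168169⟩, ⟨0, 257, 2035, 35573306954024⟩, ⟨102, 1285, 1429, 7855939659⟩, ⟨102, 128, 1738,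
    10005611879⟩, ⟨102, 2, 1175, 10976495969⟩, ⟨1, 1026, 2043, 3625467968295208⟩]]⟩,
  ⟨⟨11, 754164817292963904252091692431527080496470039789638⟩, 2, [[136], [80, 276]], [[], [], [],
    [], [], [], [⟨47, 17, 127, 209525409953⟩, ⟨47, 10, 127, 206203619492⟩], [], [⟨48, 265, 447,
    12206334969863⟩], [⟨103, 1, 711, 9872378208⟩, ⟨103, 128, 922, 9935390055⟩, ⟨103, 2, 822,
    9943683141⟩, ⟨103, 256, 996, 6746709352⟩, ⟨44, 518, 991, 112463994454370⟩, ⟨103, 64, 857,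
    8896217446⟩, ⟨66, 534, 735, 10109652666400⟩], [⟨103, 1, 1223, 10811906400⟩, ⟨103, 512, 1896,
    5640497513⟩, ⟨98, 673, 2045, 11261307755081000⟩, ⟨103, 64, 1625, 11043701094⟩, ⟨99, 1346, 2031,
    3701311821382663⟩, ⟨0, 18, 1919, 9335028813278240⟩, ⟨103, 1026, 1251, 6453304481⟩, ⟨103, 4,
    1565, 10003513698⟩, ⟨103, 4, 1381, 8764008802⟩]]⟩,
  ⟨⟨10, 8608287735738442743715453698084563285331738666⟩, 3, [[], [160], [64]], [[], [], [], [], [],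
    [], [⟨104, 1, 111, 6612356416⟩], [], [⟨48, 65, 505, 244922389514⟩, ⟨25, 81, 507, 276058771783⟩,
    ⟨104, 256, 461, 7717620040⟩, ⟨45, 130, 511, 253173357876324⟩, ⟨104, 64, 485, 2416090438⟩, ⟨104,
    18, 442, 8691981476⟩, ⟨104, 8, 413, 2423390531⟩, ⟨67, 138, 507, 9003426025799⟩, ⟨104, 32, 371,
    8792314181⟩, ⟨104, 8, 347, 6711939395⟩, ⟨104, 129, 427, 8698270752⟩], [⟨104, 2, 655,
    7821330753⟩, ⟨27, 384, 1016, 143012372778⟩, ⟨104, 4, 876, 5580596328⟩, ⟨104, 512, 915,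
    4529889609⟩, ⟨65, 532, 1021, 5711370462466⟩, ⟨21, 517, 943, 5741568074794⟩]]⟩,
  ⟨⟨10, 5753831821419541308349996994630053358724251682⟩, 1, [[68, 532]], [[], [], [], [], [], [],
    [⟨49, 9, 127, 211537727522⟩], [⟨68, 193, 255, 8042463826976⟩, ⟨105, 16, 246, 6612360516⟩, ⟨68,
    133, 255, 8046758659232⟩], [⟨105, 64, 492, 7786829126⟩, ⟨49, 277, 381, 72150749344⟩], [⟨105, 1,
    791, 8902414401⟩, ⟨4, 513, 1023, 2287333289531655⟩, ⟨105, 256, 970, 1379081544⟩, ⟨0, 641, 1019,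
    180321293405384⟩, ⟨2, 5, 1023, 10422308441237509⟩, ⟨1, 517, 1023, 8173020004847621⟩, ⟨105, 16,
    730, 6552591684⟩]]⟩,
  ⟨⟨10, 5887619959150553903336016455977198121778479130⟩, 1, [[580]], [[], [], [], [], [], [], [⟨29,
    33, 127, 178352357505⟩], [⟨106, 1, 219, 6550491456⟩], [⟨106, 1, 347, 8730543424⟩, ⟨69, 193, 503,
    8940214617408⟩, ⟨50, 325, 487, 211770738720⟩, ⟨24, 197, 503, 9006782523456⟩], [⟨106, 1, 667,
    9771716928⟩, ⟨47, 577, 1015, 183900074673282⟩]]⟩,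
  ⟨⟨11, 377073488767970360783206816774437836687703563567360⟩, 1, [[1540]], [[], [], [], [], [], [],
    [⟨107, 17, 125, 6610586692⟩, ⟨107, 3, 111, 5570399297⟩], [⟨107, 65, 243, 4463107110⟩, ⟨107, 17,
    189, 7617221700⟩, ⟨107, 9, 187, 5503294499⟩, ⟨106, 164, 254, 138752888011⟩, ⟨27, 45, 255,
    246997485924⟩, ⟨27, 163, 255, 73116327270⟩], [⟨107, 32, 500, 7719756133⟩], [⟨107, 512, 636,
    6622055492⟩, ⟨107, 4, 636, 6621832292⟩], [⟨107, 1, 1827, 1420829864⟩, ⟨107, 1024, 1134,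
    5581900865⟩, ⟨107, 32, 1396, 11008088421⟩, ⟨107, 1185, 1203, 1413651467⟩, ⟨107, 4, 1358,
    8937085025⟩, ⟨84, 1061, 1911, 221038489477280⟩]]⟩,
  ⟨⟨11, 5846408013100517642557270736806094544788055457922⟩, 2, [[544, 1312], [16]], [[], [], [], [],
    [], [], [⟨108, 64, 126, 5505123686⟩], [⟨52, 97, 251, 143045897217⟩, ⟨108, 8, 238, 5604837731⟩,
    ⟨108, 128, 189, 4464935271⟩, ⟨108, 8, 221, 239274339⟩], [⟨108, 1, 489, 6554656935⟩, ⟨6, 257,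
    511, 395893986726083⟩, ⟨52, 40, 508, 77450026155⟩, ⟨24, 296, 508, 210628783202⟩, ⟨108, 256, 469,
    241305960⟩, ⟨108, 32, 489, 6554820615⟩], [⟨108, 32, 884, 2427626692⟩, ⟨108, 32, 888,
    3434259716⟩, ⟨0, 2, 1023, 317831006917867⟩, ⟨108, 6, 711, 7518659777⟩], [⟨108, 256, 1492,
    6587227496⟩, ⟨108, 5, 1309, 4563773538⟩, ⟨108, 6, 1310, 4564822114⟩]]⟩,
  ⟨⟨10, 8563687606553924029525475572601255570399100946⟩, 1, [[12, 36]], [[], [], [], [], [], [],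
    [⟨109, 1, 111, 6553605185⟩], [⟨109, 1, 175, 7694453825⟩, ⟨109, 32, 246, 6679466309⟩, ⟨29, 97,
    255, 2446324760612⟩, ⟨109, 8, 222, 7719653699⟩, ⟨29, 137, 255, 2413036732452⟩], [⟨109, 1, 441,
    7694458980⟩, ⟨57, 389, 503, 6879635875842⟩], [⟨109, 260, 884, 5505361096⟩, ⟨109, 129, 745,
    3422889127⟩]]⟩,
  ⟨⟨11, 52621217701584029143021690836249326411129831883278⟩, 5, [[], [], [], [], [1088]], [[], [],
    [], [], [], [], [], [⟨110, 1, 207, 6550521184⟩, ⟨73, 193, 255, 1275607624806⟩, ⟨110, 68, 215,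
    1080401026⟩, ⟨110, 136, 219, 1081448579⟩, ⟨54, 44, 239, 209380879431⟩, ⟨110, 32, 238,
    2385708389⟩, ⟨54, 193, 239, 76404501699⟩, ⟨55, 210, 255, 104394494021⟩], [⟨110, 1, 335,
    6551538016⟩, ⟨110, 2, 359, 6612328801⟩, ⟨27, 292, 503, 4604246955243⟩, ⟨110, 68, 469,
    8831471618⟩, ⟨110, 264, 377, 5578788867⟩, ⟨110, 128, 485, 6610297191⟩, ⟨5, 82, 511,
    177239479034082⟩], [⟨110, 1, 567, 4367361376⟩, ⟨110, 64, 888, 8896222566⟩, ⟨110, 4, 693,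
    5613031778⟩, ⟨4, 516, 767, 251829267042379⟩, ⟨109, 548, 935, 241896169483⟩, ⟨50, 518, 1007,
    289344537788491⟩, ⟨110, 8, 655, 7594943520⟩, ⟨110, 512, 869, 5572141417⟩, ⟨27, 552, 763,
    7835103694027⟩, ⟨0, 520, 1019, 255259780845675⟩, ⟨33, 514, 995, 179589653515⟩, ⟨110, 256, 966,
    6746768744⟩, ⟨92, 336, 1023, 10134410472163467⟩, ⟨33, 65, 875, 43256911979⟩, ⟨50, 337, 1015,
    40931174657225⟩], [⟨110, 4, 1421, 8827971938⟩, ⟨110, 16, 1429, 8836491266⟩, ⟨110, 1024, 1258,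
    3434421285⟩, ⟨110, 64, 1896, 8902577510⟩]]⟩,
  ⟨⟨11, 1169225930301206376373774142122058557160839977697366⟩, 4, [[], [], [80], []], [[], [], [],
    [], [], [], [⟨111, 1, 123, 5506111840⟩, ⟨55, 104, 127, 143183054945⟩], [⟨34, 33, 191,
    37655417995⟩, ⟨111, 2, 235, 5609885025⟩, ⟨11, 34, 191, 145134485571⟩, ⟨55, 18, 191,
    105401843851⟩, ⟨111, 4, 237, 7690259810⟩, ⟨55, 196, 247, 143043594598⟩, ⟨24, 148, 247,
    207236439211⟩, ⟨44, 70, 255, 3340578720102⟩, ⟨27, 22, 191, 246021172259⟩, ⟨111, 64, 215,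
    7561482304⟩, ⟨55, 40, 191, 137480013931⟩, ⟨111, 16, 215, 7561418816⟩, ⟨110, 152, 191,
    36648878251⟩, ⟨27, 41, 191, 241694682276⟩], [⟨111, 2, 411, 8829013345⟩, ⟨111, 128, 498,
    6715245927⟩, ⟨9, 68, 511, 389338986845409⟩, ⟨111, 1, 359, 8796570976⟩], [⟨52, 776, 959,
    146485508409376⟩, ⟨0, 200, 1023, 9081250104088608⟩, ⟨111, 64, 965, 7786734950⟩, ⟨111, 1, 615,
    9870312800⟩, ⟨4, 777, 959, 289353156100163⟩], [⟨2, 8, 1535, 12738949375102214⟩, ⟨111, 1024,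
    1206, 1320489029⟩, ⟨111, 264, 1481, 204843240⟩]]⟩,
  ⟨⟨10, 535273692407331708394960560355950769733959842⟩, 4, [[], [], [], [272]], [[], [], [], [], [],
    [], [⟨112, 2, 95, 4499505473⟩, ⟨56, 100, 127, 143915132995⟩, ⟨56, 26, 127, 210621212770⟩],
    [⟨112, 1, 183, 4464876864⟩, ⟨112, 1, 235, 3395329344⟩, ⟨112, 2, 207, 3295680833⟩, ⟨112, 32, 249,
    6584012101⟩, ⟨112, 2, 215, 4503636289⟩], [⟨112, 4, 462, 7790955842⟩, ⟨56, 132, 431,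
    108449046762⟩, ⟨28, 164, 431, 34603182147⟩, ⟨12, 5, 431, 104230556935⟩, ⟨112, 8, 377,
    6587260933⟩, ⟨112, 256, 438, 4463861064⟩, ⟨112, 8, 315, 1084334213⟩, ⟨56, 9, 431, 249176265834⟩,
    ⟨28, 265, 431, 36613400583⟩], [⟨1, 146, 1023, 7044916787122181⟩, ⟨112, 4, 910, 7794165058⟩, ⟨0,
    580, 1023, 11582294212190213⟩, ⟨112, 16, 882, 1283630404⟩]]⟩,
  ⟨⟨10, 7493225292362167843032480461036711646587060322⟩, 4, [[], [], [], []], [[], [], [], [], [],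
    [], [⟨113, 1, 119, 4464875840⟩, ⟨57, 21, 127, 176200624193⟩, ⟨113, 8, 126, 5504047427⟩, ⟨57, 42,
    127, 142814062626⟩], [⟨36, 129, 239, 72143306922⟩, ⟨36, 96, 253, 105465975818⟩, ⟨113, 4, 159,
    4395670850⟩, ⟨36, 68, 239, 5604837482⟩, ⟨14, 5, 255, 7907204759594⟩, ⟨14, 40, 255,
    7903885921418⟩, ⟨36, 136, 253, 172004445258⟩], [⟨113, 1, 363, 3430978880⟩, ⟨113, 2, 303,
    3293585729⟩, ⟨113, 4, 430, 5612014914⟩], [⟨113, 1, 615, 9867138368⟩, ⟨113, 2, 783, 9935323457⟩,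
    ⟨61, 546, 891, 3442421572936⟩, ⟨95, 276, 1023, 3455908065576201⟩, ⟨113, 2, 903, 9939517761⟩,
    ⟨74, 522, 1007, 183690584172584⟩]]⟩,
  ⟨⟨10, 7493225292382936555101271334310235303743586392⟩, 4, [[], [], [272], []], [[], [], [], [],
    [], [], [⟨114, 1, 123, 1280445760⟩, ⟨58, 35, 127, 142877927462⟩, ⟨114, 4, 126, 4469067074⟩, ⟨58,
    84, 127, 40805410949⟩], [⟨15, 33, 255, 7800940986506⟩, ⟨37, 129, 253, 174051262666⟩, ⟨15, 68,
    255, 7804129642538⟩, ⟨37, 132, 239, 206260373674⟩, ⟨114, 8, 159, 1145052483⟩, ⟨37, 72, 239,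
    74324219914⟩, ⟨37, 40, 253, 6681629770⟩], [⟨114, 2, 359, 206643521⟩, ⟨114, 4, 303, 109090114⟩,
    ⟨0, 280, 511, 360883725277218⟩], [⟨3, 34, 1023, 11262370794210534⟩, ⟨72, 546, 1022,
    107999144481928⟩, ⟨8, 3, 1015, 76111122047018⟩, ⟨4, 513, 1021, 73846728368426⟩, ⟨114, 16, 821,
    8894185796⟩]]⟩,
  ⟨⟨9, 54446881791178202275897473865658310918154⟩, 1, [[4]], [[], [], [], [], [], [], [], [⟨115, 1,
    189, 5512371267⟩, ⟨78, 161, 255, 4576390447337⟩], [⟨9, 129, 511, 287111050762473⟩, ⟨115, 32,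
    438, 7786762533⟩, ⟨2, 17, 511, 211424168182948⟩, ⟨0, 273, 511, 77106643247328⟩, ⟨8, 145, 511,
    287013408574473⟩, ⟨1, 81, 511, 255090227217572⟩, ⟨18, 337, 511, 73881097606176⟩]]⟩,
  ⟨⟨9, 12250580603677836075049611286196946010122⟩, 1, [[68]], [[], [], [], [], [], [], [⟨116, 1,
    125, 4472182851⟩, ⟨60, 81, 127, 69932777766⟩, ⟨29, 21, 127, 211629903913⟩], [⟨0, 65, 255,
    7912543060002⟩, ⟨116, 16, 246, 6679467300⟩, ⟨39, 165, 253, 244987497536⟩], [⟨116, 32, 378,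
    1214357797⟩, ⟨60, 33, 319, 277063306249⟩, ⟨116, 4, 350, 6547349794⟩]]⟩,
  ⟨⟨9, 50363618003726752533357881513980339748874⟩, 1, [[80]], [[], [], [], [], [], [], [⟨117, 1,
    125, 2324699267⟩, ⟨30, 69, 127, 142914619433⟩, ⟨61, 21, 127, 207304622372⟩], [⟨117, 64, 222,
    4397767974⟩, ⟨117, 32, 190, 4396752165⟩, ⟨61, 33, 239, 246996438025⟩, ⟨116, 133, 239,
    37817948329⟩], [⟨2, 17, 511, 10070692962438⟩, ⟨20, 145, 511, 289318865208389⟩, ⟨117, 4, 374,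
    4569732386⟩]]⟩,
  ⟨⟨9, 29945429856872975837027834917526246260756⟩, 1, [[2]], [[], [], [], [], [], [], [], [], [⟨118,
    1, 411, 3499105316⟩, ⟨62, 257, 351, 207302692873⟩, ⟨11, 129, 511, 179298787102758⟩, ⟨118, 8,
    430, 7685087523⟩, ⟨71, 137, 511, 2237787217189⟩]]⟩,
  ⟨⟨8, 415394206824419708625647470597898252⟩, 1, [[2]], [[], [], [], [], [], [], [⟨119, 1, 119,
    4471134242⟩, ⟨63, 81, 127, 37720490246⟩], [⟨3, 65, 255, 7911469285473⟩, ⟨2, 33, 255,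
    9043225673825⟩, ⟨1, 161, 255, 7971633434721⟩, ⟨0, 97, 255, 5712543616001⟩, ⟨119, 16, 250,
    6678484228⟩]]⟩,
  ⟨⟨9, 65335626777017339279506668437870625488906⟩, 1, [[4]], [[], [], [], [], [], [], [], [⟨120, 1,
    221, 7659853891⟩, ⟨64, 193, 251, 178550606849⟩, ⟨120, 16, 246, 6612360484⟩], [⟨120, 1, 349,
    8800702531⟩, ⟨120, 64, 492, 7786829094⟩]]⟩,
  ⟨⟨13, 12855994756480005989253897402995462719997853206330802743541764⟩, 1, [[34, 258]], [[], [],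
    [], [], [], [], [⟨121, 17, 123, 6543545380⟩], [], [⟨121, 1, 399, 7798262818⟩, ⟨121, 128, 500,
    2421299623⟩, ⟨4, 288, 510, 7049358478401⟩, ⟨121, 129, 467, 1208393927⟩, ⟨3, 353, 509,
    4647361612864⟩, ⟨41, 337, 509, 5499987795078⟩, ⟨121, 8, 380, 5511387555⟩, ⟨65, 296, 446,
    36783132069⟩, ⟨121, 2, 442, 8838485092⟩], [⟨121, 256, 978, 1221862599⟩, ⟨121, 833, 873,
    5674049549⟩, ⟨121, 777, 873, 5677096973⟩], [⟨121, 8, 1372, 10947203491⟩], [⟨121, 513, 3745,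
    12147137705⟩, ⟨121, 64, 3276, 12148907430⟩], [⟨121, 2817, 6945, 13259546637⟩, ⟨121, 2369, 6473,
    13257351181⟩, ⟨121, 1025, 7745, 13254436042⟩, ⟨121, 4137, 6697, 12223417357⟩]]⟩,
  ⟨⟨14, 1685060944758126869752775985056417151685160798984896604279386996810⟩, 4, [[], [], [2304],
    [128]], [[], [], [], [], [], [], [⟨22, 33, 127, 75344381059⟩, ⟨45, 17, 127, 173986152558⟩, ⟨45,
    34, 127, 3361772622⟩, ⟨66, 5, 127, 107548247118⟩, ⟨38, 21, 127, 211595442179⟩, ⟨66, 40, 127,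
    69799678062⟩, ⟨38, 42, 127, 206263335074⟩, ⟨121, 76, 127, 172979458062⟩], [⟨122, 129, 235,
    5577837600⟩, ⟨122, 2, 215, 7656704449⟩, ⟨66, 194, 251, 103285917127⟩, ⟨122, 128, 250,
    6625135652⟩, ⟨4, 196, 255, 15463131256835⟩, ⟨122, 8, 250, 6625008676⟩, ⟨35, 74, 251,
    246024280078⟩, ⟨46, 202, 255, 2377265592423⟩], [⟨122, 257, 335, 2189891680⟩, ⟨122, 64, 380,
    3370328133⟩, ⟨28, 322, 511, 105774580797666⟩, ⟨122, 4, 373, 216080517⟩, ⟨58, 324, 511,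
    105595128780974⟩, ⟨122, 80, 474, 8831568932⟩], [⟨122, 1, 591, 9867136448⟩, ⟨20, 642, 767,
    250801864905920⟩, ⟨122, 528, 691, 43457700⟩, ⟨39, 84, 759, 10136158671022⟩, ⟨122, 264, 940,
    2318869736⟩, ⟨122, 650, 718, 6746578030⟩], [⟨58, 1537, 1911, 141914487947470⟩, ⟨122, 1024, 1649,
    4477756422⟩, ⟨122, 4, 1319, 8757750210⟩, ⟨122, 64, 1861, 2491711942⟩], [⟨122, 2050, 2135,
    6454448193⟩, ⟨122, 4, 3111, 12146742722⟩], [⟨122, 512, 7104, 13261609417⟩, ⟨122, 4097, 4203,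
    5583080480⟩, ⟨122, 4098, 5143, 10817572865⟩], [⟨0, 2, 16247, 15433026899610240142⟩, ⟨122, 8194,
    9239, 10818621441⟩]]⟩,
  ⟨⟨13, 12856007015982478061220787401767434002929904690293086744543306⟩, 4, [[], [512], [2112],
    [1536]], [[], [], [], [], [], [], [⟨23, 33, 127, 75343334529⟩, ⟨46, 17, 127, 174053261357⟩, ⟨67,
    34, 127, 71947161645⟩, ⟨67, 5, 127, 38828772429⟩, ⟨39, 21, 127, 211597538305⟩, ⟨122, 70, 127,
    4368403629⟩, ⟨46, 40, 127, 1214354509⟩, ⟨39, 42, 127, 206196290722⟩], [⟨123, 1, 207,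
    7719716256⟩, ⟨4, 148, 255, 5946621493345⟩, ⟨38, 84, 255, 7731148131458⟩, ⟨6, 136, 255,
    1353994834082⟩, ⟨123, 64, 231, 2316311974⟩, ⟨4, 138, 255, 447988569218⟩, ⟨38, 74, 255,
    7770871337057⟩], [⟨123, 256, 373, 215224389⟩, ⟨123, 4, 373, 215031941⟩, ⟨8, 262, 511,
    289314413052098⟩], [⟨123, 513, 619, 5579901984⟩, ⟨123, 2, 634, 6623896676⟩, ⟨123, 258, 934,
    2316739816⟩, ⟨123, 576, 739, 1083612326⟩, ⟨59, 324, 895, 35297251563693⟩, ⟨123, 8, 605,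
    9804188067⟩], [⟨123, 1025, 1131, 5580950560⟩, ⟨123, 1088, 1265, 4473658374⟩, ⟨123, 256, 2000,
    4603488680⟩, ⟨123, 8, 1117, 10810823075⟩], [⟨123, 64, 2277, 12048302502⟩, ⟨123, 4, 3117,
    12146808226⟩, ⟨123, 2064, 2170, 6622186532⟩], [⟨123, 128, 7104, 13263706535⟩, ⟨123, 4097, 4203,
    5583047712⟩, ⟨123, 2050, 7302, 2484515051⟩]]⟩,
  ⟨⟨13, 12856043795871122507210181097013129831064905770973644179964962⟩, 4, [[], [], [64], [576]],
    [[], [], [], [], [], [], [⟨4, 65, 127, 453286858850⟩, ⟨124, 66, 111, 5375429697⟩, ⟨24, 98, 127,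
    3257013670⟩, ⟨36, 18, 127, 172004313133⟩, ⟨124, 4, 125, 181475428⟩, ⟨68, 69, 127, 104158333350⟩,
    ⟨124, 8, 125, 181508164⟩, ⟨68, 73, 127, 69798596006⟩, ⟨37, 13, 127, 211664568365⟩, ⟨40, 77, 127,
    171835820166⟩], [⟨124, 17, 221, 7717948484⟩, ⟨4, 130, 191, 254482187362⟩, ⟨37, 44, 191,
    240690562146⟩], [⟨124, 1, 437, 2295341285⟩, ⟨60, 385, 511, 71577920307373⟩, ⟨124, 16, 374,
    8758827428⟩, ⟨124, 256, 437, 2295602181⟩, ⟨124, 32, 489, 3496182181⟩, ⟨123, 261, 319,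
    38923209901⟩, ⟨124, 8, 347, 6576710051⟩, ⟨58, 104, 511, 289177369447458⟩, ⟨30, 137, 511,
    71482454675656⟩], [⟨124, 514, 559, 5378575425⟩, ⟨19, 517, 959, 287079977196845⟩, ⟨124, 8, 795,
    9932149155⟩], [⟨124, 1, 1191, 7686105504⟩, ⟨45, 273, 1403, 4438949536170⟩, ⟨124, 1, 1195,
    7687154080⟩], [⟨124, 1, 3123, 12151063968⟩, ⟨124, 2050, 2319, 8702560257⟩], [⟨0, 2177, 7167,
    14241727171314950209⟩, ⟨2, 2, 7167, 14241754392851219533⟩, ⟨124, 4098, 4367, 8703608833⟩, ⟨124,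
    2181, 6341, 13260523533⟩]]⟩,
  ⟨⟨13, 12855994756018147967229869547170845085115320248065246557700170⟩, 4, [[], [], [], [1152]],
    [[], [], [], [], [], [], [⟨25, 33, 127, 75343334529⟩, ⟨48, 17, 127, 174053261357⟩, ⟨69, 34, 127,
    71947161645⟩, ⟨69, 5, 127, 38828772429⟩, ⟨41, 21, 127, 211597538305⟩, ⟨124, 70, 127,
    4368403629⟩, ⟨48, 40, 127, 1214354509⟩, ⟨41, 42, 127, 206196290722⟩], [⟨125, 129, 235,
    5577804832⟩, ⟨125, 2, 250, 6623894628⟩, ⟨73, 194, 255, 2307672936487⟩, ⟨125, 128, 250,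
    6624087076⟩, ⟨7, 196, 255, 14365767112705⟩, ⟨125, 8, 221, 7656704419⟩, ⟨69, 200, 251,
    34566442407⟩, ⟨38, 74, 251, 246024280077⟩, ⟨49, 202, 255, 2377267688487⟩], [⟨125, 257, 335,
    2256967712⟩, ⟨125, 4, 373, 215031941⟩, ⟨61, 324, 511, 35295104080045⟩, ⟨125, 80, 474,
    8831536164⟩, ⟨125, 64, 374, 1221795909⟩, ⟨31, 328, 511, 35404762943714⟩], [⟨125, 1, 619,
    5579509152⟩, ⟨4, 130, 763, 6768973358317⟩, ⟨125, 16, 634, 6619696548⟩, ⟨125, 16, 697,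
    9898661284⟩, ⟨125, 836, 846, 1378951373⟩], [⟨125, 1025, 1131, 5580950560⟩, ⟨125, 1026, 1587,
    5513847809⟩, ⟨125, 256, 2016, 9905023400⟩, ⟨125, 516, 1644, 6620096610⟩, ⟨125, 516, 1581,
    110536866⟩, ⟨125, 8, 1117, 10810823075⟩], [⟨125, 2049, 2155, 5581999136⟩, ⟨125, 2050, 2611,
    5514896385⟩, ⟨125, 256, 4000, 12156376488⟩, ⟨125, 4, 3117, 12146808226⟩], [⟨3, 1, 7679,
    14242922067791020077⟩, ⟨125, 4097, 4203, 5583047712⟩, ⟨2, 66, 8191, 455766823576008035334⟩,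
    ⟨125, 4098, 4659, 5515944961⟩, ⟨0, 2116, 7679, 14246365846590030854⟩]]⟩,
  ⟨⟨13, 3665840440101848956493963805080791326595337425707865643155504⟩, 1, [[]], [[], [], [], [],
    [], [], [], [], [⟨126, 65, 459, 3490094118⟩, ⟨126, 387, 411, 3493862445⟩, ⟨126, 139, 411,
    8694799405⟩], [⟨126, 129, 965, 8791696455⟩, ⟨126, 65, 963, 9898991654⟩, ⟨126, 585, 619,
    1280320621⟩, ⟨126, 773, 783, 3490784269⟩, ⟨126, 525, 783, 8691721229⟩, ⟨126, 771, 907,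
    7821591565⟩, ⟨126, 523, 907, 7826670605⟩], [⟨126, 1024, 1326, 3491796394⟩, ⟨126, 256, 1512,
    5711793576⟩, ⟨126, 1545, 1675, 1416924173⟩, ⟨126, 1536, 1834, 3499529258⟩, ⟨126, 12, 1182,
    10774551682⟩, ⟨126, 2, 1142, 5708519841⟩], [⟨126, 2048, 3012, 8805262407⟩, ⟨126, 512, 2764,
    3604256839⟩, ⟨126, 128, 2268, 3594590631⟩, ⟨126, 512, 3012, 8805198919⟩, ⟨126, 4, 3222,
    12056564130⟩, ⟨126, 4, 2764, 3604030663⟩, ⟨126, 2565, 2575, 3591447565⟩, ⟨126, 4, 3012,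
    8804969767⟩], [⟨0, 1, 8159, 14992837248672998659⟩, ⟨126, 4096, 4698, 4598205868⟩, ⟨1, 2561,
    7167, 5779394924950986859⟩, ⟨126, 8, 7944, 10077089187⟩, ⟨126, 9, 6921, 10066767107⟩, ⟨2, 2053,
    7167, 5769148964786283779⟩]]⟩,
  ⟨⟨13, 12856043795685509033669140121198908208088975091900101474451530⟩, 4, [[], [], [], [640]],
    [[], [], [], [], [], [], [⟨27, 33, 127, 75343334529⟩, ⟨50, 17, 127, 174053261357⟩, ⟨71, 34, 127,
    71947161645⟩, ⟨71, 5, 127, 38828772429⟩, ⟨43, 21, 127, 211597538305⟩, ⟨126, 70, 127,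
    4368403629⟩, ⟨50, 40, 127, 1214354509⟩, ⟨43, 42, 127, 206196290722⟩], [⟨127, 129, 235,
    5577804832⟩, ⟨127, 2, 250, 6623894628⟩, ⟨75, 194, 255, 2307672936487⟩, ⟨127, 128, 250,
    6624087076⟩, ⟨9, 196, 255, 14365767112705⟩, ⟨127, 8, 221, 7656704419⟩, ⟨71, 200, 251,
    34566442407⟩, ⟨40, 74, 251, 246024280077⟩, ⟨51, 202, 255, 2377267688487⟩], [⟨127, 257, 335,
    2256967712⟩, ⟨127, 4, 373, 215031941⟩, ⟨63, 324, 511, 35295104080045⟩, ⟨127, 80, 474,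
    8831536164⟩, ⟨127, 64, 374, 1221795909⟩, ⟨33, 328, 511, 35404762943714⟩], [⟨127, 513, 619,
    5579901984⟩, ⟨22, 578, 895, 75973710258477⟩, ⟨6, 260, 893, 209519191309⟩, ⟨127, 8, 605,
    9737081251⟩], [⟨127, 1, 1131, 5580557728⟩, ⟨127, 128, 1944, 9935399335⟩, ⟨127, 514, 1587,
    5512800257⟩, ⟨127, 1028, 1581, 111584418⟩, ⟨127, 16, 1146, 6620745124⟩, ⟨127, 16, 1209,
    10972403108⟩], [⟨127, 2, 3123, 12152078753⟩, ⟨127, 4, 2605, 12113253794⟩], [⟨127, 1024, 7554,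
    13262620074⟩, ⟨127, 4097, 4203, 5583047712⟩, ⟨127, 2048, 7812, 7854141867⟩, ⟨127, 2048, 7938,
    1417982379⟩]]⟩,
  ⟨⟨12, 98082801312628741206333505078204833041063753040970711074⟩, 1, [[68]], [[], [], [], [], [],
    [], [⟨72, 17, 127, 211539856418⟩], [⟨91, 193, 255, 8111150797856⟩, ⟨128, 8, 238, 6612360579⟩,
    ⟨91, 133, 255, 8115445630112⟩], [⟨72, 329, 351, 210529291296⟩, ⟨128, 4, 470, 7791052162⟩],
    [⟨128, 1, 655, 7629448257⟩, ⟨128, 128, 698, 9710048387⟩, ⟨78, 641, 959, 325595266323468⟩, ⟨128,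
    520, 700, 2291539107⟩], [⟨128, 576, 1652, 2291542182⟩], [⟨2, 513, 4095, 13049607637947191592⟩,
    ⟨1, 2561, 4095, 2571706124850172938⟩, ⟨0, 1537, 4095, 13056151931155714344⟩, ⟨128, 64, 3188,
    12148938118⟩, ⟨128, 2056, 2458, 8836747299⟩]]⟩,
  ⟨⟨16, 30081730833611175781888919096633692035705179989064072281096029158960674472010⟩, 3, [[], [],
    []], [[], [], [], [], [], [], [⟨52, 17, 127, 39831212240⟩, ⟨45, 49, 127, 69964152966⟩, ⟨73, 66,
    127, 175156265168⟩, ⟨29, 18, 127, 208456941669⟩, ⟨52, 10, 127, 143883601072⟩, ⟨45, 74, 127,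
    73215885349⟩, ⟨128, 100, 127, 37784551568⟩], [⟨129, 1, 207, 7719652864⟩, ⟨129, 130, 183,
    4369945601⟩, ⟨73, 165, 253, 247097458789⟩], [⟨129, 258, 359, 6451369025⟩, ⟨129, 4, 380,
    5486223556⟩, ⟨24, 164, 511, 215507669164272⟩, ⟨49, 76, 383, 8968968673424⟩, ⟨31, 261, 479,
    1185683803143⟩], [⟨129, 1, 591, 9766476288⟩, ⟨129, 514, 567, 4372042753⟩, ⟨129, 576, 723,
    1083710598⟩, ⟨65, 324, 895, 177031142967440⟩, ⟨79, 548, 895, 177227601912112⟩, ⟨129, 8, 873,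
    8898221571⟩, ⟨129, 8, 634, 1247946243⟩, ⟨129, 1, 715, 7727056384⟩, ⟨129, 549, 869, 8898221136⟩],
    [⟨104, 1537, 1917, 178473205350694⟩, ⟨129, 160, 1210, 4403505189⟩, ⟨129, 1024, 1452,
    7787940362⟩, ⟨129, 256, 1904, 5710685704⟩, ⟨55, 36, 1343, 9144091280464⟩, ⟨129, 256, 1992,
    3529746952⟩, ⟨46, 76, 1631, 11305434025104⟩], [⟨129, 2, 2103, 11983192577⟩, ⟨129, 2052, 3102,
    3367512098⟩], [⟨129, 4, 5150, 13223724546⟩], [⟨129, 8833, 10885, 2595527696⟩, ⟨129, 2048, 15136,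
    14369986059⟩, ⟨129, 4, 8471, 8724198914⟩], [⟨129, 512, 20232, 15412235785⟩, ⟨129, 2, 17423,
    10807687681⟩], [⟨129, 1, 32883, 4501585408⟩]]⟩,
  ⟨⟨15, 277803827403469586984428054152258477707136810438661772538044292458610828⟩, 1, [[]], [[], [],
    [], [], [], [], [⟨74, 17, 127, 208321774693⟩], [], [], [⟨93, 577, 763, 10412246637664⟩, ⟨130,
    32, 888, 8898350565⟩, ⟨130, 32, 746, 6678488549⟩, ⟨104, 515, 1019, 291887188712454⟩, ⟨88, 515,
    959, 289496905061506⟩], [⟨130, 1, 1421, 8835402208⟩, ⟨130, 1088, 1492, 8835797062⟩, ⟨130, 32,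
    1714, 11040595429⟩, ⟨130, 1313, 1333, 4464847119⟩, ⟨130, 258, 1310, 10846965825⟩], [⟨130, 1,
    2445, 8836419040⟩, ⟨130, 1, 3143, 11122251810⟩, ⟨130, 1, 3115, 12162438179⟩, ⟨130, 2369, 3409,
    11110916111⟩, ⟨130, 1345, 3409, 12151103503⟩, ⟨130, 1283, 3347, 12150939663⟩], [⟨130, 2048,
    7244, 3563139563⟩, ⟨130, 4097, 6691, 5671201836⟩], [], [⟨130, 1024, 19978, 15402640874⟩, ⟨0,
    17665, 32767, 310721750463782426314767⟩]]⟩,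
  ⟨⟨14, 635168425033101306225017739486270915916814430074030693467823341830⟩, 3, [[], [], []], [[],
    [], [], [], [], [], [], [⟨131, 144, 222, 2255951908⟩, ⟨79, 201, 255, 2302140397767⟩, ⟨131, 2,
    187, 7687242177⟩, ⟨131, 2, 183, 7686066625⟩, ⟨131, 144, 219, 41359460⟩], [⟨131, 129, 399,
    3296141344⟩, ⟨131, 65, 335, 3295092768⟩, ⟨131, 129, 407, 4336328768⟩, ⟨131, 32, 497,
    272833989⟩], [⟨131, 513, 783, 3298238496⟩, ⟨131, 32, 946, 9902793157⟩, ⟨131, 513, 791,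
    4338425920⟩, ⟨131, 64, 994, 9913442341⟩, ⟨131, 394, 910, 9900761134⟩, ⟨131, 202, 718,
    9900759086⟩, ⟨131, 256, 994, 9913505829⟩, ⟨131, 836, 980, 7822581838⟩, ⟨131, 452, 980,
    9902956622⟩, ⟨131, 528, 603, 43456612⟩, ⟨131, 32, 739, 9898596805⟩, ⟨131, 390, 910, 9901776942⟩,
    ⟨131, 198, 718, 9901774894⟩], [⟨131, 1024, 1932, 9901777354⟩, ⟨131, 128, 1764, 2489492935⟩,
    ⟨131, 4, 1181, 7856030146⟩, ⟨131, 68, 1103, 1080502370⟩, ⟨131, 4, 1167, 7852789186⟩], [⟨131, 1,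
    2319, 12082808256⟩, ⟨131, 2048, 3024, 7822582219⟩, ⟨131, 2097, 2617, 10036057102⟩, ⟨131, 1,
    2327, 12083825088⟩, ⟨131, 64, 2680, 10036057542⟩, ⟨131, 128, 3746, 12114373063⟩, ⟨131, 2048,
    2897, 272836043⟩], [⟨131, 4096, 4812, 7820384716⟩], [⟨131, 2048, 15008, 5618644361⟩, ⟨0, 10257,
    16383, 14514239519405290557889⟩, ⟨131, 128, 15232, 8973956489⟩, ⟨131, 8192, 10008, 8929781197⟩,
    ⟨0, 4230, 16383, 15693680334185736210880⟩]]⟩,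
  ⟨⟨14, 108613193497456571550948923554556144609891407613939635142315999276⟩, 1, [[]], [[], [], [],
    [], [], [], [], [⟨132, 128, 246, 4497413575⟩], [⟨132, 17, 317, 8762362944⟩], [⟨132, 512, 698,
    5606773193⟩, ⟨132, 258, 798, 4605807681⟩, ⟨132, 128, 948, 4605512135⟩, ⟨90, 67, 767,
    150854319479971⟩], [⟨68, 1089, 2037, 70550449961162⟩, ⟨132, 17, 1619, 1376200900⟩], [⟨132, 1,
    2349, 8769310144⟩, ⟨132, 2048, 3666, 1390782660⟩, ⟨132, 1, 2199, 4678753314⟩, ⟨68, 2051, 2807,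
    215819121339470⟩, ⟨132, 258, 2830, 11887125601⟩], [⟨132, 6209, 7361, 11147619342⟩], [⟨132, 1025,
    9261, 14070256704⟩, ⟨131, 9217, 13609, 108797112590⟩, ⟨132, 64, 8660, 14229410246⟩, ⟨1, 10305,
    16383, 12108138648458987906273⟩]]⟩,
  ⟨⟨13, 2410541929132471263748691973561070290955511053976092360638534⟩, 4, [[], [], [], [2560,
    4624]], [[], [], [], [], [], [⟨133, 4, 63, 5503978914⟩], [⟨133, 33, 111, 3294009376⟩, ⟨133, 18,
    126, 3289815204⟩, ⟨77, 106, 127, 176164345857⟩], [⟨133, 4, 159, 7617909154⟩, ⟨133, 18, 246,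
    7685445700⟩], [⟨133, 1, 335, 3296762272⟩, ⟨133, 272, 500, 7692785732⟩, ⟨133, 272, 380,
    3297155236⟩, ⟨133, 198, 486, 5612017741⟩, ⟨133, 102, 486, 7692392525⟩, ⟨133, 360, 366,
    1344379053⟩, ⟨133, 33, 359, 8629164096⟩], [⟨133, 1, 591, 9868215712⟩, ⟨133, 64, 881,
    8897298854⟩, ⟨133, 516, 573, 5512793090⟩, ⟨133, 550, 742, 6751946797⟩, ⟨133, 64, 627,
    5503985062⟩, ⟨133, 72, 857, 8895500294⟩, ⟨133, 16, 756, 9872509348⟩, ⟨133, 297, 825,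
    9936473101⟩, ⟨133, 537, 825, 8897301517⟩, ⟨133, 554, 622, 6746641453⟩], [⟨133, 2, 1827,
    5713953185⟩, ⟨133, 2, 1319, 5706359201⟩, ⟨133, 2, 1799, 9934219681⟩, ⟨133, 544, 1720,
    3465980037⟩, ⟨133, 1024, 1762, 9872508330⟩, ⟨133, 1024, 1506, 7692392874⟩, ⟨133, 32, 1206,
    1411521957⟩, ⟨133, 1, 1873, 8905566342⟩], [⟨133, 2048, 3528, 6781378987⟩, ⟨5, 8, 4095,
    15104022198758703464⟩, ⟨133, 2048, 3682, 9879000106⟩, ⟨133, 512, 3665, 12160634886⟩, ⟨133, 256,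
    3010, 7891879336⟩, ⟨132, 2561, 3907, 207610718477⟩], [⟨133, 2, 6978, 6758117736⟩, ⟨0, 4134,
    8191, 116774188815636210028⟩, ⟨133, 512, 6915, 47493480⟩, ⟨133, 8, 6328, 4476481895⟩, ⟨1, 4617,
    8191, 419999233969499640900⟩]]⟩,
  ⟨⟨12, 73560581087341115586751607854183185402573366827462427144⟩, 1, [[1344]], [[], [], [], [], [],
    [], [⟨134, 1, 95, 2193627267⟩, ⟨14, 5, 127, 412352679108⟩, ⟨78, 69, 127, 142875924864⟩, ⟨78, 21,
    127, 211595399552⟩, ⟨50, 85, 127, 36681683040⟩, ⟨34, 35, 127, 75333993856⟩], [⟨67, 67, 255,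
    7733259671936⟩, ⟨78, 18, 254, 247130524812⟩, ⟨50, 82, 254, 74225758247⟩], [⟨134, 64, 492,
    8827080070⟩, ⟨134, 129, 483, 5570437159⟩, ⟨134, 2, 414, 8829110657⟩], [⟨13, 17, 639,
    2238956315660⟩, ⟨134, 272, 828, 2324046948⟩], [⟨134, 64, 1142, 1153640581⟩, ⟨134, 1026, 1182,
    4406516801⟩], [⟨0, 259, 4095, 11676784110491508935⟩]]⟩,
  ⟨⟨12, 75092936304403171780129079764920565643942596052044283914⟩, 3, [[192, 320], [], []], [[], [],
    [], [], [], [], [], [⟨135, 80, 250, 7623545892⟩, ⟨135, 130, 215, 6517297153⟩, ⟨135, 72, 249,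
    5509618691⟩, ⟨135, 132, 231, 41293986⟩], [⟨135, 1, 441, 5515518179⟩, ⟨58, 417, 443,
    138518049031⟩, ⟨44, 97, 511, 213340023562343⟩, ⟨135, 258, 343, 6518345729⟩, ⟨135, 256, 441,
    5515779075⟩, ⟨135, 128, 441, 5515747331⟩, ⟨35, 418, 443, 8698332293⟩, ⟨135, 260, 359,
    42342562⟩], [⟨19, 769, 955, 5636380262792⟩, ⟨135, 32, 756, 7824544133⟩, ⟨135, 32, 636,
    3361809797⟩, ⟨135, 16, 826, 9839936900⟩, ⟨74, 785, 959, 256360192159880⟩, ⟨135, 514, 599,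
    6519394305⟩, ⟨135, 450, 963, 9898598604⟩, ⟨135, 354, 874, 3499268140⟩, ⟨135, 106, 874,
    9839941676⟩, ⟨135, 4, 615, 9831487874⟩, ⟨135, 260, 870, 9840236578⟩, ⟨135, 533, 725,
    7824543756⟩], [⟨135, 128, 1768, 6783536519⟩, ⟨135, 1025, 1477, 2349211882⟩, ⟨135, 1024, 1988,
    9900859786⟩, ⟨135, 8, 1209, 10977673603⟩, ⟨135, 4, 1127, 10938783106⟩, ⟨71, 1556, 2044,
    285020817265029⟩, ⟨71, 1548, 1790, 39760736619911⟩], [⟨135, 256, 3912, 10039397768⟩, ⟨135, 16,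
    2206, 7618997636⟩, ⟨135, 2, 2135, 11951735169⟩, ⟨0, 2050, 4063, 85610526922613984⟩, ⟨135, 2,
    2234, 7629483172⟩, ⟨135, 2112, 3024, 7824875659⟩, ⟨44, 32, 4028, 361027672869036⟩, ⟨135, 128,
    3721, 12113258887⟩, ⟨135, 2146, 2403, 8959072428⟩, ⟨0, 1540, 4079, 41728776207674630⟩]]⟩,
  ⟨⟨12, 122603408121931262935057129359492261825301160115659341988⟩, 4, [[], [], [2176], []], [[],
    [], [], [], [], [], [], [⟨136, 1, 183, 1312983424⟩, ⟨136, 2, 219, 239275393⟩, ⟨136, 1, 189,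
    4465958272⟩], [⟨136, 144, 411, 3259375623⟩, ⟨84, 278, 447, 3335049621764⟩, ⟨136, 144, 407,
    2152079399⟩, ⟨84, 281, 479, 2202285584644⟩], [⟨136, 513, 679, 1318458432⟩, ⟨136, 260, 996,
    9867500712⟩, ⟨136, 64, 984, 3530822022⟩, ⟨136, 68, 630, 5505426470⟩, ⟨136, 676, 694,
    1312990284⟩, ⟨72, 228, 767, 319996747221376⟩, ⟨136, 534, 694, 5510308940⟩, ⟨136, 264, 783,
    75899939⟩, ⟨136, 64, 754, 5510309254⟩, ⟨136, 40, 686, 7555392579⟩, ⟨136, 24, 543, 71705635⟩,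
    ⟨136, 24, 670, 7554344003⟩], [⟨136, 512, 1868, 8793467273⟩, ⟨136, 275, 1307, 10874822668⟩, ⟨136,
    1152, 1419, 3265667079⟩, ⟨136, 16, 1139, 1275242884⟩, ⟨136, 8, 1551, 11039475075⟩, ⟨136, 1152,
    1415, 2158370855⟩], [⟨136, 16, 3186, 12147955076⟩, ⟨136, 2049, 2215, 1320555584⟩, ⟨136, 16,
    3185, 12146874756⟩, ⟨136, 2050, 2251, 246814817⟩, ⟨1, 17, 4093, 79942507874626892⟩, ⟨136, 2067,
    2331, 8962215948⟩, ⟨8, 4, 4095, 13910501092067775786⟩, ⟨136, 2048, 3040, 9877953704⟩, ⟨136,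
    1024, 3864, 8962478474⟩, ⟨136, 512, 2898, 12092477478⟩, ⟨0, 2564, 3967, 366309171153537121⟩,
    ⟨136, 256, 3426, 11107767688⟩, ⟨136, 128, 2443, 12082774407⟩, ⟨136, 32, 3552, 11119271112⟩, ⟨0,
    2084, 4094, 157983708650146855⟩, ⟨135, 2592, 3952, 279486568780⟩, ⟨2, 1032, 4095,
    14166470762813259909⟩]]⟩,
  ⟨⟨11, 795086863128021036886317918521763827335392304365570⟩, 1, [[36, 48]], [[], [], [], [], [],
    [], [⟨137, 9, 125, 6509925507⟩], [⟨137, 16, 250, 6682674532⟩, ⟨137, 9, 189, 7650776131⟩, ⟨137,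
    4, 238, 7722861922⟩], [⟨137, 1, 343, 6521102465⟩, ⟨20, 65, 479, 3676565442792⟩, ⟨85, 321, 479,
    3438330348800⟩, ⟨81, 81, 471, 282597560672⟩, ⟨61, 337, 479, 3373935930624⟩, ⟨137, 4, 366,
    5477800290⟩], [⟨137, 288, 934, 2186650856⟩], [⟨137, 256, 1926, 11041545576⟩, ⟨1, 1281, 2047,
    255794857530927456⟩]]⟩,
  ⟨⟨11, 751241814007753666975662119383453062221806336999680⟩, 1, [[160, 544]], [[], [], [], [], [],
    [], [⟨138, 9, 125, 6610587715⟩, ⟨138, 3, 119, 5570400321⟩], [⟨138, 65, 235, 3389365286⟩, ⟨138,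
    17, 187, 5469740068⟩, ⟨138, 9, 189, 7650776131⟩, ⟨58, 53, 255, 246998534499⟩], [⟨138, 132, 500,
    5572501639⟩], [⟨138, 512, 746, 3400834086⟩, ⟨138, 128, 746, 3400770598⟩, ⟨17, 640, 1018,
    3474668626219⟩, ⟨138, 32, 742, 2192745702⟩, ⟨138, 3, 599, 9865367617⟩], [⟨9, 1, 2047,
    396390615185821738⟩, ⟨138, 1024, 1142, 5581901889⟩, ⟨138, 4, 1142, 5581645953⟩, ⟨1, 1029, 2047,
    183598961180115272⟩, ⟨0, 37, 1535, 389335837022250⟩, ⟨138, 1061, 1381, 6618622027⟩]]⟩,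
  ⟨⟨11, 935385355758836747142765042635369845215665051730194⟩, 3, [[], [1280], []], [[], [], [], [],
    [], [], [⟨19, 18, 127, 211629936651⟩, ⟨83, 82, 127, 178311539744⟩, ⟨139, 4, 111, 5570071906⟩,
    ⟨19, 36, 127, 1178765515⟩, ⟨19, 5, 127, 178346002475⟩, ⟨83, 37, 127, 211664579585⟩], [⟨139, 64,
    246, 4463861094⟩, ⟨139, 8, 190, 5504048483⟩], [⟨139, 1, 407, 7786762592⟩, ⟨87, 129, 509,
    2408542379275⟩, ⟨62, 160, 508, 105432454411⟩, ⟨139, 130, 474, 4397048007⟩, ⟨139, 34, 378,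
    3356860613⟩, ⟨34, 10, 511, 73881227504672⟩, ⟨108, 266, 511, 141020056628258⟩, ⟨62, 72, 508,
    180627901515⟩, ⟨84, 330, 383, 4573106642946⟩, ⟨42, 42, 511, 73881093406763⟩], [⟨139, 2, 783,
    3296732513⟩], [⟨139, 2, 1551, 11042619745⟩]]⟩,
  ⟨⟨11, 403380875084177658300494059068153247983341561774242⟩, 2, [[20], [136]], [[], [], [], [], [],
    [], [⟨84, 9, 127, 142819301410⟩, ⟨84, 18, 127, 72086493344⟩], [], [⟨140, 1, 423, 8826951008⟩,
    ⟨103, 298, 447, 9039131055136⟩], [⟨140, 1, 679, 9833586016⟩, ⟨140, 1, 881, 8903465093⟩, ⟨19, 65,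
    1011, 9112986322123⟩, ⟨121, 325, 1021, 325696132323426⟩, ⟨140, 514, 711, 7525996609⟩, ⟨140, 128,
    921, 9935389031⟩, ⟨121, 642, 767, 328994666879074⟩, ⟨140, 32, 825, 8895201637⟩, ⟨140, 32, 745,
    3429901669⟩], [⟨0, 517, 2039, 6795153901923402⟩, ⟨140, 1, 1649, 10883179717⟩, ⟨140, 581, 1733,
    10811876555⟩, ⟨140, 2, 1223, 10811873633⟩, ⟨140, 1024, 1720, 9843317860⟩, ⟨19, 1032, 1980,
    10076232681579⟩, ⟨140, 1056, 1761, 7527048389⟩]]⟩,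
  ⟨⟨10, 5887636292610725047199211304410058715802435618⟩, 1, [[20, 68]], [[], [], [], [], [], [],
    [⟨85, 9, 127, 211537727522⟩], [⟨104, 193, 255, 8042463826976⟩, ⟨141, 16, 246, 6612360516⟩, ⟨104,
    133, 255, 8046758659232⟩], [⟨141, 64, 492, 7786829126⟩], [⟨2, 1, 1023, 2287160520877162⟩, ⟨141,
    512, 732, 7661197379⟩, ⟨141, 257, 977, 4530185416⟩, ⟨141, 128, 698, 9775060004⟩, ⟨36, 641, 1019,
    180529597219850⟩, ⟨141, 4, 732, 7660971203⟩, ⟨0, 517, 1023, 10388393228838917⟩]]⟩,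
  ⟨⟨10, 2854496749573702755493575977263906208389267472⟩, 1, [[258, 522, 776]], [[], [], [], [], [],
    [], [⟨142, 1, 123, 5580524580⟩, ⟨22, 33, 127, 343804022881⟩, ⟨86, 41, 127, 36681420096⟩, ⟨42,
    69, 127, 175088212288⟩, ⟨86, 35, 127, 105400894784⟩, ⟨58, 43, 127, 211597722752⟩], [⟨75, 73,
    255, 7908179873088⟩, ⟨86, 66, 254, 243811946538⟩, ⟨58, 74, 254, 173984032967⟩], [⟨142, 320, 498,
    1216683174⟩, ⟨142, 8, 366, 6620815394⟩, ⟨142, 2, 366, 6620749922⟩], [⟨142, 64, 756, 9900822854⟩,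
    ⟨0, 577, 767, 37558656565577⟩, ⟨142, 8, 700, 9903870275⟩]]⟩,
  ⟨⟨10, 5753777375243902820444913582230726912844759076⟩, 1, [[258]], [[], [], [], [], [], [], [⟨142,
    81, 127, 174086685802⟩, ⟨87, 9, 127, 138686859274⟩, ⟨59, 11, 127, 211529279588⟩], [⟨25, 17, 255,
    71984878791⟩, ⟨88, 131, 255, 6843034275936⟩, ⟨57, 67, 255, 7837448472608⟩], [⟨143, 1, 363,
    3433046053⟩, ⟨38, 385, 511, 5567488926023⟩, ⟨143, 64, 492, 8759909702⟩, ⟨143, 2, 438,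
    8765180225⟩], [⟨1, 257, 895, 144244334437642⟩, ⟨79, 321, 895, 144114440214698⟩]]⟩,
  ⟨⟨11, 795080083537464541144586562523937177317144997920772⟩, 1, [[514]], [[], [], [], [], [], [],
    [⟨144, 1, 111, 5581573154⟩, ⟨24, 33, 127, 378163824737⟩, ⟨44, 81, 127, 175155255648⟩, ⟨88, 41,
    127, 38828838240⟩, ⟨88, 35, 127, 107548312928⟩, ⟨60, 43, 127, 211664864320⟩], [⟨77, 73, 255,
    7908244884832⟩, ⟨88, 66, 254, 243879053355⟩, ⟨60, 74, 254, 176129420487⟩], [⟨80, 321, 511,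
    39685572629704⟩, ⟨118, 265, 511, 39763183765696⟩, ⟨144, 129, 473, 4395999431⟩, ⟨127, 267, 511,
    251929026626912⟩], [⟨144, 576, 742, 1150655654⟩, ⟨144, 8, 924, 8834386275⟩, ⟨0, 520, 1022,
    397204085999713⟩, ⟨144, 2, 634, 6621799524⟩], [⟨144, 64, 1254, 10906312038⟩, ⟨0, 1088, 1534,
    398062033935560⟩]]⟩,
  ⟨⟨12, 67430366522615383365698422920684981491979444800934970382⟩, 5, [[384], [], [], [], []], [[],
    [], [], [], [], [], [⟨45, 65, 127, 173086345347⟩, ⟨89, 33, 127, 107576559788⟩, ⟨68, 68, 127,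
    3356563628⟩, ⟨89, 72, 127, 173947424876⟩, ⟨144, 42, 127, 4463888588⟩, ⟨61, 76, 127,
    34464673989⟩, ⟨68, 17, 127, 211595427948⟩, ⟨61, 49, 127, 40972201987⟩], [⟨145, 1, 175,
    5443194240⟩, ⟨145, 2, 235, 5573188993⟩, ⟨28, 132, 255, 3551939072197⟩, ⟨26, 140, 255,
    415775103109⟩, ⟨60, 14, 255, 7874856489027⟩, ⟨28, 144, 255, 5751163717635⟩, ⟨26, 176, 255,
    7014994444355⟩, ⟨60, 50, 255, 7799700850821⟩], [⟨145, 1, 303, 8695907712⟩, ⟨145, 258, 467,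
    4505082881⟩, ⟨145, 260, 311, 1082528898⟩, ⟨145, 136, 473, 6584410115⟩, ⟨145, 40, 315,
    1079386243⟩, ⟨145, 16, 350, 1283557764⟩], [⟨145, 4, 567, 9832501634⟩, ⟨145, 520, 857,
    6586507267⟩, ⟨145, 528, 606, 1284901956⟩, ⟨145, 288, 870, 1283859525⟩], [⟨0, 34, 1791,
    11508727795619209⟩, ⟨35, 1058, 1527, 147408647758151⟩, ⟨145, 4, 1103, 6488664160⟩, ⟨3, 1028,
    1407, 182557685657928⟩, ⟨145, 8, 1071, 5448509472⟩, ⟨24, 1032, 1375, 6635791688012⟩, ⟨1, 10,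
    1279, 359718579211276⟩, ⟨2, 16, 1663, 327832744034412⟩], [⟨145, 1024, 3461, 12048146826⟩, ⟨145,
    3082, 3610, 10037078060⟩]]⟩,
  ⟨⟨11, 374144865542523338992719508794887438700893727948962⟩, 4, [[16], [], [16], []], [[], [], [],
    [], [], [], [⟨146, 24, 95, 38115395⟩], [⟨146, 130, 246, 5504342087⟩, ⟨26, 18, 223,
    382253243586⟩, ⟨94, 82, 255, 5635042286786⟩, ⟨146, 4, 215, 1085347975⟩, ⟨59, 69, 239,
    172880137410⟩, ⟨59, 70, 223, 137680192619⟩, ⟨94, 22, 255, 5635042286662⟩, ⟨69, 86, 247,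
    5504216258⟩, ⟨58, 136, 223, 1215498347⟩, ⟨26, 40, 239, 183643638978⟩, ⟨46, 25, 223,
    40905179492⟩], [⟨146, 1, 423, 2390791520⟩, ⟨146, 2, 303, 2253398369⟩, ⟨46, 130, 463,
    68965928136⟩, ⟨72, 98, 495, 2309619887304⟩, ⟨27, 100, 495, 8076860064872⟩, ⟨2, 5, 511,
    146511004535019⟩, ⟨145, 261, 463, 244007901227⟩, ⟨146, 4, 469, 8802865159⟩, ⟨61, 265, 495,
    5573795223656⟩], [⟨146, 513, 739, 6687134752⟩, ⟨146, 514, 907, 7525998689⟩, ⟨146, 8, 591,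
    9730824547⟩], [⟨1, 257, 1535, 4681830267658602⟩, ⟨146, 2, 1295, 11008049505⟩, ⟨0, 1058, 2047,
    156827920904752129⟩, ⟨146, 64, 1481, 11006086502⟩, ⟨146, 1028, 1677, 245736546⟩, ⟨3, 8, 1503,
    356517722397771⟩, ⟨146, 1032, 1103, 44406851⟩, ⟨146, 768, 1986, 7727327272⟩]]⟩,
  ⟨⟨11, 795082938001544982623116107043060321450853862277202⟩, 4, [[], [], [], []], [[], [], [], [],
    [], [], [], [⟨27, 34, 191, 183614145762⟩, ⟨60, 148, 191, 171936416994⟩, ⟨60, 133, 223,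
    210454809826⟩, ⟨27, 72, 223, 218103844066⟩, ⟨70, 74, 223, 6815780066⟩, ⟨70, 42, 191,
    143176860898⟩], [⟨147, 1, 347, 8794539360⟩, ⟨31, 257, 383, 3441410709771⟩, ⟨27, 257, 351,
    107410096331⟩, ⟨147, 2, 407, 8661245281⟩, ⟨147, 272, 441, 7625610244⟩, ⟨147, 4, 350,
    6715180386⟩, ⟨27, 68, 351, 140693932299⟩, ⟨30, 20, 479, 7911363382411⟩, ⟨105, 84, 511,
    249623645194501⟩, ⟨147, 8, 413, 142679395⟩, ⟨147, 1, 467, 8798638432⟩, ⟨117, 265, 511,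
    188020993067111⟩, ⟨91, 265, 351, 214816533604⟩], [⟨147, 2, 711, 9904851297⟩, ⟨147, 512, 573,
    2259981316⟩, ⟨147, 2, 903, 9907011937⟩, ⟨147, 8, 571, 1085383844⟩, ⟨89, 778, 991,
    246500119815522⟩], [⟨147, 768, 1938, 1317382281⟩, ⟨5, 40, 1727, 71476078292138⟩]]⟩,
  ⟨⟨13, 16873340632931026351768298913464271437357592466738717555163392⟩, 1, [[]], [[], [], [], [],
    [], [], [⟨148, 17, 125, 2349241444⟩, ⟨148, 3, 111, 6509991009⟩], [⟨148, 33, 243, 6577101861⟩,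
    ⟨147, 200, 254, 138753971277⟩, ⟨68, 105, 255, 242704649636⟩, ⟨148, 5, 215, 4496727074⟩, ⟨148, 5,
    207, 3255213250⟩, ⟨68, 195, 255, 107543207330⟩], [⟨148, 64, 476, 3362857382⟩], [⟨148, 512, 726,
    4510227490⟩, ⟨148, 128, 726, 4510164002⟩, ⟨6, 193, 1015, 40827327948032⟩, ⟨38, 705, 767,
    106795639210409⟩, ⟨33, 648, 1022, 325492063506631⟩], [⟨148, 1024, 1148, 2362774628⟩, ⟨148, 8,
    1148, 2362550436⟩, ⟨6, 73, 1407, 177093755414784⟩, ⟨38, 1097, 1279, 251858161598890⟩], [⟨148, 1,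
    3905, 12160345288⟩, ⟨2, 640, 4094, 370822670374372546⟩, ⟨148, 2689, 2729, 3595805709⟩, ⟨148,
    1024, 3888, 9937497514⟩], [⟨148, 2048, 7560, 7927565739⟩]]⟩,
  ⟨⟨11, 1135612819870554752110360514950546696346324059620374⟩, 2, [[768], [144]], [[], [], [], [],
    [], [], [], [⟨149, 129, 183, 5443522592⟩], [⟨149, 1, 429, 7796167778⟩, ⟨70, 321, 503,
    176167100775⟩, ⟨69, 289, 495, 3545537609803⟩, ⟨148, 161, 487, 70033350859⟩, ⟨28, 9, 383,
    6770212737131⟩, ⟨101, 73, 495, 7972739678563⟩, ⟨149, 2, 371, 5574238561⟩, ⟨149, 32, 429,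
    7796329474⟩, ⟨51, 42, 383, 6780782387236⟩, ⟨72, 6, 487, 213948336139⟩], [⟨149, 1, 567,
    9803203936⟩, ⟨149, 1, 599, 9804220768⟩, ⟨9, 545, 1023, 3527302061403431⟩, ⟨149, 553, 683,
    7819236459⟩, ⟨149, 128, 980, 4599322983⟩, ⟨6, 2, 1007, 320205013387275⟩], []]⟩,
  ⟨⟨12, 148655528354193567708243139433557858694434961730245558346⟩, 3, [[], [], []], [[], [], [],
    [], [], [], [], [⟨150, 34, 183, 4367719425⟩], [⟨150, 257, 347, 4404418592⟩, ⟨150, 32, 504,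
    7721820549⟩, ⟨150, 257, 335, 2189826144⟩, ⟨150, 177, 437, 8759942156⟩, ⟨150, 258, 407,
    4370865153⟩, ⟨150, 258, 399, 3230014529⟩, ⟨150, 80, 497, 8762301446⟩, ⟨150, 8, 317, 8759935363⟩,
    ⟨150, 68, 485, 8760204294⟩, ⟨150, 8, 315, 8758759811⟩, ⟨150, 165, 437, 8761973772⟩], [⟨150, 512,
    948, 5641411977⟩, ⟨150, 32, 888, 9936411013⟩, ⟨150, 513, 933, 5637545033⟩, ⟨150, 144, 978,
    8896518183⟩, ⟨86, 561, 959, 247467732009347⟩, ⟨150, 34, 874, 9933559909⟩, ⟨86, 562, 895,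
    211218073945474⟩, ⟨150, 4, 798, 8895202690⟩, ⟨150, 68, 606, 3362137122⟩, ⟨86, 396, 1021,
    6773272550793⟩, ⟨86, 332, 1022, 43194561698181⟩], [⟨150, 1, 1115, 10943038848⟩, ⟨150, 1, 1103,
    10940878208⟩, ⟨150, 1026, 1175, 4372962305⟩, ⟨150, 64, 1481, 8928632198⟩, ⟨150, 1026, 1167,
    3232111681⟩, ⟨150, 256, 1960, 7821502856⟩], [⟨150, 1024, 3536, 4671611274⟩, ⟨150, 128, 2786,
    12118590855⟩, ⟨150, 16, 2110, 5470498180⟩, ⟨0, 1073, 4089, 13662919345576197⟩, ⟨1, 2, 4095,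
    3605132780814833996⟩, ⟨150, 2048, 3672, 6781281675⟩, ⟨150, 16, 3101, 11106617732⟩, ⟨150, 8,
    2107, 11946431875⟩, ⟨0, 2316, 4092, 13625326571693387⟩]]⟩,
  ⟨⟨11, 420919608317881980283923917079929392671340403949610⟩, 4, [[1152], [], [], []], [[], [], [],
    [], [], [], [⟨95, 65, 127, 36646685899⟩, ⟨51, 17, 127, 211672894529⟩, ⟨150, 98, 127,
    2354089099⟩, ⟨95, 18, 127, 209385031723⟩, ⟨74, 5, 127, 143987376171⟩, ⟨67, 69, 127,
    176298208257⟩, ⟨74, 24, 127, 1146196171⟩, ⟨67, 26, 127, 171834453126⟩], [⟨33, 66, 255,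
    6700227661991⟩, ⟨74, 34, 191, 71944934635⟩, ⟨99, 132, 255, 6704611952683⟩, ⟨96, 196, 255,
    5742483538950⟩, ⟨53, 36, 255, 7731044035750⟩, ⟨65, 100, 255, 7731113462854⟩, ⟨33, 136, 255,
    7733100254342⟩, ⟨95, 40, 191, 241663377515⟩, ⟨67, 42, 191, 139687144615⟩], [⟨151, 257, 363,
    6551868448⟩, ⟨151, 256, 373, 179574852⟩, ⟨151, 4, 414, 8731528546⟩, ⟨7, 260, 511,
    396070208146502⟩], [⟨151, 513, 571, 4472540192⟩, ⟨151, 514, 663, 4371880961⟩, ⟨41, 68, 767,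
    247562051364043⟩, ⟨151, 8, 621, 9870248291⟩], [⟨151, 1, 1131, 10911581536⟩, ⟨7, 1025, 1279,
    398233833636871⟩, ⟨6, 2, 1535, 9365745411556587⟩, ⟨151, 1026, 1175, 4372929537⟩, ⟨6, 8, 1535,
    11548205158304971⟩, ⟨151, 1024, 1205, 2293570565⟩]]⟩,
  ⟨⟨11, 751237710517852763789059291698519832929449846505552⟩, 1, [[1028]], [[], [], [], [], [], [],
    [⟨96, 9, 127, 36713893899⟩, ⟨68, 13, 127, 178245413985⟩, ⟨151, 35, 127, 210492196971⟩], [⟨33,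
    133, 255, 6975264033921⟩, ⟨67, 37, 255, 7734336786496⟩], [⟨152, 1, 365, 3400540230⟩, ⟨8, 33,
    511, 289209309069515⟩, ⟨37, 259, 511, 289246765255840⟩], [⟨152, 512, 634, 6622056483⟩], [⟨6,
    257, 2047, 333630554551355558⟩, ⟨1, 1281, 2047, 38390726247425256⟩, ⟨0, 33, 1791,
    8243417875288070⟩, ⟨152, 1313, 1331, 1413488811⟩, ⟨152, 801, 1841, 11043610795⟩, ⟨152, 4, 1142,
    5580558690⟩]]⟩,
  ⟨⟨10, 8920483196010629280665222305240256348613312554⟩, 4, [[], [128], [64], [128]], [[], [], [],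
    [], [], [], [⟨97, 65, 127, 36646685898⟩, ⟨53, 17, 127, 211671845953⟩, ⟨152, 98, 127,
    2354089098⟩, ⟨97, 18, 127, 209385031722⟩, ⟨76, 5, 127, 143987376170⟩, ⟨69, 69, 127,
    176298207233⟩, ⟨76, 24, 127, 1146196170⟩, ⟨69, 26, 127, 171834452102⟩], [⟨153, 129, 187,
    4470410272⟩, ⟨153, 66, 250, 5504310374⟩, ⟨153, 132, 190, 5510597666⟩, ⟨153, 8, 237,
    7722764611⟩], [⟨153, 1, 363, 8764097856⟩, ⟨36, 260, 383, 6882824621057⟩, ⟨153, 32, 371,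
    6577725765⟩, ⟨68, 42, 383, 9006714521697⟩], [⟨0, 257, 1023, 8209228860886209⟩, ⟨6, 2, 1023,
    11506529049090053⟩, ⟨153, 512, 629, 178559044⟩, ⟨5, 258, 1023, 8103512672109573⟩, ⟨1, 34, 1023,
    9263735675914272⟩, ⟨43, 546, 959, 105623049280808⟩, ⟨153, 4, 629, 178332868⟩, ⟨11, 516, 767,
    35359597603111⟩]]⟩,
  ⟨⟨10, 892095143713385780425075122602451375795994628⟩, 1, [[528]], [[], [], [], [], [], [], [],
    [⟨154, 1, 183, 5614080034⟩, ⟨154, 1, 215, 6486498434⟩, ⟨35, 81, 255, 1343421098112⟩, ⟨78, 209,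
    255, 5704898644096⟩, ⟨35, 49, 255, 7734365956224⟩, ⟨78, 51, 255, 6776486692992⟩], [⟨154, 129,
    427, 1174741159⟩, ⟨35, 273, 479, 7734366054528⟩, ⟨56, 259, 495, 5712643165408⟩, ⟨154, 129, 441,
    4395966631⟩, ⟨56, 35, 495, 9007956823264⟩, ⟨54, 291, 431, 111909602368⟩], [⟨154, 16, 922,
    8835441699⟩, ⟨154, 2, 846, 8800799041⟩, ⟨131, 515, 767, 211288037885988⟩]]⟩,
  ⟨⟨10, 3924996493159123457084588792688189258709860516⟩, 3, [[520], [768], [16]], [[], [], [], [],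
    [], [⟨155, 4, 63, 4400874818⟩], [], [⟨155, 1, 237, 6613441856⟩], [⟨155, 1, 429, 8828032320⟩,
    ⟨155, 64, 504, 7787910470⟩, ⟨155, 306, 315, 171057194⟩, ⟨155, 66, 371, 169156742⟩, ⟨155, 298,
    315, 172073002⟩, ⟨155, 267, 315, 4400881706⟩, ⟨155, 260, 287, 4404347906⟩], [⟨155, 1, 915,
    4607451175⟩, ⟨15, 265, 1023, 1206404948174948⟩, ⟨155, 2, 915, 4607483911⟩, ⟨155, 512, 952,
    8828097865⟩, ⟨1, 258, 1015, 46248483792006⟩, ⟨59, 290, 1007, 219909885961314⟩, ⟨155, 16, 732,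
    7820384580⟩, ⟨14, 522, 1023, 4791844790930496⟩, ⟨34, 3, 999, 6877625714730⟩, ⟨5, 523, 1023,
    11374591941319840⟩, ⟨150, 75, 1023, 9189865390670049⟩, ⟨94, 586, 1022, 289208172422469⟩, ⟨12,
    32, 1019, 106796783279114⟩, ⟨78, 160, 1009, 210763947018⟩]]⟩,
  ⟨⟨10, 5887615195394734114973763660266759577735069722⟩, 1, [[36]], [[], [], [], [], [], [], [⟨79,
    65, 127, 211671908449⟩], [⟨156, 1, 187, 5510366528⟩], [⟨156, 1, 315, 5511351616⟩, ⟨119, 161,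
    495, 8836062711104⟩], [⟨1, 1, 991, 221113745473578⟩, ⟨0, 545, 1019, 106661527360650⟩, ⟨156, 288,
    934, 2186618088⟩]]⟩,
  ⟨⟨10, 5798414256419426688162195336783857687181197322⟩, 1, [[20]], [[], [], [], [], [], [], [], [],
    [⟨157, 1, 413, 7795118147⟩, ⟨3, 257, 511, 11031895249095⟩, ⟨157, 129, 485, 2315591879⟩, ⟨59,
    289, 447, 7982199935137⟩, ⟨15, 17, 511, 219083130939393⟩, ⟨0, 273, 511, 218976793791754⟩, ⟨36,
    5, 447, 7976965440522⟩, ⟨109, 133, 509, 6740120799552⟩, ⟨156, 324, 508, 108657709290⟩], [⟨15,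
    321, 991, 253035854177345⟩, ⟨90, 261, 957, 10178169801024⟩]]⟩,
  ⟨⟨11, 760009753406518246040128001436860197145896114978820⟩, 1, [[1026]], [[], [], [], [], [], [],
    [⟨38, 17, 127, 11981066435⟩, ⟨81, 19, 127, 69093855427⟩], [⟨158, 1, 183, 4474280994⟩, ⟨60, 97,
    255, 383466380355⟩, ⟨40, 137, 255, 4611760000352⟩, ⟨157, 168, 254, 138752923723⟩, ⟨58, 97, 247,
    145157592416⟩], [⟨0, 129, 511, 287113397476704⟩, ⟨14, 33, 511, 12202171112520⟩, ⟨91, 161, 503,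
    8972390145376⟩, ⟨40, 258, 510, 9043132322947⟩, ⟨102, 34, 502, 282599786539⟩, ⟨74, 162, 502,
    143917296808⟩], [⟨94, 545, 1015, 42022035886249⟩, ⟨158, 514, 622, 5445621857⟩], [⟨16, 40, 2044,
    78280380296298⟩, ⟨158, 2, 1134, 10843396449⟩]]⟩,
  ⟨⟨11, 403380696646228494307531378253914119933206469017624⟩, 1, [[]], [[], [], [], [], [], [], [],
    [], [⟨159, 65, 485, 8758074438⟩, ⟨82, 160, 494, 36717171819⟩, ⟨159, 389, 437, 5641346123⟩, ⟨122,
    37, 495, 8830623914338⟩, ⟨159, 165, 437, 8761908299⟩, ⟨159, 3, 423, 5637512257⟩, ⟨63, 35, 511,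
    77349247819904⟩], [⟨159, 1, 683, 1320166563⟩, ⟨68, 512, 1022, 77146243567915⟩, ⟨107, 640, 1006,
    2406529408107⟩, ⟨159, 256, 882, 4603413864⟩, ⟨1, 33, 1007, 325492190383115⟩, ⟨49, 544, 1022,
    77007963656491⟩, ⟨159, 516, 924, 7619321993⟩, ⟨95, 133, 1007, 325627347829986⟩, ⟨104, 644, 1006,
    9106617502882⟩], [⟨0, 128, 2046, 4857853940898923⟩, ⟨159, 1152, 1738, 9775192103⟩]]⟩,
  ⟨⟨10, 8920473668114740800935125194051502518020669514⟩, 4, [[], [], [], []], [[], [], [], [], [],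
    [], [⟨83, 33, 127, 139688313034⟩, ⟨60, 17, 127, 69937925286⟩, ⟨104, 5, 127, 211662408778⟩, ⟨76,
    37, 127, 38725134342⟩, ⟨159, 70, 127, 140862624778⟩, ⟨83, 24, 127, 6611374154⟩, ⟨76, 88, 127,
    34566416514⟩], [⟨83, 66, 251, 175024309482⟩, ⟨62, 34, 255, 7902845872162⟩, ⟨42, 68, 255,
    2302280929319⟩, ⟨105, 164, 255, 1344436082690⟩, ⟨74, 38, 255, 7902777904290⟩, ⟨42, 136, 255,
    7908119118978⟩, ⟨104, 10, 251, 247132618858⟩, ⟨76, 74, 251, 142908532775⟩], [⟨160, 257, 347,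
    4337244256⟩, ⟨160, 258, 435, 5511650305⟩, ⟨69, 4, 511, 253063801708618⟩, ⟨160, 132, 413,
    108339330⟩, ⟨50, 36, 511, 252922173694026⟩, ⟨160, 8, 303, 8658097475⟩, ⟨160, 320, 497,
    4471462918⟩], [⟨1, 1, 1023, 9331766749888618⟩, ⟨160, 513, 591, 2257917984⟩, ⟨160, 128, 994,
    8897365319⟩, ⟨160, 2, 630, 6620750916⟩, ⟨50, 514, 1019, 105731492913450⟩, ⟨18, 6, 1015,
    6776690878536⟩, ⟨0, 264, 1023, 10207872570989610⟩]]⟩,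
  ⟨⟨9, 24500828910497437477090384003437852688394⟩, 1, [[36, 260]], [[], [], [], [], [], [], [], [],
    [⟨161, 1, 365, 6720328771⟩, ⟨7, 257, 511, 9932383589606⟩, ⟨0, 385, 511, 71612409086119⟩, ⟨161,
    65, 469, 2282004710⟩, ⟨19, 33, 511, 253166917690369⟩, ⟨4, 289, 511, 253027294547209⟩, ⟨63, 273,
    383, 6881614566529⟩, ⟨40, 5, 383, 6876413625353⟩, ⟨113, 69, 509, 7872884869408⟩]]⟩,
  ⟨⟨13, 13264009817324958052437943148270906654679776639159055344537638⟩, 3, [[2624], [4224],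
    [1288]], [[], [], [], [], [], [], [⟨85, 17, 127, 40973111373⟩, ⟨78, 81, 127, 104359539842⟩, ⟨85,
    34, 127, 139589747917⟩, ⟨62, 18, 127, 72088584358⟩, ⟨161, 76, 127, 137643496493⟩, ⟨106, 6, 127,
    211664535629⟩, ⟨78, 38, 127, 107441468454⟩], [⟨44, 129, 255, 7908155722882⟩, ⟨106, 9, 251,
    247132685325⟩, ⟨78, 73, 251, 142808921191⟩, ⟨44, 68, 255, 2200278601831⟩, ⟨107, 164, 255,
    3543361820706⟩, ⟨76, 44, 255, 7903918850210⟩], [⟨162, 257, 303, 3263599680⟩, ⟨162, 258, 335,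
    2156304481⟩, ⟨162, 4, 380, 6623928420⟩, ⟨1, 260, 511, 296015760459873⟩], [⟨162, 1, 753,
    7731160197⟩, ⟨52, 512, 1022, 38696753837346⟩, ⟨162, 514, 603, 4405499905⟩, ⟨85, 288, 1016,
    243880170797⟩, ⟨98, 12, 1022, 42036027790473⟩], [⟨162, 1025, 1071, 3265696832⟩, ⟨162, 1026,
    1103, 2158401633⟩, ⟨162, 32, 1265, 7728136613⟩, ⟨162, 8, 1179, 10871676323⟩], [⟨162, 64, 2530,
    8836515238⟩, ⟨17, 2, 3579, 11655067133477901⟩, ⟨162, 2050, 2139, 4407597057⟩, ⟨162, 4, 2327,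
    8725212578⟩], [⟨162, 1, 4623, 9733976480⟩, ⟨162, 128, 5064, 9944894887⟩]]⟩,
  ⟨⟨12, 122986695695331084229906234606406472034074113261096403048⟩, 1, [[532]], [[], [], [], [], [],
    [], [⟨79, 3, 127, 413463088134⟩], [], [⟨163, 1, 413, 8837402691⟩, ⟨44, 257, 479, 7703429907586⟩,
    ⟨107, 273, 415, 70069096832⟩, ⟨86, 144, 478, 36616412364⟩, ⟨108, 261, 479, 8837973248390⟩, ⟨107,
    132, 478, 210495573068⟩, ⟨79, 277, 477, 282599719298⟩, ⟨79, 148, 478, 276022046950⟩], [⟨163, 16,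
    826, 9772766596⟩, ⟨163, 4, 814, 9772766594⟩], [⟨163, 1, 1565, 11051995203⟩], [⟨0, 641, 4095,
    5778446356594300964⟩, ⟨91, 2689, 4015, 5673722766009738⟩, ⟨53, 16, 3518, 364187559702661⟩, ⟨163,
    2064, 2234, 7628788772⟩, ⟨99, 5, 2527, 395871501950054⟩]]⟩,
  ⟨⟨11, 938312774754932151498589171995575409708861508878354⟩, 1, [[36]], [[], [], [], [], [], [],
    [], [⟨164, 1, 189, 7628395588⟩, ⟨45, 129, 255, 3299982153797⟩, ⟨109, 161, 255, 7905963283809⟩,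
    ⟨64, 73, 253, 246090435936⟩, ⟨108, 40, 254, 36715991211⟩, ⟨108, 133, 253, 178479303008⟩, ⟨87,
    12, 254, 211668765739⟩], [⟨100, 33, 511, 289389697567873⟩, ⟨2, 5, 509, 3581103180128⟩, ⟨46, 261,
    509, 7905058365792⟩], [⟨90, 265, 1017, 6843094019337⟩], [⟨164, 8, 1484, 2360453383⟩, ⟨0, 1033,
    2047, 189474692024864843⟩]]⟩,
  ⟨⟨10, 6422816064680761529542319191888376606843273226⟩, 1, [[4]], [[], [], [], [], [], [], [⟨109,
    33, 127, 208410936330⟩, ⟨164, 81, 127, 104358480042⟩], [⟨165, 1, 183, 4473232449⟩, ⟨110, 145,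
    255, 4506731446598⟩], [⟨165, 128, 492, 3299057830⟩], [⟨165, 257, 853, 2349147272⟩, ⟨165, 1, 679,
    9841941569⟩, ⟨0, 529, 1023, 9334994381211847⟩]]⟩,
  ⟨⟨9, 2722632794685562234942815972093937909802⟩, 1, [[260]], [[], [], [], [], [], [], [⟨89, 17,
    127, 144058679393⟩], [⟨110, 65, 253, 139694642185⟩, ⟨82, 69, 253, 243744711876⟩], [⟨166, 1, 363,
    6618711328⟩, ⟨4, 257, 509, 7840535249192⟩, ⟨0, 385, 511, 291405049304132⟩]]⟩,
  ⟨⟨10, 1516499675864045599789355882295729381612781578⟩, 1, [[4]], [[], [], [], [], [], [], [⟨80,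
    33, 127, 217067880545⟩], [⟨167, 1, 221, 6687821891⟩, ⟨47, 65, 253, 343838723202⟩, ⟨111, 81, 253,
    74296955200⟩], [⟨100, 145, 509, 9043224629568⟩], [⟨23, 129, 1021, 11311033520232⟩, ⟨103, 641,
    991, 221354259515489⟩, ⟨9, 17, 1021, 289387550183744⟩, ⟨167, 528, 698, 7626626084⟩]]⟩,
  ⟨⟨11, 1215995231488526962424913368321485600262481287118862⟩, 3, [[], [], [32]], [[], [], [], [],
    [], [], [⟨91, 65, 127, 38760618059⟩, ⟨84, 81, 127, 173009808578⟩, ⟨68, 66, 127, 74301079652⟩,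
    ⟨91, 10, 127, 208311256203⟩, ⟨112, 6, 127, 140866781259⟩, ⟨84, 14, 127, 178308361252⟩], [⟨168,
    129, 175, 5409967168⟩, ⟨168, 2, 243, 6617694561⟩, ⟨6, 130, 255, 5572723249387⟩, ⟨168, 20, 190,
    5404728420⟩, ⟨168, 8, 249, 5577507171⟩], [⟨168, 256, 474, 6554917924⟩, ⟨112, 33, 379,
    279279993867⟩, ⟨84, 49, 379, 209380846760⟩, ⟨168, 128, 474, 6554886180⟩, ⟨104, 140, 511,
    287014545365090⟩, ⟨113, 268, 383, 5778890133538⟩], [⟨168, 1, 559, 9769617760⟩, ⟨26, 513, 1019,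
    287179770305835⟩, ⟨0, 529, 895, 283885560762729⟩, ⟨168, 512, 633, 5581869059⟩], [⟨168, 4, 1134,
    1253124198⟩, ⟨26, 1028, 1663, 142008872183115⟩]]⟩,
  ⟨⟨10, 6422835121895208971478980665513589729762017290⟩, 1, [[]], [[], [], [], [], [], [], [⟨113,
    49, 127, 211866946561⟩], [⟨169, 4, 190, 7655753026⟩], [⟨169, 1, 429, 7795119171⟩, ⟨169, 129,
    497, 5570371719⟩, ⟨75, 321, 511, 148719688419365⟩, ⟨27, 33, 511, 148715561092106⟩, ⟨105, 289,
    511, 148641374281834⟩, ⟨144, 161, 511, 286120051058849⟩, ⟨169, 337, 371, 5571092618⟩, ⟨102, 165,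
    447, 5609464408065⟩], [⟨25, 257, 1021, 11140342158441⟩, ⟨0, 273, 1023, 6939329410729280⟩, ⟨1,
    37, 1021, 150915693775168⟩, ⟨90, 292, 1006, 2440824984905⟩]]⟩,
  ⟨⟨9, 46280084218264865028580810758848968392708⟩, 1, [[24]], [[], [], [], [], [], [], [⟨50, 33,
    127, 9766474948⟩, ⟨93, 35, 127, 69024650436⟩], [⟨170, 1, 175, 5478816802⟩, ⟨8, 129, 255,
    3441382464800⟩, ⟨52, 145, 255, 5711269531936⟩, ⟨72, 73, 255, 312632974404⟩], [⟨26, 9, 511,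
    10038514228296⟩, ⟨103, 137, 495, 8904744410400⟩, ⟨0, 3, 511, 284951991878944⟩, ⟨52, 258, 510,
    9043130223780⟩, ⟨2, 131, 511, 149642238035232⟩, ⟨114, 10, 494, 282600769577⟩, ⟨86, 138, 494,
    178277033064⟩]]⟩,
  ⟨⟨11, 847700230753596299133792592096156757971852120031764⟩, 3, [[264], [1152], []], [[], [], [],
    [], [], [], [⟨170, 73, 127, 139790914603⟩, ⟨94, 34, 127, 137509373131⟩, ⟨71, 18, 127,
    3367012518⟩, ⟨115, 3, 127, 211664537611⟩, ⟨87, 35, 127, 107376454694⟩, ⟨94, 20, 127,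
    40973176843⟩, ⟨87, 84, 127, 104359603328⟩], [⟨53, 65, 255, 69972725863⟩, ⟨116, 161, 255,
    3543426832416⟩, ⟨85, 41, 255, 7903918786720⟩, ⟨0, 2, 255, 7908242850891⟩, ⟨53, 132, 255,
    7908153691264⟩, ⟨115, 12, 254, 247132685387⟩, ⟨87, 76, 254, 142876028007⟩], [⟨171, 1, 377,
    6621765732⟩, ⟨10, 257, 511, 293816737267809⟩, ⟨4, 33, 383, 8900319516000⟩, ⟨0, 8, 510,
    9043223645227⟩, ⟨171, 260, 303, 3263534082⟩], [⟨94, 288, 1016, 243880170795⟩, ⟨171, 514, 606,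
    4405434433⟩, ⟨171, 4, 756, 7729128581⟩, ⟨61, 512, 1019, 38696753835296⟩, ⟨6, 68, 1023,
    325596343338059⟩], [⟨6, 130, 2046, 2613715508857899⟩, ⟨94, 576, 2032, 279348287819⟩]]⟩,
  ⟨⟨10, 7850085536621288037525545774966925662013947914⟩, 1, [[68]], [[], [], [], [], [], [], [⟨95,
    17, 127, 1151439045⟩], [⟨172, 1, 237, 7694456899⟩, ⟨117, 193, 255, 7736513364292⟩, ⟨116, 33,
    191, 139627498506⟩, ⟨85, 133, 239, 211629906986⟩, ⟨90, 37, 255, 7903991958592⟩], [⟨172, 64, 374,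
    1151541412⟩, ⟨6, 5, 511, 352053168936072⟩, ⟨117, 261, 447, 7972644262048⟩], [⟨5, 128, 958,
    11031761098024⟩, ⟨0, 641, 1023, 9150177813210438⟩, ⟨172, 257, 917, 2282038504⟩]]⟩,
  ⟨⟨9, 33347775825501836200188269035837040361568⟩, 1, [[8]], [[], [], [], [], [], [], [], [⟨53, 17,
    223, 9770701025⟩, ⟨96, 21, 223, 206463635681⟩], [⟨173, 1, 349, 4405076038⟩, ⟨11, 257, 479,
    3543416381728⟩, ⟨55, 385, 479, 4441066642720⟩, ⟨109, 5, 511, 250732750048453⟩, ⟨0, 261, 511,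
    5610510812295⟩]]⟩,
  ⟨⟨8, 10387287580981276463827879891107850⟩, 1, [[132]], [[], [], [], [], [], [], [⟨118, 33, 127,
    139626449928⟩, ⟨173, 81, 127, 37721475240⟩, ⟨90, 37, 127, 207235391652⟩], [⟨174, 1, 231,
    5578431553⟩, ⟨12, 129, 255, 6739947716871⟩, ⟨3, 65, 255, 8799486411847⟩, ⟨0, 193, 255,
    138786572391⟩, ⟨56, 145, 255, 5600710791431⟩, ⟨7, 5, 255, 7908213426432⟩, ⟨94, 69, 255,
    7839492014120⟩]]⟩,
  ⟨⟨9, 21778279198266195451902809254910999920668⟩, 1, [[2]], [[], [], [], [], [], [], [⟨91, 33, 127,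
    209417406633⟩], [⟨75, 129, 253, 210623270121⟩, ⟨75, 65, 253, 244983008457⟩], [⟨175, 1, 459,
    8800705571⟩, ⟨175, 257, 413, 7625543744⟩, ⟨95, 193, 495, 8832603563207⟩]]⟩,
  ⟨⟨8, 540010599234597124294861493172437004⟩, 1, [[2]], [[], [], [], [], [], [], [⟨76, 17, 127,
    40874675208⟩], [⟨0, 1, 255, 8830560833733⟩, ⟨76, 129, 239, 40874773512⟩, ⟨76, 65, 223,
    41980987400⟩, ⟨76, 33, 191, 41980954632⟩]]⟩]

/-- The four induced subgraphs formed by a 5-cycle `0, …, 4`, a neighbour `5` of `0` and a neighbour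
`6` of `2` which are adjacent, with evidence that `0` has no further neighbour. -/
def connectedCycles : List (Config × List (List Witness)) := [
  (⟨7, 2852292430857817430744686198834⟩, [[], [], [], [], [], [], [⟨177, 1, 123, 6613501152⟩,
    ⟨57, 65, 127, 107410030759⟩, ⟨57, 9, 127, 211562889351⟩,
    ⟨121, 73, 127, 178309307492⟩]]),
  (⟨7, 2852302102264383354977338589234⟩, [[], [], [], [], [], [], [⟨2, 1, 127, 241665414148⟩,
    ⟨121, 65, 127, 140728341703⟩, ⟨100, 9, 127, 75330846855⟩, ⟨93, 73, 127, 36713896964⟩,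
    ⟨77, 5, 127, 207306626148⟩]]),
  (⟨7, 4119943032266638452958800707634⟩, [[], [], [], [], [], [], [⟨2, 1, 127, 241662365701⟩,
    ⟨100, 65, 127, 72076165287⟩, ⟨121, 9, 127, 178309304423⟩, ⟨93, 73, 127, 36612283397⟩,
    ⟨77, 5, 127, 104227410117⟩]]),
  (⟨7, 4119952703673204377191453098034⟩, [[], [], [], [], [], [], [⟨90, 1, 127, 241597286595⟩,
    ⟨93, 65, 127, 36613328903⟩, ⟨93, 9, 127, 36713893895⟩, ⟨87, 73, 127, 172945936391⟩,
    ⟨0, 5, 127, 211664568359⟩]])]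

theorem reducible_check : checkAll [wagner, forkConfig] reducible = true := by decide +kernel

theorem connectedCycles_check :
    connectedCycles.all
      (classifies (known [wagner, forkConfig] reducible) fun T => !T.testBit 0) = true := by
  decide +kernel

section Conclusion

variable {V : Type} {G : SimpleGraph V}

theorem exists_connectedCycles_emb (hG : ∀ x y z, G.Adj x y → G.Adj y z → G.Adj x z → False)
    {p : Fin 5 → V} (hp : IsC5 G p) {a b : V} (ha : G.Adj (p 0) a) (hac : a ∉ Set.range p)
    (hb : G.Adj (p 2) b) (hbc : b ∉ Set.range p) (hab : G.Adj a b) :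
    ∃ r ∈ connectedCycles, r.1.Emb G fun i => [p 0, p 1, p 2, p 3, p 4, a, b].getD i b := by
  have hne : ∀ i j : Fin 5, i ≠ j → p i ≠ p j := fun i j hij h => hij (hp.1 h)
  have ha' : ∀ i, a ≠ p i := fun i h => hac ⟨i, h.symm⟩
  have hb' : ∀ i, b ≠ p i := fun i h => hbc ⟨i, h.symm⟩
  have h01 : G.Adj (p 0) (p 1) := hp.2 0
  have h12 : G.Adj (p 1) (p 2) := hp.2 1
  have h23 : G.Adj (p 2) (p 3) := hp.2 2
  have h34 : G.Adj (p 3) (p 4) := hp.2 3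
  have h40 : G.Adj (p 4) (p 0) := hp.2 4
  have n20 : ¬ G.Adj (p 2) (p 0) := fun h => hG _ _ _ h01 h12 h.symm
  have n31 : ¬ G.Adj (p 3) (p 1) := fun h => hG _ _ _ h12 h23 h.symm
  have n42 : ¬ G.Adj (p 4) (p 2) := fun h => hG _ _ _ h23 h34 h.symm
  have n30 : ¬ G.Adj (p 3) (p 0) := fun h => hG _ _ _ h34 h40 h
  have n41 : ¬ G.Adj (p 4) (p 1) := fun h => hG _ _ _ h40 h01 h
  have na1 : ¬ G.Adj a (p 1) := fun h => hG _ _ _ ha h h01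
  have na4 : ¬ G.Adj a (p 4) := fun h => hG _ _ _ ha h h40.symm
  have na2 : ¬ G.Adj a (p 2) := fun h => hG _ _ _ h hb hab
  have nb1 : ¬ G.Adj b (p 1) := fun h => hG _ _ _ hb h h12.symm
  have nb3 : ¬ G.Adj b (p 3) := fun h => hG _ _ _ hb h h23
  have nb0 : ¬ G.Adj b (p 0) := fun h => hG _ _ _ hab h ha.symm
  have pairs : ∀ r ∈ connectedCycles, (r.1.adj 5 3 = true ↔ G.Adj a (p 3)) →
      (r.1.adj 6 4 = true ↔ G.Adj b (p 4)) →
      r.1.Emb G fun i => [p 0, p 1, p 2, p 3, p 4, a, b].getD i b := by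
    intro r hr h53 h64 i hi j hj
    have fixed : ∀ r ∈ connectedCycles, r.1.n = 7 ∧ ∀ i j : Fin 7, j < i →
        ¬ (i.1 = 5 ∧ j.1 = 3) → ¬ (i.1 = 6 ∧ j.1 = 4) →
        r.1.adj i j = Config.adj ⟨7, 2852292430857817430744686198834⟩ i j := by
      decide +kernel
    obtain ⟨hn, hadj⟩ := fixed r hr
    rw [hn] at hi
    replace hadj := hadj ⟨i, hi⟩ ⟨j, hj.trans hi⟩ hj
    dsimp only at hadj
    generalize r.1.adj = A at h53 h64 hadj ⊢
    interval_cases i <;> interval_cases j <;>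
      refine ⟨by first | exact hne _ _ (by decide) | exact ha' _ | exact hb' _ | exact hab.ne', ?_⟩
    all_goals first
      | exact h53
      | exact h64
      | refine iff_of_true ((hadj (by decide) (by decide)).trans (by decide +kernel)) ?_
        first | assumption | (refine SimpleGraph.Adj.symm ?_; assumption)
      | refine iff_of_false (ne_of_eq_of_ne (hadj (by decide) (by decide)) (by decide +kernel)) ?_
        assumption
  have codes : ∀ u v : Bool, ∃ r ∈ connectedCycles, r.1.adj 5 3 = u ∧ r.1.adj 6 4 = v := by
    decide +kernel
  classical
  obtain ⟨r, hr, h53, h64⟩ := codes (decide (G.Adj a (p 3))) (decide (G.Adj b (p 4)))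
  exact ⟨r, hr, pairs r hr (by rw [h53, decide_eq_true_eq]) (by rw [h64, decide_eq_true_eq])⟩

theorem not_adj_of_four_le_degree [Fintype V] [DecidableRel G.Adj] (hG : MinCex G)
    {p : Fin 5 → V} (hp : IsC5 G p) (hdeg : 4 ≤ G.degree (p 0)) {a b : V} (ha : G.Adj (p 0) a)
    (hac : a ∉ Set.range p) (hb : G.Adj (p 2) b) (hbc : b ∉ Set.range p) : ¬ G.Adj a b := by
  classical
  intro hab
  have htri : ∀ x y z, G.Adj x y → G.Adj y z → G.Adj x z → False := fun _ _ _ => hG.triangle_free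
  obtain ⟨r, hr, hemb⟩ := exists_connectedCycles_emb htri hp ha hac hb hbc hab
  have hn : ∀ r ∈ connectedCycles, r.1.n = 7 := by decide
  obtain ⟨z, hz, hz'⟩ := Finset.exists_mem_notMem_of_card_lt_card
    (s := {p 1, p 4, a}) (t := G.neighborFinset (p 0))
    (Finset.card_le_three.trans_lt (by rw [G.card_neighborFinset_eq_degree]; omega))
  rw [SimpleGraph.mem_neighborFinset] at hz
  simp only [Finset.mem_insert, Finset.mem_singleton, not_or] at hz'
  have hdb := checkAll_sound hG (by simpa using ⟨wagner_absent hG, forkConfig_absent hG.2.1⟩)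
    reducible_check
  obtain ⟨T, hT, hleaf⟩ := classifies_sound htri hdb
    (List.all_eq_true.mp connectedCycles_check r hr) hemb (u := z) (by
      intro i hi
      rw [hn r hr] at hi
      interval_cases i
      · exact hz.ne
      · exact fun h => hz'.1 h.symm
      · rintro rfl
        exact htri _ _ _ (hp.2 0) (hp.2 1) hz
      · rintro rfl
        exact htri _ _ _ (hp.2 3) (hp.2 4) hz.symm
      · exact fun h => hz'.2.1 h.symm
      · exact fun h => hz'.2.2 h.symm
      · rintro rfl
        exact htri _ _ _ ha hab hz)
  rw [(hT.1 0 (by rw [hn r hr]; omega)).mpr hz.symm] at hleaf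
  exact absurd hleaf (by decide)

end Conclusion

end Reduction

theorem minCex_distance_two_no_connection {V : Type} [Fintype V]
    (G : SimpleGraph V) [DecidableRel G.Adj]
    (hG : MinCex G) (c : Fin 5 → V) (hc : GoodC5 G c)
    (hdeg : ¬ ∃ i : Fin 5, G.degree (c i) = 3 ∧ G.degree (c (i + 1)) = 3)
    (i j : Fin 5) (hj1 : j ≠ i - 1) (hj2 : j ≠ i) (hj3 : j ≠ i + 1)
    (hi4 : 4 ≤ G.degree (c i)) (a b : V)
    (ha : G.Adj (c i) a) (hac : a ∉ Set.range c)
    (hb : G.Adj (c j) b) (hbc : b ∉ Set.range c) :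
    ¬ G.Adj a b := by
  obtain ⟨hinj, hcyc⟩ := hc.1
  have hrange : ∀ (q : Fin 5 → Fin 5) (x : V), x ∉ Set.range c → x ∉ Set.range (c ∘ q) :=
    fun q x hx h => hx (Set.range_comp_subset_range q c h)
  have hj : j = i + 2 ∨ j = i - 2 := by
    clear hi4 ha hb
    revert i j
    decide
  rcases hj with rfl | rfl
  · refine Reduction.not_adj_of_four_le_degree hG (p := c ∘ fun k => i + k)
      ⟨hinj.comp (add_right_injective i), fun k => ?_⟩ ?_ ?_ (hrange _ a hac) hb (hrange _ b hbc)
    · simpa only [Function.comp_apply, add_assoc] using hcyc (i + k)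
    · rwa [Function.comp_apply, add_zero]
    · simpa using ha
  · refine Reduction.not_adj_of_four_le_degree hG (p := c ∘ fun k => i - k)
      ⟨hinj.comp (sub_right_injective (b := i)), fun k => ?_⟩ ?_ ?_ (hrange _ a hac) hb
      (hrange _ b hbc)
    · have := hcyc (i - (k + 1))
      rw [sub_add_eq_sub_sub, sub_add_cancel] at this
      simpa only [Function.comp_apply, sub_add_eq_sub_sub] using this.symm
    · rwa [Function.comp_apply, sub_zero]
    · simpa using ha
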